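/- Let c satisfy (B0)–(B3) and (B2s). If u is a c-convex solution of: λ ≤ |∂ᶜu| ≤ 1/λ on an open set U^λ ⊂ U and |∂ᶜu| ≤ Λ on cl U, then u is strictly c-convex on U^λ, meaning ∂ᶜu(x) and ∂ᶜu(x̃) are disjoint whenever x, x̃ ∈ U^λ are distinct. -/

import Mathlib

open Set MeasureTheory Metric Bornology
open scoped ENNReal NNReal Pointwise

noncomputable section

abbrev Euc (n : ℕ) := EuclideanSpace ℝ (Fin n)

/-- Partial gradient of the cost in the first variable: `D_x c(x,y)`. -/
noncomputable def gradX (n : ℕ) (c : Euc n → Euc n → ℝ) (x y : Euc n) : Euc n :=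
  gradient (fun x' => c x' y) x

/-- Partial gradient of the cost in the second variable: `D_y c(x,y)`. -/
noncomputable def gradY (n : ℕ) (c : Euc n → Euc n → ℝ) (x y : Euc n) : Euc n :=
  gradient (fun y' => c x y') y

/-- Mixed second derivative `D²_{xy} c` as a continuous linear map. -/
noncomputable def DxyC (n : ℕ) (c : Euc n → Euc n → ℝ) (x y : Euc n) : Euc n →L[ℝ] Euc n :=
  fderiv ℝ (fun x' => gradY n c x' y) x

/-- Second derivative `D²_{xx} c`. -/
noncomputable def DxxC (n : ℕ) (c : Euc n → Euc n → ℝ) (x y : Euc n) : Euc n →L[ℝ] Euc n :=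
  fderiv ℝ (fun x' => gradX n c x' y) x

/-- Third derivative `D²_{xx} D_y c`. -/
noncomputable def DxxyC (n : ℕ) (c : Euc n → Euc n → ℝ) (x y : Euc n) :
    Euc n →L[ℝ] Euc n →L[ℝ] Euc n :=
  fderiv ℝ (fun x' => DxyC n c x' y) x

/-- `β⁺_c = ‖D²_{xy} c‖_{L∞(U×V)}`. -/
noncomputable def betaPlus (n : ℕ) (c : Euc n → Euc n → ℝ) (U V : Set (Euc n)) : ℝ :=
  sSup ((fun p : Euc n × Euc n => ‖DxyC n c p.1 p.2‖) '' (U ×ˢ V))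

/-- `β⁻_c = ‖(D²_{xy} c)⁻¹‖_{L∞(U×V)}`. -/
noncomputable def betaMinus (n : ℕ) (c : Euc n → Euc n → ℝ) (U V : Set (Euc n)) : ℝ :=
  sSup ((fun p : Euc n × Euc n => ‖(DxyC n c p.1 p.2).inverse‖) '' (U ×ˢ V))

/-- `γ⁺_c = ‖det D²_{xy} c‖_{L∞(U×V)}`. -/
noncomputable def gammaPlus (n : ℕ) (c : Euc n → Euc n → ℝ) (U V : Set (Euc n)) : ℝ :=
  sSup ((fun p : Euc n × Euc n =>
    |LinearMap.det ((DxyC n c p.1 p.2 : Euc n →L[ℝ] Euc n) : Euc n →ₗ[ℝ] Euc n)|) '' (U ×ˢ V))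

/-- `γ⁻_c = ‖(det D²_{xy} c)⁻¹‖_{L∞(U×V)}`. -/
noncomputable def gammaMinus (n : ℕ) (c : Euc n → Euc n → ℝ) (U V : Set (Euc n)) : ℝ :=
  sSup ((fun p : Euc n × Euc n =>
    |LinearMap.det ((DxyC n c p.1 p.2 : Euc n →L[ℝ] Euc n) : Euc n →ₗ[ℝ] Euc n)|⁻¹) '' (U ×ˢ V))

noncomputable def supDxx (n : ℕ) (c : Euc n → Euc n → ℝ) (U V : Set (Euc n)) : ℝ :=
  sSup ((fun p : Euc n × Euc n => ‖DxxC n c p.1 p.2‖) '' (U ×ˢ V))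

noncomputable def supDx (n : ℕ) (c : Euc n → Euc n → ℝ) (U V : Set (Euc n)) : ℝ :=
  sSup ((fun p : Euc n × Euc n => ‖gradX n c p.1 p.2‖) '' (U ×ˢ V))

noncomputable def supDxxy (n : ℕ) (c : Euc n → Euc n → ℝ) (U V : Set (Euc n)) : ℝ :=
  sSup ((fun p : Euc n × Euc n => ‖DxxyC n c p.1 p.2‖) '' (U ×ˢ V))

/-- The constant `M_c` from Theorem 4.3. -/
noncomputable def Mconst (n : ℕ) (c : Euc n → Euc n → ℝ) (U V : Set (Euc n)) : ℝ :=
  (betaMinus n c U V) ^ 2 * supDxx n c U V +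
    (betaMinus n c U V) ^ 3 * supDx n c U V * supDxxy n c U V

/-- The constant `ε_c` of Lemma 6.1: `1/ε_c = 2 (β⁺)⁴ (β⁻)⁶ ‖D³_{xxy} c‖_∞`. -/
noncomputable def epsC (n : ℕ) (c : Euc n → Euc n → ℝ) (U V : Set (Euc n)) : ℝ :=
  (2 * (betaPlus n c U V) ^ 4 * (betaMinus n c U V) ^ 6 * supDxxy n c U V)⁻¹

/-- Condition (B0). -/
def B0cond (n : ℕ) (c : Euc n → Euc n → ℝ) (U V : Set (Euc n)) : Prop :=
  IsOpen U ∧ IsBounded U ∧ IsOpen V ∧ IsBounded V ∧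
    ContDiffOn ℝ 4 (Function.uncurry c) (closure U ×ˢ closure V)

/-- `f` is a (C¹-) diffeomorphism from `S` onto its range. -/
def DiffeoOnto (n : ℕ) (f : Euc n → Euc n) (S : Set (Euc n)) : Prop :=
  Set.InjOn f S ∧ ContDiffOn ℝ 1 f S ∧ ContDiffOn ℝ 1 (Function.invFunOn f S) (f '' S)

/-- Condition (B1) (bi-twist). -/
def B1cond (n : ℕ) (c : Euc n → Euc n → ℝ) (U V : Set (Euc n)) : Prop :=
  (∀ y ∈ closure V, DiffeoOnto n (fun x => -gradY n c x y) (closure U)) ∧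
  (∀ x ∈ closure U, DiffeoOnto n (fun y => -gradX n c x y) (closure V))

/-- `U_ȳ := -D_y c(U, ȳ)`. -/
def Uyset (n : ℕ) (c : Euc n → Euc n → ℝ) (U : Set (Euc n)) (ybar : Euc n) : Set (Euc n) :=
  (fun x => -gradY n c x ybar) '' U

/-- `V_x̄ := -D_x c(x̄, V)`. -/
def Vxset (n : ℕ) (c : Euc n → Euc n → ℝ) (V : Set (Euc n)) (xbar : Euc n) : Set (Euc n) :=
  (fun y => -gradX n c xbar y) '' V

/-- Condition (B2) (bi-convexity). -/
def B2cond (n : ℕ) (c : Euc n → Euc n → ℝ) (U V : Set (Euc n)) : Prop :=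
  (∀ y ∈ closure V, Convex ℝ (Uyset n c U y)) ∧ (∀ x ∈ closure U, Convex ℝ (Vxset n c V x))

/-- A strongly convex set: each boundary point is touched from outside by a sphere of
radius `R` enclosing the set. -/
def StronglyConvexSet (n : ℕ) (Q : Set (Euc n)) : Prop :=
  Convex ℝ Q ∧ ∃ R : ℝ, 0 < R ∧ ∀ x ∈ frontier Q, ∃ z : Euc n, dist x z = R ∧ Q ⊆ closedBall z R

/-- Condition (B2s). -/
def B2scond (n : ℕ) (c : Euc n → Euc n → ℝ) (U V : Set (Euc n)) : Prop :=
  (∀ y ∈ closure V, StronglyConvexSet n (Uyset n c U y)) ∧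
  (∀ x ∈ closure U, StronglyConvexSet n (Vxset n c V x))

/-- An affinely parameterized line segment on `[-1,1]`. -/
def IsAffineSeg (n : ℕ) (F : ℝ → Euc n × Euc n) : Prop :=
  ∃ a b : Euc n × Euc n, ∀ t ∈ Icc (-1 : ℝ) 1, F t = a + t • b

/-- `∂²/∂s∂t c(x(s), y(t))` at `(0,0)`. -/
noncomputable def crossDiff2 (n : ℕ) (c : Euc n → Euc n → ℝ) (x y : ℝ → Euc n) : ℝ :=
  deriv (fun s => deriv (fun t => c (x s) (y t)) 0) 0

/-- `∂⁴/∂s²∂t² c(x(s), y(t))` at `(0,0)`. -/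
noncomputable def crossDiff4 (n : ℕ) (c : Euc n → Euc n → ℝ) (x y : ℝ → Euc n) : ℝ :=
  deriv (deriv (fun s => deriv (deriv (fun t => c (x s) (y t))) 0)) 0

/-- Condition (B3) (= A3w). -/
def B3cond (n : ℕ) (c : Euc n → Euc n → ℝ) (U V : Set (Euc n)) : Prop :=
  ∀ x y : ℝ → Euc n, (∀ t ∈ Icc (-1 : ℝ) 1, x t ∈ closure U) →
    (∀ t ∈ Icc (-1 : ℝ) 1, y t ∈ closure V) →
    IsAffineSeg n (fun t => (gradY n c (x t) (y 0), gradX n c (x 0) (y t))) →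
    crossDiff2 n c x y = 0 → crossDiff4 n c x y ≤ 0

/-- Condition (B4) (non-negative cross-curvature). -/
def B4cond (n : ℕ) (c : Euc n → Euc n → ℝ) (U V : Set (Euc n)) : Prop :=
  ∀ x y : ℝ → Euc n, (∀ t ∈ Icc (-1 : ℝ) 1, x t ∈ closure U) →
    (∀ t ∈ Icc (-1 : ℝ) 1, y t ∈ closure V) →
    IsAffineSeg n (fun t => (gradY n c (x t) (y 0), gradX n c (x 0) (y t))) →
    crossDiff4 n c x y ≤ 0

/-- The `c*`-transform `u^{c*}(y) = sup_{x ∈ A} (-c(x,y) - u(x))`. -/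
noncomputable def cStarT (n : ℕ) (c : Euc n → Euc n → ℝ) (A : Set (Euc n)) (u : Euc n → ℝ)
    (y : Euc n) : ℝ :=
  sSup ((fun x => -c x y - u x) '' A)

/-- `u` is `c`-convex on `A` (relative to the target set `B`): `u = (u^{c*})^c`. -/
def CConvexOn (n : ℕ) (c : Euc n → Euc n → ℝ) (A B : Set (Euc n)) (u : Euc n → ℝ) : Prop :=
  ∀ x ∈ A, u x = sSup ((fun y => -c x y - cStarT n c A u y) '' B)

/-- The `c`-subdifferential `∂ᶜu ⊂ A × B`. -/
def cSubdiff (n : ℕ) (c : Euc n → Euc n → ℝ) (A B : Set (Euc n)) (u : Euc n → ℝ) :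
    Set (Euc n × Euc n) :=
  {p | p.1 ∈ A ∧ p.2 ∈ B ∧ u p.1 + cStarT n c A u p.2 + c p.1 p.2 = 0}

def cSubdiffAt (n : ℕ) (c : Euc n → Euc n → ℝ) (A B : Set (Euc n)) (u : Euc n → ℝ)
    (x : Euc n) : Set (Euc n) :=
  {y | (x, y) ∈ cSubdiff n c A B u}

def cSubdiffImg (n : ℕ) (c : Euc n → Euc n → ℝ) (A B : Set (Euc n)) (u : Euc n → ℝ)
    (X : Set (Euc n)) : Set (Euc n) :=
  ⋃ x ∈ X, cSubdiffAt n c A B u x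

/-- `∂^{c*}u^{c*}(Y) = {x : ∃ y ∈ Y, (x,y) ∈ ∂ᶜu}`. -/
def cSubdiffPre (n : ℕ) (c : Euc n → Euc n → ℝ) (A B : Set (Euc n)) (u : Euc n → ℝ)
    (Y : Set (Euc n)) : Set (Euc n) :=
  {x | ∃ y ∈ Y, (x, y) ∈ cSubdiff n c A B u}

/-- `|∂ᶜu| ≥ lam` on `S`. -/
def MAge (n : ℕ) (c : Euc n → Euc n → ℝ) (A B : Set (Euc n)) (u : Euc n → ℝ) (lam : ℝ)
    (S : Set (Euc n)) : Prop :=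
  ∀ X : Set (Euc n), X ⊆ S → MeasurableSet X →
    ENNReal.ofReal lam * volume X ≤ volume (cSubdiffImg n c A B u X)

/-- `|∂ᶜu| ≤ lam` on `S`. -/
def MAle (n : ℕ) (c : Euc n → Euc n → ℝ) (A B : Set (Euc n)) (u : Euc n → ℝ) (lam : ℝ)
    (S : Set (Euc n)) : Prop :=
  ∀ X : Set (Euc n), X ⊆ S → MeasurableSet X →
    volume (cSubdiffImg n c A B u X) ≤ ENNReal.ofReal lam * volume X

/-- The inverse of the cost-exponential coordinate change `q(x) = -D_y c(x, ȳ)`. -/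
noncomputable def xOf (n : ℕ) (c : Euc n → Euc n → ℝ) (U : Set (Euc n)) (ybar : Euc n) :
    Euc n → Euc n :=
  Function.invFunOn (fun x => -gradY n c x ybar) (closure U)

/-- `cl U_ȳ := -D_y c(cl U, ȳ)`. -/
def clUy (n : ℕ) (c : Euc n → Euc n → ℝ) (U : Set (Euc n)) (ybar : Euc n) : Set (Euc n) :=
  (fun x => -gradY n c x ybar) '' closure U

/-- The modified cost `c̃(q,y) = c(x(q), y) - c(x(q), ȳ)`. -/
noncomputable def modCost (n : ℕ) (c : Euc n → Euc n → ℝ) (U : Set (Euc n)) (ybar : Euc n)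
    (q y : Euc n) : ℝ :=
  c (xOf n c U ybar q) y - c (xOf n c U ybar q) ybar

/-- The modified potential `ũ(q) = u(x(q)) + c(x(q), ȳ)`. -/
noncomputable def modPot (n : ℕ) (c : Euc n → Euc n → ℝ) (U : Set (Euc n)) (ybar : Euc n)
    (u : Euc n → ℝ) (q : Euc n) : ℝ :=
  u (xOf n c U ybar q) + c (xOf n c U ybar q) ybar

/-- The `c̃`-cone generated by `qt` and `Q` with height `-h0 > 0`. -/
noncomputable def cConeFun (n : ℕ) (ct : Euc n → Euc n → ℝ) (B Q : Set (Euc n)) (qt : Euc n)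
    (h0 : ℝ) (q : Euc n) : ℝ :=
  sSup {r : ℝ | ∃ y ∈ B, r = -ct q y + ct qt y + h0 ∧
    ∀ p ∈ frontier Q, -ct p y + ct qt y + h0 ≤ 0}

/-- The ordinary subdifferential `∂u(x)` relative to a domain `A`. -/
def subdiffAt (n : ℕ) (A : Set (Euc n)) (u : Euc n → ℝ) (x : Euc n) : Set (Euc n) :=
  {p | ∀ ε > 0, ∃ δ > 0, ∀ x' ∈ A, ‖x' - x‖ < δ →
    u x + @inner ℝ _ _ p (x' - x) - ε * ‖x' - x‖ ≤ u x'}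

/-- The dual norm `‖v‖*_K = sup_{w ∈ K} ⟨w, v⟩`. -/
noncomputable def dualNorm (n : ℕ) (K : Set (Euc n)) (v : Euc n) : ℝ :=
  sSup ((fun w => (@inner ℝ _ _ w v : ℝ)) '' K)

/-- The section `S(x̄, ȳ, τ)`. -/
def sectS (n : ℕ) (c : Euc n → Euc n → ℝ) (U : Set (Euc n)) (u : Euc n → ℝ)
    (xbar ybar : Euc n) (τ : ℝ) : Set (Euc n) :=
  {x ∈ U | u x ≤ u xbar - c x ybar + c xbar ybar + τ}

/-- The measure with density `f` restricted to `A`. -/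
noncomputable def densMeasure (n : ℕ) (A : Set (Euc n)) (f : Euc n → ℝ) : Measure (Euc n) :=
  (volume.restrict A).withDensity fun x => ENNReal.ofReal (f x)

end

section Part1
open Set MeasureTheory Metric Bornology
open scoped ENNReal NNReal Pointwise

/-! ### One dimensional differential inequality -/

structure DIneq (C : ℝ) (f φ ψ : ℝ → ℝ) : Prop where
  hC : 0 ≤ C
  h1 : ∀ t ∈ Icc (0:ℝ) 1, HasDerivAt f (φ t) t
  h2 : ∀ t ∈ Icc (0:ℝ) 1, HasDerivAt φ (ψ t) t
  h3 : ∀ t ∈ Icc (0:ℝ) 1, - C * |φ t| ≤ ψ t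

theorem DIneq.comparison {C : ℝ} {f φ ψ : ℝ → ℝ} (H : DIneq C f φ ψ) {k t0 t : ℝ} (hk : k ≤ 0)
    (ht0 : 0 ≤ t0) (htt : t0 ≤ t) (ht1 : t ≤ 1) (h0 : k * Real.exp (C * t0) ≤ φ t0) :
    k * Real.exp (C * t) ≤ φ t := by
  have key : ∀ ε > 0, -φ t ≤ (-k + ε) * Real.exp ((C + ε) * t) := by
    intro ε hε
    have hB : ∀ x, HasDerivAt (fun x => (-k + ε) * Real.exp ((C + ε) * x))
        ((-k + ε) * (Real.exp ((C + ε) * x) * ((C + ε) * 1))) x := fun x =>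
      (((hasDerivAt_id x).const_mul (C + ε)).exp).const_mul _
    have sub : ∀ x ∈ Icc t0 t, x ∈ Icc (0:ℝ) 1 := fun x hx => ⟨ht0.trans hx.1, hx.2.trans ht1⟩
    refine image_le_of_deriv_right_lt_deriv_boundary (f := fun x => -φ x) (f' := fun x => -ψ x)
      (a := t0) (b := t) ?_ ?_ ?_ hB ?_ ⟨htt, le_rfl⟩
    · intro x hx
      exact (H.h2 x (sub x hx)).neg.continuousAt.continuousWithinAt
    · intro x hx
      exact (H.h2 x (sub x ⟨hx.1, hx.2.le⟩)).neg.hasDerivWithinAt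
    · have e1 : Real.exp (C * t0) ≤ Real.exp ((C + ε) * t0) := by
        apply Real.exp_le_exp.2; nlinarith
      have e2 := Real.exp_pos (C * t0)
      have e3 := Real.exp_pos ((C + ε) * t0)
      show -φ t0 ≤ (-k + ε) * Real.exp ((C + ε) * t0)
      nlinarith
    · intro x hx hfx
      have h3 := H.h3 x (sub x ⟨hx.1, hx.2.le⟩)
      have e3 := Real.exp_pos ((C + ε) * x)
      have hfx' : -φ x = (-k + ε) * Real.exp ((C + ε) * x) := hfx
      have hp : 0 < -φ x := by rw [hfx']; apply mul_pos <;> linarith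
      rw [abs_of_neg (by linarith)] at h3
      have : (-k + ε) * (Real.exp ((C + ε) * x) * ((C + ε) * 1)) = (C + ε) * (-φ x) := by
        rw [hfx']; ring
      rw [this]
      nlinarith
  have lim : Filter.Tendsto (fun ε => (-k + ε) * Real.exp ((C + ε) * t)) (nhdsWithin 0 (Ioi 0))
      (nhds ((-k + 0) * Real.exp ((C + 0) * t))) := by
    apply Filter.Tendsto.mono_left _ nhdsWithin_le_nhds
    apply Continuous.tendsto
    fun_prop
  have := ge_of_tendsto lim (Filter.eventually_of_mem self_mem_nhdsWithin (fun ε hε => key ε hε))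
  simp only [add_zero] at this
  linarith

theorem DIneq.nonneg {C : ℝ} {f φ ψ : ℝ → ℝ} (H : DIneq C f φ ψ) {t0 t : ℝ}
    (ht0 : 0 ≤ t0) (htt : t0 ≤ t) (ht1 : t ≤ 1) (h0 : 0 ≤ φ t0) : 0 ≤ φ t := by
  have := H.comparison (k := 0) le_rfl ht0 htt ht1 (by simpa using h0)
  simpa using this

theorem DIneq.mvt {C : ℝ} {f φ ψ : ℝ → ℝ} (H : DIneq C f φ ψ) {a b : ℝ}
    (ha : 0 ≤ a) (hab : a < b) (hb : b ≤ 1) : ∃ t ∈ Ioo a b, f b - f a = φ t * (b - a) := by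
  have sub : ∀ x ∈ Icc a b, x ∈ Icc (0:ℝ) 1 := fun x hx => ⟨ha.trans hx.1, hx.2.trans hb⟩
  obtain ⟨t, ht, h⟩ := exists_hasDerivAt_eq_slope f φ hab
    (fun x hx => (H.h1 x (sub x hx)).continuousAt.continuousWithinAt)
    (fun x hx => H.h1 x (sub x ⟨hx.1.le, hx.2.le⟩))
  refine ⟨t, ht, ?_⟩
  rw [h]; field_simp [sub_ne_zero.2 hab.ne']

theorem DIneq.D2 {C : ℝ} {f φ ψ : ℝ → ℝ} (H : DIneq C f φ ψ) (h0 : φ 0 ≤ 0) :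
    Real.exp C * φ 0 ≤ f 1 - f 0 := by
  obtain ⟨t, ht, h⟩ := H.mvt le_rfl one_pos le_rfl
  have := H.comparison h0 le_rfl ht.1.le ht.2.le (by simp)
  have e : Real.exp (C * t) ≤ Real.exp C := Real.exp_le_exp.2 (by nlinarith [H.hC, ht.2])
  rw [h]; nlinarith

theorem DIneq.D1 {C : ℝ} {f φ ψ : ℝ → ℝ} (H : DIneq C f φ ψ) (h0 : 0 ≤ φ 0) :
    Real.exp (-C) * φ 0 ≤ f 1 - f 0 := by
  obtain ⟨t, ht, h⟩ := H.mvt le_rfl one_pos le_rfl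
  have mono : MonotoneOn (fun t => φ t * Real.exp (C * t)) (Icc 0 1) := by
    have hd : ∀ x ∈ Icc (0:ℝ) 1, HasDerivAt (fun t => φ t * Real.exp (C * t))
        (ψ x * Real.exp (C * x) + φ x * (Real.exp (C * x) * (C * 1))) x := fun x hx =>
      (H.h2 x hx).mul (((hasDerivAt_id x).const_mul C).exp)
    refine monotoneOn_of_deriv_nonneg (convex_Icc 0 1)
      (fun x hx => (hd x hx).continuousAt.continuousWithinAt) (fun x hx => ?_) (fun x hx => ?_)
    · exact (hd x (interior_subset hx)).differentiableAt.differentiableWithinAt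
    · have hx' := interior_subset hx
      rw [(hd x hx').deriv]
      have h3 := H.h3 x hx'
      rw [abs_of_nonneg (H.nonneg le_rfl hx'.1 hx'.2 h0)] at h3
      have := Real.exp_pos (C * x)
      nlinarith
  have := mono (left_mem_Icc.2 zero_le_one) ⟨ht.1.le, ht.2.le⟩ ht.1.le
  simp only [mul_zero, Real.exp_zero, mul_one] at this
  have hn := H.nonneg le_rfl ht.1.le ht.2.le h0
  have e : Real.exp (C * t) ≤ Real.exp C := Real.exp_le_exp.2 (by nlinarith [H.hC, ht.2])
  have e1 : φ 0 ≤ φ t * Real.exp C := this.trans (by gcongr)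
  rw [h, Real.exp_neg]
  have := Real.exp_pos C
  rw [inv_mul_le_iff₀ this]; linarith

theorem DIneq.D3 {C : ℝ} {f φ ψ : ℝ → ℝ} (H : DIneq C f φ ψ) {t : ℝ} (ht : t ∈ Icc (0:ℝ) 1) :
    f t ≤ max (f 0) (f 1) := by
  by_contra hcon
  push Not at hcon
  have h0 : f 0 < f t := lt_of_le_of_lt (le_max_left _ _) hcon
  have h1 : f 1 < f t := lt_of_le_of_lt (le_max_right _ _) hcon
  have ht0 : 0 < t := lt_of_le_of_ne ht.1 (by rintro rfl; exact lt_irrefl _ h0)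
  have ht1 : t < 1 := lt_of_le_of_ne ht.2 (by rintro rfl; exact lt_irrefl _ h1)
  obtain ⟨s, hs, e1⟩ := H.mvt le_rfl ht0 ht.2
  obtain ⟨r, hr, e2⟩ := H.mvt ht.1 ht1 le_rfl
  have hps : 0 ≤ φ s := by
    by_contra hn; push Not at hn; nlinarith
  have := H.nonneg hs.1.le (hs.2.trans hr.1).le hr.2.le hps
  nlinarith

end Part1

section Part2
open Set MeasureTheory Metric Bornology
open scoped ENNReal NNReal Pointwise

noncomputable section
set_option synthInstance.maxSize 2000
set_option synthInstance.maxHeartbeats 200000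
set_option maxSynthPendingDepth 10

def cD1 (n : ℕ) (c : Euc n → Euc n → ℝ) : Euc n × Euc n → (Euc n × Euc n →L[ℝ] ℝ) :=
  fderiv ℝ (Function.uncurry c)
def cD2 (n : ℕ) (c : Euc n → Euc n → ℝ) :
    Euc n × Euc n → (Euc n × Euc n →L[ℝ] Euc n × Euc n →L[ℝ] ℝ) := fderiv ℝ (cD1 n c)
def cD3 (n : ℕ) (c : Euc n → Euc n → ℝ) :
    Euc n × Euc n → (Euc n × Euc n →L[ℝ] Euc n × Euc n →L[ℝ] Euc n × Euc n →L[ℝ] ℝ) :=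
  fderiv ℝ (cD2 n c)
def cD4 (n : ℕ) (c : Euc n → Euc n → ℝ) :
    Euc n × Euc n → (Euc n × Euc n →L[ℝ] Euc n × Euc n →L[ℝ] Euc n × Euc n →L[ℝ]
      Euc n × Euc n →L[ℝ] ℝ) :=
  fderiv ℝ (cD3 n c)

/-- Swapped cost. -/
def swapC (n : ℕ) (c : Euc n → Euc n → ℝ) : Euc n → Euc n → ℝ := fun y x => c x y

structure Raw (n : ℕ) (c : Euc n → Euc n → ℝ) (U V : Set (Euc n)) : Prop where
  b0 : B0cond n c U V
  b1 : B1cond n c U V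
  b2 : B2cond n c U V
  b2s : B2scond n c U V

variable {n : ℕ} {c : Euc n → Euc n → ℝ} {U V : Set (Euc n)}

theorem Raw.swap (H : Raw n c U V) : Raw n (swapC n c) V U := by
  refine ⟨⟨H.b0.2.2.1, H.b0.2.2.2.1, H.b0.1, H.b0.2.1, ?_⟩, ⟨H.b1.2, H.b1.1⟩, ⟨H.b2.2, H.b2.1⟩,
    ⟨H.b2s.2, H.b2s.1⟩⟩
  have h := H.b0.2.2.2.2
  have e : Function.uncurry (swapC n c) = Function.uncurry c ∘ Prod.swap := by
    funext ⟨a, b⟩; rfl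
  rw [e]
  exact h.comp (ContDiff.contDiffOn (contDiff_snd.prodMk contDiff_fst)) (fun z hz => ⟨hz.2, hz.1⟩)

theorem Raw.openU (H : Raw n c U V) : IsOpen U := H.b0.1
theorem Raw.openV (H : Raw n c U V) : IsOpen V := H.b0.2.2.1
theorem Raw.bddU (H : Raw n c U V) : IsBounded U := H.b0.2.1
theorem Raw.bddV (H : Raw n c U V) : IsBounded V := H.b0.2.2.2.1
theorem Raw.compU (H : Raw n c U V) : IsCompact (closure U) := H.bddU.isCompact_closure
theorem Raw.compV (H : Raw n c U V) : IsCompact (closure V) := H.bddV.isCompact_closure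
theorem Raw.contOn (H : Raw n c U V) : ContinuousOn (Function.uncurry c) (closure U ×ˢ closure V) :=
  H.b0.2.2.2.2.continuousOn

theorem Raw.contDiffAt (H : Raw n c U V) {z : Euc n × Euc n} (hz : z ∈ U ×ˢ V) :
    ContDiffAt ℝ 4 (Function.uncurry c) z :=
  H.b0.2.2.2.2.contDiffAt (Filter.mem_of_superset ((H.openU.prod H.openV).mem_nhds hz)
    (prod_mono subset_closure subset_closure))

theorem Raw.cdD1 (H : Raw n c U V) {z : Euc n × Euc n} (hz : z ∈ U ×ˢ V) :
    ContDiffAt ℝ 3 (cD1 n c) z := (H.contDiffAt hz).fderiv_right (by norm_num)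
theorem Raw.cdD2 (H : Raw n c U V) {z : Euc n × Euc n} (hz : z ∈ U ×ˢ V) :
    ContDiffAt ℝ 2 (cD2 n c) z := (H.cdD1 hz).fderiv_right (by norm_num)
theorem Raw.cdD3 (H : Raw n c U V) {z : Euc n × Euc n} (hz : z ∈ U ×ˢ V) :
    ContDiffAt ℝ 1 (cD3 n c) z := (H.cdD2 hz).fderiv_right (by norm_num)
theorem Raw.cdD4 (H : Raw n c U V) {z : Euc n × Euc n} (hz : z ∈ U ×ˢ V) :
    ContDiffAt ℝ 0 (cD4 n c) z := (H.cdD3 hz).fderiv_right (by norm_num)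

theorem Raw.h0 (H : Raw n c U V) {z : Euc n × Euc n} (hz : z ∈ U ×ˢ V) :
    HasFDerivAt (Function.uncurry c) (cD1 n c z) z :=
  ((H.contDiffAt hz).differentiableAt (by norm_num)).hasFDerivAt
theorem Raw.h1 (H : Raw n c U V) {z : Euc n × Euc n} (hz : z ∈ U ×ˢ V) :
    HasFDerivAt (cD1 n c) (cD2 n c z) z :=
  ((H.cdD1 hz).differentiableAt (by norm_num)).hasFDerivAt
theorem Raw.h2 (H : Raw n c U V) {z : Euc n × Euc n} (hz : z ∈ U ×ˢ V) :
    HasFDerivAt (cD2 n c) (cD3 n c z) z :=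
  ((H.cdD2 hz).differentiableAt (by norm_num)).hasFDerivAt
theorem Raw.h3 (H : Raw n c U V) {z : Euc n × Euc n} (hz : z ∈ U ×ˢ V) :
    HasFDerivAt (cD3 n c) (cD4 n c z) z :=
  ((H.cdD3 hz).differentiableAt (by norm_num)).hasFDerivAt

theorem Raw.symm2 (H : Raw n c U V) {z : Euc n × Euc n} (hz : z ∈ U ×ˢ V) (v w : Euc n × Euc n) :
    cD2 n c z v w = cD2 n c z w v := by
  have := (H.contDiffAt hz).isSymmSndFDerivAt (by simp; norm_num)
  exact this v w
theorem Raw.symm3 (H : Raw n c U V) {z : Euc n × Euc n} (hz : z ∈ U ×ˢ V) (v w : Euc n × Euc n) :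
    cD3 n c z v w = cD3 n c z w v := by
  have := (H.cdD1 hz).isSymmSndFDerivAt (by simp; norm_num)
  exact this v w
theorem Raw.symm4 (H : Raw n c U V) {z : Euc n × Euc n} (hz : z ∈ U ×ˢ V) (v w : Euc n × Euc n) :
    cD4 n c z v w = cD4 n c z w v := by
  have := (H.cdD2 hz).isSymmSndFDerivAt (by simp)
  exact this v w

theorem Raw.nhdsO (H : Raw n c U V) {z : Euc n × Euc n} (hz : z ∈ U ×ˢ V) :
    ∀ᶠ w in nhds z, w ∈ U ×ˢ V := (H.openU.prod H.openV).mem_nhds hz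

theorem Raw.symm3' (H : Raw n c U V) {z : Euc n × Euc n} (hz : z ∈ U ×ˢ V)
    (u v w : Euc n × Euc n) : cD3 n c z u v w = cD3 n c z u w v := by
  have h := H.h2 hz
  have e1 : HasFDerivAt (fun z => cD2 n c z v w) (((cD3 n c z).flip v).flip w) z := by
    have := (h.clm_apply (hasFDerivAt_const v z)).clm_apply (hasFDerivAt_const w z)
    refine this.congr_fderiv ?_
    refine ContinuousLinearMap.ext fun a => ?_
    simp
  have e2 : HasFDerivAt (fun z => cD2 n c z w v) (((cD3 n c z).flip w).flip v) z := by
    have := (h.clm_apply (hasFDerivAt_const w z)).clm_apply (hasFDerivAt_const v z)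
    refine this.congr_fderiv ?_
    refine ContinuousLinearMap.ext fun a => ?_
    simp
  have e3 := e1.congr_of_eventuallyEq
    (f₁ := fun z => cD2 n c z w v) ((H.nhdsO hz).mono (fun z hz => H.symm2 hz w v))
  have := e3.unique e2
  have := congrArg (fun L => L u) this
  simpa using this

theorem Raw.symm4' (H : Raw n c U V) {z : Euc n × Euc n} (hz : z ∈ U ×ˢ V)
    (u v w : Euc n × Euc n) : cD4 n c z u v w = cD4 n c z u w v := by
  have h := H.h3 hz
  have e1 : HasFDerivAt (fun z => cD3 n c z v w) (((cD4 n c z).flip v).flip w) z := by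
    have := (h.clm_apply (hasFDerivAt_const v z)).clm_apply (hasFDerivAt_const w z)
    refine this.congr_fderiv ?_
    refine ContinuousLinearMap.ext fun a => ?_
    simp
  have e2 : HasFDerivAt (fun z => cD3 n c z w v) (((cD4 n c z).flip w).flip v) z := by
    have := (h.clm_apply (hasFDerivAt_const w z)).clm_apply (hasFDerivAt_const v z)
    refine this.congr_fderiv ?_
    refine ContinuousLinearMap.ext fun a => ?_
    simp
  have e3 := e1.congr_of_eventuallyEq
    (f₁ := fun z => cD3 n c z w v) ((H.nhdsO hz).mono (fun z hz => H.symm3 hz w v))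
  have := e3.unique e2
  have := congrArg (fun L => L u) this
  simpa using this

theorem Raw.symm4'' (H : Raw n c U V) {z : Euc n × Euc n} (hz : z ∈ U ×ˢ V)
    (u v w w' : Euc n × Euc n) : cD4 n c z u v w w' = cD4 n c z u v w' w := by
  have h := H.h3 hz
  have e : ∀ w w', HasFDerivAt (fun z => cD3 n c z v w w') ((((cD4 n c z).flip v).flip w).flip w') z := by
    intro w w'
    have := ((h.clm_apply (hasFDerivAt_const v z)).clm_apply (hasFDerivAt_const w z)).clm_apply
      (hasFDerivAt_const w' z)
    refine this.congr_fderiv ?_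
    refine ContinuousLinearMap.ext fun a => ?_
    simp
  have e3 := (e w w').congr_of_eventuallyEq
    (f₁ := fun z => cD3 n c z v w' w) ((H.nhdsO hz).mono (fun z hz => H.symm3' hz v w' w))
  have := e3.unique (e w' w)
  have := congrArg (fun L => L u) this
  simpa using this

/-- bounds on derivatives -/
theorem Raw.bound_iter (H : Raw n c U V) (k : ℕ) (hk : k ≤ 4) :
    ∃ M : ℝ, ∀ z ∈ U ×ˢ V, ‖iteratedFDeriv ℝ k (Function.uncurry c) z‖ ≤ M := by
  have hcomp : IsCompact (closure U ×ˢ closure V) := H.compU.prod H.compV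
  have hcd := H.b0.2.2.2.2
  have key : ∀ z ∈ closure U ×ˢ closure V, ∃ t ∈ nhdsWithin z (closure U ×ˢ closure V),
      ∃ M : ℝ, ∀ w ∈ t ∩ (U ×ˢ V), ‖iteratedFDeriv ℝ k (Function.uncurry c) w‖ ≤ M := by
    intro z hz
    have h4 : ContDiffWithinAt ℝ ((4:ℕ) : WithTop ℕ∞) (Function.uncurry c) (closure U ×ˢ closure V) z :=
      hcd z hz
    obtain ⟨t, ht, p, hp⟩ := h4 4 (by norm_num)
    rw [insert_eq_of_mem hz] at ht
    have hzt : z ∈ t := mem_of_mem_nhdsWithin hz ht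
    have hcont := hp.cont k (by exact_mod_cast hk)
    have hb : ∀ᶠ w in nhdsWithin z t, ‖p w k‖ < ‖p z k‖ + 1 := by
      have := (hcont z hzt).norm
      exact this.eventually_lt tendsto_const_nhds (by simp)
    obtain ⟨t', ht', ht'sub⟩ := mem_nhdsWithin_iff_exists_mem_nhds_inter.1 hb
    obtain ⟨o, ho, hosub⟩ := mem_nhdsWithin_iff_exists_mem_nhds_inter.1 ht
    obtain ⟨o', ho'sub, ho'open, hzo'⟩ := _root_.mem_nhds_iff.1 ho
    refine ⟨t' ∩ o', ?_, ‖p z k‖ + 1, ?_⟩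
    · exact mem_nhdsWithin_of_mem_nhds (Filter.inter_mem ht' (ho'open.mem_nhds hzo'))
    · rintro w ⟨⟨hw1, hw2⟩, hw3⟩
      have hnt : o' ∩ (U ×ˢ V) ⊆ t := fun a ha => hosub ⟨ho'sub ha.1,
        prod_mono subset_closure subset_closure ha.2⟩
      have hop : IsOpen (o' ∩ (U ×ˢ V)) := ho'open.inter (H.openU.prod H.openV)
      have hp' := hp.mono hnt
      have e := hp'.eq_iteratedFDerivWithin_of_uniqueDiffOn (m := k) (by exact_mod_cast hk)
        hop.uniqueDiffOn ⟨hw2, hw3⟩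
      rw [iteratedFDerivWithin_of_isOpen k hop ⟨hw2, hw3⟩] at e
      rw [← e]
      exact (ht'sub ⟨hw1, hnt ⟨hw2, hw3⟩⟩).le
  have : ∃ M : ℝ, ∀ z ∈ (closure U ×ˢ closure V) ∩ (U ×ˢ V),
      ‖iteratedFDeriv ℝ k (Function.uncurry c) z‖ ≤ M := by
    refine hcomp.induction_on (p := fun s => ∃ M : ℝ, ∀ z ∈ s ∩ (U ×ˢ V),
      ‖iteratedFDeriv ℝ k (Function.uncurry c) z‖ ≤ M) ⟨0, by simp⟩ ?_ ?_ key
    · rintro s t hst ⟨M, hM⟩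
      exact ⟨M, fun z hz => hM z ⟨hst hz.1, hz.2⟩⟩
    · rintro s t ⟨M, hM⟩ ⟨M', hM'⟩
      refine ⟨max M M', ?_⟩
      rintro z ⟨hz | hz, hz2⟩
      · exact (hM z ⟨hz, hz2⟩).trans (le_max_left _ _)
      · exact (hM' z ⟨hz, hz2⟩).trans (le_max_right _ _)
  obtain ⟨M, hM⟩ := this
  exact ⟨M, fun z hz => hM z ⟨prod_mono subset_closure subset_closure hz, hz⟩⟩

theorem cD_norm (z : Euc n × Euc n) :
    ‖cD1 n c z‖ = ‖iteratedFDeriv ℝ 1 (Function.uncurry c) z‖ ∧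
    ‖cD2 n c z‖ = ‖iteratedFDeriv ℝ 2 (Function.uncurry c) z‖ ∧
    ‖cD3 n c z‖ = ‖iteratedFDeriv ℝ 3 (Function.uncurry c) z‖ ∧
    ‖cD4 n c z‖ = ‖iteratedFDeriv ℝ 4 (Function.uncurry c) z‖ := by
  refine ⟨?_, ?_, ?_, ?_⟩ <;>
  · simp only [← norm_iteratedFDeriv_fderiv, cD1, cD2, cD3, cD4, norm_iteratedFDeriv_zero]

theorem Raw.bounds (H : Raw n c U V) : ∃ M : ℝ, 0 < M ∧ ∀ z ∈ U ×ˢ V,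
    ‖cD1 n c z‖ ≤ M ∧ ‖cD2 n c z‖ ≤ M ∧ ‖cD3 n c z‖ ≤ M ∧ ‖cD4 n c z‖ ≤ M := by
  obtain ⟨M1, h1⟩ := H.bound_iter 1 (by norm_num)
  obtain ⟨M2, h2⟩ := H.bound_iter 2 (by norm_num)
  obtain ⟨M3, h3⟩ := H.bound_iter 3 (by norm_num)
  obtain ⟨M4, h4⟩ := H.bound_iter 4 (by norm_num)
  refine ⟨|M1| + |M2| + |M3| + |M4| + 1, by positivity, fun z hz => ?_⟩
  obtain ⟨e1, e2, e3, e4⟩ := cD_norm (n := n) (c := c) z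
  rw [e1, e2, e3, e4]
  have := h1 z hz; have := h2 z hz; have := h3 z hz; have := h4 z hz
  have := le_abs_self M1; have := le_abs_self M2; have := le_abs_self M3; have := le_abs_self M4
  have := abs_nonneg M1; have := abs_nonneg M2; have := abs_nonneg M3; have := abs_nonneg M4
  refine ⟨?_, ?_, ?_, ?_⟩ <;> linarith


/-! derivatives along curves -/
section gen
variable {W : Type*} [NormedAddCommGroup W] [NormedSpace ℝ W]
  {X : Type*} [NormedAddCommGroup X] [NormedSpace ℝ X]
  {Y : Type*} [NormedAddCommGroup Y] [NormedSpace ℝ Y]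
  {Z : Type*} [NormedAddCommGroup Z] [NormedSpace ℝ Z]

theorem gk1 {F : W → W →L[ℝ] X} {F' : W →L[ℝ] W →L[ℝ] X} {γ v : ℝ → W} {γ' v' : W} {t : ℝ}
    (hF : HasFDerivAt F F' (γ t)) (hγ : HasDerivAt γ γ' t) (hv : HasDerivAt v v' t) :
    HasDerivAt (fun t => F (γ t) (v t)) (F' γ' (v t) + F (γ t) v') t := by
  have h1 : HasDerivAt (fun t => F (γ t)) (F' γ') t := hF.comp_hasDerivAt t hγ
  exact h1.clm_apply hv

theorem gk2 {F : W → W →L[ℝ] W →L[ℝ] X} {F' : W →L[ℝ] W →L[ℝ] W →L[ℝ] X} {γ v w : ℝ → W}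
    {γ' v' w' : W} {t : ℝ}
    (hF : HasFDerivAt F F' (γ t)) (hγ : HasDerivAt γ γ' t) (hv : HasDerivAt v v' t)
    (hw : HasDerivAt w w' t) :
    HasDerivAt (fun t => F (γ t) (v t) (w t))
      (F' γ' (v t) (w t) + F (γ t) v' (w t) + F (γ t) (v t) w') t := by
  have h1 := (gk1 hF hγ hv).clm_apply hw
  simpa using h1

theorem gk3 {F : W → W →L[ℝ] W →L[ℝ] W →L[ℝ] X} {F' : W →L[ℝ] W →L[ℝ] W →L[ℝ] W →L[ℝ] X}
    {γ v w u : ℝ → W} {γ' v' w' u' : W} {t : ℝ}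
    (hF : HasFDerivAt F F' (γ t)) (hγ : HasDerivAt γ γ' t) (hv : HasDerivAt v v' t)
    (hw : HasDerivAt w w' t) (hu : HasDerivAt u u' t) :
    HasDerivAt (fun t => F (γ t) (v t) (w t) (u t))
      (F' γ' (v t) (w t) (u t) + F (γ t) v' (w t) (u t) + F (γ t) (v t) w' (u t)
        + F (γ t) (v t) (w t) u') t := by
  have h1 := (gk2 hF hγ hv hw).clm_apply hu
  simpa using h1
end gen

theorem Raw.k0 (H : Raw n c U V) {x y : ℝ → Euc n} {x' y' : Euc n} {t : ℝ}
    (hx : HasDerivAt x x' t) (hy : HasDerivAt y y' t) (hz : (x t, y t) ∈ U ×ˢ V) :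
    HasDerivAt (fun t => c (x t) (y t)) (cD1 n c (x t, y t) (x', y')) t :=
  HasFDerivAt.comp_hasDerivAt (f := fun t => (x t, y t)) t (H.h0 hz) (hx.prodMk hy)

theorem Raw.k1 (H : Raw n c U V) {x y : ℝ → Euc n} {x' y' : Euc n} {t : ℝ}
    {v : ℝ → Euc n × Euc n} {v' : Euc n × Euc n}
    (hx : HasDerivAt x x' t) (hy : HasDerivAt y y' t) (hv : HasDerivAt v v' t)
    (hz : (x t, y t) ∈ U ×ˢ V) :
    HasDerivAt (fun t => cD1 n c (x t, y t) (v t))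
      (cD2 n c (x t, y t) (x', y') (v t) + cD1 n c (x t, y t) v') t :=
  gk1 (γ := fun t => (x t, y t)) (H.h1 hz) (hx.prodMk hy) hv

theorem Raw.k2 (H : Raw n c U V) {x y : ℝ → Euc n} {x' y' : Euc n} {t : ℝ}
    {v w : ℝ → Euc n × Euc n} {v' w' : Euc n × Euc n}
    (hx : HasDerivAt x x' t) (hy : HasDerivAt y y' t) (hv : HasDerivAt v v' t)
    (hw : HasDerivAt w w' t) (hz : (x t, y t) ∈ U ×ˢ V) :
    HasDerivAt (fun t => cD2 n c (x t, y t) (v t) (w t))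
      (cD3 n c (x t, y t) (x', y') (v t) (w t) + cD2 n c (x t, y t) v' (w t)
        + cD2 n c (x t, y t) (v t) w') t :=
  gk2 (γ := fun t => (x t, y t)) (H.h2 hz) (hx.prodMk hy) hv hw

theorem Raw.k3 (H : Raw n c U V) {x y : ℝ → Euc n} {x' y' : Euc n} {t : ℝ}
    {v w u : ℝ → Euc n × Euc n} {v' w' u' : Euc n × Euc n}
    (hx : HasDerivAt x x' t) (hy : HasDerivAt y y' t) (hv : HasDerivAt v v' t)
    (hw : HasDerivAt w w' t) (hu : HasDerivAt u u' t) (hz : (x t, y t) ∈ U ×ˢ V) :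
    HasDerivAt (fun t => cD3 n c (x t, y t) (v t) (w t) (u t))
      (cD4 n c (x t, y t) (x', y') (v t) (w t) (u t) + cD3 n c (x t, y t) v' (w t) (u t)
        + cD3 n c (x t, y t) (v t) w' (u t) + cD3 n c (x t, y t) (v t) (w t) u') t :=
  gk3 (γ := fun t => (x t, y t)) (H.h3 hz) (hx.prodMk hy) hv hw hu

/-! swap of derivatives -/
theorem Raw.swap0 (z : Euc n × Euc n) :
    Function.uncurry (swapC n c) z = Function.uncurry c z.swap := rfl

def swapL (n : ℕ) : Euc n × Euc n →L[ℝ] Euc n × Euc n :=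
  (ContinuousLinearMap.snd ℝ _ _).prod (ContinuousLinearMap.fst ℝ _ _)

theorem swapL_apply (z : Euc n × Euc n) : swapL n z = z.swap := rfl

theorem Raw.swap1 (H : Raw n c U V) {z : Euc n × Euc n} (hz : z ∈ V ×ˢ U) (v : Euc n × Euc n) :
    cD1 n (swapC n c) z v = cD1 n c z.swap v.swap := by
  have hz' : z.swap ∈ U ×ˢ V := ⟨hz.2, hz.1⟩
  have e : HasFDerivAt (Function.uncurry (swapC n c)) ((cD1 n c z.swap).comp (swapL n)) z :=
    HasFDerivAt.comp z (f := fun z => swapL n z) (H.h0 hz') (swapL n).hasFDerivAt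
  rw [(H.swap.h0 hz).unique e]; rfl

theorem Raw.swap2 (H : Raw n c U V) {z : Euc n × Euc n} (hz : z ∈ V ×ˢ U) (v w : Euc n × Euc n) :
    cD2 n (swapC n c) z v w = cD2 n c z.swap v.swap w.swap := by
  have hz' : z.swap ∈ U ×ˢ V := ⟨hz.2, hz.1⟩
  have e1 : HasFDerivAt (fun z => cD1 n c z.swap w.swap)
      ((((cD2 n c z.swap)).flip w.swap).comp (swapL n)) z := by
    have := HasFDerivAt.comp z (f := fun z => swapL n z) (H.h1 hz') (swapL n).hasFDerivAt
    refine (this.clm_apply (hasFDerivAt_const w.swap z)).congr_fderiv ?_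
    refine ContinuousLinearMap.ext fun a => ?_
    simp [swapL_apply]
  have e2 : HasFDerivAt (fun z => cD1 n (swapC n c) z w) ((cD2 n (swapC n c) z).flip w) z := by
    refine ((H.swap.h1 hz).clm_apply (hasFDerivAt_const w z)).congr_fderiv ?_
    refine ContinuousLinearMap.ext fun a => ?_
    simp [swapL_apply]
  have e3 := e1.congr_of_eventuallyEq (f₁ := fun z => cD1 n (swapC n c) z w)
    ((H.swap.nhdsO hz).mono (fun z hz => H.swap1 hz w))
  have := congrArg (fun L => L v) (e2.unique e3)
  simpa [swapL_apply] using this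

theorem Raw.swap3 (H : Raw n c U V) {z : Euc n × Euc n} (hz : z ∈ V ×ˢ U)
    (u v w : Euc n × Euc n) :
    cD3 n (swapC n c) z u v w = cD3 n c z.swap u.swap v.swap w.swap := by
  have hz' : z.swap ∈ U ×ˢ V := ⟨hz.2, hz.1⟩
  have e1 : HasFDerivAt (fun z => cD2 n c z.swap v.swap w.swap)
      (((((cD3 n c z.swap)).flip v.swap).flip w.swap).comp (swapL n)) z := by
    have := HasFDerivAt.comp z (f := fun z => swapL n z) (H.h2 hz') (swapL n).hasFDerivAt
    refine ((this.clm_apply (hasFDerivAt_const v.swap z)).clm_apply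
      (hasFDerivAt_const w.swap z)).congr_fderiv ?_
    refine ContinuousLinearMap.ext fun a => ?_
    simp [swapL_apply]
  have e2 : HasFDerivAt (fun z => cD2 n (swapC n c) z v w)
      (((cD3 n (swapC n c) z).flip v).flip w) z := by
    refine (((H.swap.h2 hz).clm_apply (hasFDerivAt_const v z)).clm_apply
      (hasFDerivAt_const w z)).congr_fderiv ?_
    refine ContinuousLinearMap.ext fun a => ?_
    simp [swapL_apply]
  have e3 := e1.congr_of_eventuallyEq (f₁ := fun z => cD2 n (swapC n c) z v w)
    ((H.swap.nhdsO hz).mono (fun z hz => H.swap2 hz v w))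
  have := congrArg (fun L => L u) (e2.unique e3)
  simpa [swapL_apply] using this

theorem Raw.swap4 (H : Raw n c U V) {z : Euc n × Euc n} (hz : z ∈ V ×ˢ U)
    (r u v w : Euc n × Euc n) :
    cD4 n (swapC n c) z r u v w = cD4 n c z.swap r.swap u.swap v.swap w.swap := by
  have hz' : z.swap ∈ U ×ˢ V := ⟨hz.2, hz.1⟩
  have e1 : HasFDerivAt (fun z => cD3 n c z.swap u.swap v.swap w.swap)
      ((((((cD4 n c z.swap)).flip u.swap).flip v.swap).flip w.swap).comp (swapL n)) z := by
    have := HasFDerivAt.comp z (f := fun z => swapL n z) (H.h3 hz') (swapL n).hasFDerivAt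
    refine (((this.clm_apply (hasFDerivAt_const u.swap z)).clm_apply
      (hasFDerivAt_const v.swap z)).clm_apply
      (hasFDerivAt_const w.swap z)).congr_fderiv ?_
    refine ContinuousLinearMap.ext fun a => ?_
    simp [swapL_apply]
  have e2 : HasFDerivAt (fun z => cD3 n (swapC n c) z u v w)
      ((((cD4 n (swapC n c) z).flip u).flip v).flip w) z := by
    refine ((((H.swap.h3 hz).clm_apply (hasFDerivAt_const u z)).clm_apply
      (hasFDerivAt_const v z)).clm_apply
      (hasFDerivAt_const w z)).congr_fderiv ?_
    refine ContinuousLinearMap.ext fun a => ?_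
    simp [swapL_apply]
  have e3 := e1.congr_of_eventuallyEq (f₁ := fun z => cD3 n (swapC n c) z u v w)
    ((H.swap.nhdsO hz).mono (fun z hz => H.swap3 hz u v w))
  have := congrArg (fun L => L r) (e2.unique e3)
  simpa [swapL_apply] using this

end

end Part2

section Part3
open Set MeasureTheory Metric Bornology
open scoped ENNReal NNReal Pointwise InnerProductSpace

noncomputable section

/-- `q_y(x) = -D_y c(x,y)` -/
def qc (n : ℕ) (c : Euc n → Euc n → ℝ) (y x : Euc n) : Euc n := -gradY n c x y

section q
variable {n : ℕ} {c : Euc n → Euc n → ℝ} {U V : Set (Euc n)}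

theorem qc_swap (x y : Euc n) : qc n (swapC n c) x y = -gradX n c x y := rfl

theorem Raw.local_grad (H : Raw n c U V) {x y : Euc n} (hx : x ∈ closure U) (hy : y ∈ V) :
    ∃ f' : Euc n × Euc n → (Euc n × Euc n →L[ℝ] ℝ), ContinuousWithinAt f' (closure U ×ˢ V) (x, y) ∧
    ∀ᶠ z in nhdsWithin (x, y) (closure U ×ˢ V), HasGradientAt (fun y' => c z.1 y')
      ((InnerProductSpace.toDual ℝ (Euc n)).symm ((f' z).comp (ContinuousLinearMap.inr ℝ _ _))) z.2 := by
  have hz : (x, y) ∈ closure U ×ˢ closure V := ⟨hx, subset_closure hy⟩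
  have h4 : ContDiffWithinAt ℝ (3 + 1) (Function.uncurry c) (closure U ×ˢ closure V) (x, y) := by
    have := H.b0.2.2.2.2 _ hz
    convert this using 1; norm_num
  obtain ⟨t, ht, -, f', hf', hcd⟩ := (contDiffWithinAt_succ_iff_hasFDerivWithinAt (by simp)).1 h4
  rw [insert_eq_of_mem hz] at ht
  obtain ⟨o, hoo, hzo, hosub⟩ := mem_nhdsWithin.1 ht
  have sub : o ∩ (closure U ×ˢ V) ⊆ t := fun w hw =>
    hosub ⟨hw.1, prod_mono Subset.rfl subset_closure hw.2⟩
  refine ⟨f', ?_, ?_⟩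
  · have := hcd.continuousWithinAt.mono sub
    exact (continuousWithinAt_inter' (mem_nhdsWithin_of_mem_nhds (hoo.mem_nhds hzo))).1
      (this.mono (by intro w hw; exact ⟨hw.2, hw.1⟩))
  · have : o ∩ (closure U ×ˢ V) ∈ nhdsWithin (x, y) (closure U ×ˢ V) :=
      Filter.inter_mem (mem_nhdsWithin_of_mem_nhds (hoo.mem_nhds hzo)) self_mem_nhdsWithin
    filter_upwards [this] with w hw
    have hd := hf' w (sub hw)
    have hi : HasFDerivAt (fun y' : Euc n => (w.1, y')) (ContinuousLinearMap.inr ℝ (Euc n) (Euc n)) w.2 :=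
      hasFDerivAt_prodMk_right w.1 w.2
    have hpre : (fun y' : Euc n => (w.1, y')) ⁻¹' t ∈ nhds w.2 := by
      have h1 : (fun y' : Euc n => (w.1, y')) ⁻¹' o ∈ nhds w.2 :=
        (hoo.preimage (by fun_prop : Continuous fun y' : Euc n => (w.1, y'))).mem_nhds hw.1
      filter_upwards [h1, H.openV.mem_nhds hw.2.2] with a ha1 ha2
      exact sub ⟨ha1, hw.2.1, ha2⟩
    have hcomp := HasFDerivWithinAt.comp (g := Function.uncurry c) w.2 (t := t)
      (f := fun y' : Euc n => (w.1, y')) hd (hi.hasFDerivWithinAt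
      (s := (fun y' : Euc n => (w.1, y')) ⁻¹' t)) (mapsTo_preimage _ _)
    have := hcomp.hasFDerivAt hpre
    rw [hasGradientAt_iff_hasFDerivAt, LinearIsometryEquiv.apply_symm_apply]
    exact this

theorem Raw.hasGradY (H : Raw n c U V) {x y : Euc n} (hx : x ∈ closure U) (hy : y ∈ V) :
    HasGradientAt (fun y' => c x y') (gradY n c x y) y := by
  obtain ⟨f', -, h⟩ := H.local_grad hx hy
  have := h.self_of_nhdsWithin (⟨hx, hy⟩ : (x, y) ∈ closure U ×ˢ V)
  unfold gradY
  exact this.differentiableAt.hasGradientAt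

theorem Raw.contGradY (H : Raw n c U V) :
    ContinuousOn (fun z : Euc n × Euc n => gradY n c z.1 z.2) (closure U ×ˢ V) := by
  rintro ⟨x, y⟩ ⟨hx, hy⟩
  obtain ⟨f', hf', h⟩ := H.local_grad hx hy
  have e : ∀ᶠ z in nhdsWithin (x, y) (closure U ×ˢ V), gradY n c z.1 z.2 =
      ((InnerProductSpace.toDual ℝ (Euc n)).symm ((f' z).comp (ContinuousLinearMap.inr ℝ _ _))) :=
    h.mono fun z hz => hz.gradient
  refine ContinuousWithinAt.congr_of_eventuallyEq ?_ e
    (e.self_of_nhdsWithin (⟨hx, hy⟩ : (x, y) ∈ closure U ×ˢ V))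
  refine ((InnerProductSpace.toDual ℝ (Euc n)).symm.continuous.continuousAt.comp_continuousWithinAt ?_)
  exact hf'.clm_comp continuousWithinAt_const

theorem Raw.contq2 (H : Raw n c U V) :
    ContinuousOn (fun z : Euc n × Euc n => qc n c z.2 z.1) (closure U ×ˢ V) := H.contGradY.neg

theorem Raw.contq (H : Raw n c U V) {y : Euc n} (hy : y ∈ V) :
    ContinuousOn (qc n c y) (closure U) :=
  H.contq2.comp (f := fun x => (x, y)) (by fun_prop) (fun x hx => ⟨hx, hy⟩)

theorem Raw.gradY_eq (H : Raw n c U V) {z : Euc n × Euc n} (hz : z ∈ U ×ˢ V) :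
    gradY n c z.1 z.2 = (InnerProductSpace.toDual ℝ (Euc n)).symm
      ((cD1 n c z).comp (ContinuousLinearMap.inr ℝ _ _)) := by
  have h1 : HasFDerivAt (fun y' => c z.1 y')
      ((cD1 n c z).comp (ContinuousLinearMap.inr ℝ _ _)) z.2 :=
    HasFDerivAt.comp (g := Function.uncurry c) z.2 (H.h0 hz) (hasFDerivAt_prodMk_right z.1 z.2)
  refine HasGradientAt.gradient ?_
  rw [hasGradientAt_iff_hasFDerivAt]
  simpa using h1

theorem Raw.inner_q (H : Raw n c U V) {x y : Euc n} (hx : x ∈ U) (hy : y ∈ V) (η : Euc n) :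
    ⟪qc n c y x, η⟫_ℝ = - cD1 n c (x, y) (0, η) := by
  have := H.gradY_eq (z := (x, y)) ⟨hx, hy⟩
  simp only at this
  rw [qc, this, inner_neg_left, InnerProductSpace.toDual_symm_apply]
  simp

theorem Raw.cdq2 (H : Raw n c U V) {z : Euc n × Euc n} (hz : z ∈ U ×ˢ V) :
    ContDiffAt ℝ 3 (fun z : Euc n × Euc n => qc n c z.2 z.1) z := by
  have e : ∀ᶠ w in nhds z, gradY n c w.1 w.2 = (InnerProductSpace.toDual ℝ (Euc n)).symm
      ((cD1 n c w).comp (ContinuousLinearMap.inr ℝ _ _)) :=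
    (H.nhdsO hz).mono fun w hw => H.gradY_eq hw
  refine ContDiffAt.neg (ContDiffAt.congr_of_eventuallyEq ?_ e)
  refine (InnerProductSpace.toDual ℝ (Euc n)).symm.contDiff.contDiffAt.comp _ ?_
  exact (H.cdD1 hz).clm_comp contDiffAt_const

theorem Raw.cdq (H : Raw n c U V) {x y : Euc n} (hx : x ∈ U) (hy : y ∈ V) :
    ContDiffAt ℝ 3 (qc n c y) x :=
  (H.cdq2 (z := (x, y)) ⟨hx, hy⟩).comp x (f := fun x => (x, y)) (by fun_prop)

theorem Raw.inner_dq (H : Raw n c U V) {x y : Euc n} (hx : x ∈ U) (hy : y ∈ V) (a η : Euc n) :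
    ⟪fderiv ℝ (qc n c y) x a, η⟫_ℝ = - cD2 n c (x, y) (a, 0) (0, η) := by
  have h1 : HasFDerivAt (qc n c y) (fderiv ℝ (qc n c y) x) x :=
    ((H.cdq hx hy).differentiableAt (by norm_num)).hasFDerivAt
  have hl : HasDerivAt (fun t : ℝ => x + t • a) a 0 := by
    simpa using ((hasDerivAt_id (0:ℝ)).smul_const a).const_add x
  have h2 : HasDerivAt (fun t : ℝ => ⟪qc n c y (x + t • a), η⟫_ℝ)
      (⟪fderiv ℝ (qc n c y) x a, η⟫_ℝ) 0 := by
    have h3 : HasDerivAt (fun t : ℝ => qc n c y (x + t • a)) (fderiv ℝ (qc n c y) x a) 0 := by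
      have h1' : HasFDerivAt (qc n c y) (fderiv ℝ (qc n c y) x) (x + (0:ℝ) • a) := by
        simpa using h1
      exact HasFDerivAt.comp_hasDerivAt (l := qc n c y) (f := fun t : ℝ => x + t • a) (0:ℝ) h1' hl
    simpa using h3.inner ℝ (hasDerivAt_const (0:ℝ) η)
  have h4 := H.k1 (x := fun t : ℝ => x + t • a) (y := fun _ => y) (t := 0) (y' := 0) (v' := 0)
    (v := fun _ => ((0 : Euc n), η)) hl (hasDerivAt_const _ _) (hasDerivAt_const _ _)
    (by simpa using ⟨hx, hy⟩)
  have h4 := h4.neg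
  have hev : ∀ᶠ t : ℝ in nhds 0, x + t • a ∈ U := by
    have : ContinuousAt (fun t : ℝ => x + t • a) 0 := hl.continuousAt
    exact this.preimage_mem_nhds (by simpa using H.openU.mem_nhds hx)
  have h5 := h2.congr_of_eventuallyEq
    (f₁ := fun t : ℝ => - cD1 n c (x + t • a, y) (0, η))
    (hev.mono fun t ht => (H.inner_q ht hy η).symm)
  have := h5.unique h4
  rw [this]
  simp

theorem Raw.injq (H : Raw n c U V) {y : Euc n} (hy : y ∈ V) : InjOn (qc n c y) (closure U) :=
  (H.b1.1 y (subset_closure hy)).1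

theorem xOf_left (H : Raw n c U V) {y x : Euc n} (hy : y ∈ V) (hx : x ∈ closure U) :
    xOf n c U y (qc n c y x) = x :=
  (H.injq hy).leftInvOn_invFunOn hx

theorem xOf_mem {y q : Euc n} (hq : q ∈ clUy n c U y) :
    xOf n c U y q ∈ closure U ∧ qc n c y (xOf n c U y q) = q :=
  ⟨Function.invFunOn_mem hq, Function.invFunOn_eq hq⟩

theorem xOf_memU (H : Raw n c U V) {y q : Euc n} (hy : y ∈ V) (hq : q ∈ Uyset n c U y) :
    xOf n c U y q ∈ U ∧ qc n c y (xOf n c U y q) = q := by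
  obtain ⟨x, hx, rfl⟩ := hq
  have := xOf_left H hy (subset_closure hx)
  have e : (fun x => -gradY n c x y) x = qc n c y x := rfl
  rw [e, this]; exact ⟨hx, rfl⟩

/-- nondegeneracy -/
theorem Raw.dq_inj (H : Raw n c U V) {x y : Euc n} (hx : x ∈ U) (hy : y ∈ V) :
    Function.Injective (fderiv ℝ (qc n c y) x) := by
  have h1 : HasFDerivAt (qc n c y) (fderiv ℝ (qc n c y) x) x :=
    ((H.cdq hx hy).differentiableAt (by norm_num)).hasFDerivAt
  have hX := (H.b1.1 y (subset_closure hy)).2.2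
  have hqm : qc n c y x ∈ (fun x => -gradY n c x y) '' closure U := ⟨x, subset_closure hx, rfl⟩
  have hXd := ((hX _ hqm).differentiableWithinAt (by norm_num)).hasFDerivWithinAt
  have hcomp := HasFDerivWithinAt.comp x (s := U) hXd h1.hasFDerivWithinAt
    (fun x hx => ⟨x, subset_closure hx, rfl⟩)
  have hcomp' := hcomp.hasFDerivAt (H.openU.mem_nhds hx)
  have hid : HasFDerivAt (fun x : Euc n => x) (ContinuousLinearMap.id ℝ _) x := hasFDerivAt_id x
  have e := hid.congr_of_eventuallyEq (f₁ := Function.invFunOn (fun x => -gradY n c x y) (closure U) ∘ qc n c y)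
    (Filter.eventually_of_mem (H.openU.mem_nhds hx) fun x hx => xOf_left H hy (subset_closure hx))
  have := hcomp'.unique e
  intro a b hab
  have h2 := congrArg (fun L => L a) this
  have h3 := congrArg (fun L => L b) this
  simp only [ContinuousLinearMap.comp_apply, ContinuousLinearMap.id_apply] at h2 h3
  rw [← h2, ← h3, hab]

theorem Raw.nondeg (H : Raw n c U V) {x y : Euc n} (hx : x ∈ U) (hy : y ∈ V) {a : Euc n}
    (h : ∀ η, cD2 n c (x, y) (a, 0) (0, η) = 0) : a = 0 := by
  apply H.dq_inj hx hy
  rw [map_zero]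
  apply ext_inner_right ℝ
  intro η
  rw [H.inner_dq hx hy, h, inner_zero_left, neg_zero]

theorem Raw.nondeg' (H : Raw n c U V) {x y : Euc n} (hx : x ∈ U) (hy : y ∈ V) {α : Euc n}
    (h : ∀ ξ, cD2 n c (x, y) (0, α) (ξ, 0) = 0) : α = 0 := by
  apply H.swap.nondeg hy hx
  intro η
  rw [H.swap2 (z := (y, x)) ⟨hy, hx⟩]
  exact h η

/-- the derivative as an equivalence -/
def Raw.dqE (H : Raw n c U V) {x y : Euc n} (hx : x ∈ U) (hy : y ∈ V) : Euc n ≃L[ℝ] Euc n :=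
  (LinearEquiv.ofInjectiveEndo ((fderiv ℝ (qc n c y) x : Euc n →L[ℝ] Euc n) : Euc n →ₗ[ℝ] Euc n)
    (H.dq_inj hx hy)).toContinuousLinearEquiv

theorem Raw.dqE_coe (H : Raw n c U V) {x y : Euc n} (hx : x ∈ U) (hy : y ∈ V) :
    (H.dqE hx hy : Euc n →L[ℝ] Euc n) = fderiv ℝ (qc n c y) x := by
  ext1 a; rfl

theorem Raw.hasDq (H : Raw n c U V) {x y : Euc n} (hx : x ∈ U) (hy : y ∈ V) :
    HasFDerivAt (qc n c y) (H.dqE hx hy : Euc n →L[ℝ] Euc n) x := by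
  rw [H.dqE_coe]
  exact ((H.cdq hx hy).differentiableAt (by norm_num)).hasFDerivAt

theorem Raw.openUy (H : Raw n c U V) {y : Euc n} (hy : y ∈ V) : IsOpen (Uyset n c U y) := by
  rw [isOpen_iff_mem_nhds]
  rintro _ ⟨x, hx, rfl⟩
  have hs : HasStrictFDerivAt (qc n c y) (H.dqE hx hy : Euc n →L[ℝ] Euc n) x :=
    (H.cdq hx hy).hasStrictFDerivAt' (H.hasDq hx hy) (by norm_num)
  have := hs.map_nhds_eq_of_equiv
  show _ ∈ nhds (qc n c y x)
  rw [← this]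
  exact Filter.image_mem_map (H.openU.mem_nhds hx)

theorem Raw.cdX (H : Raw n c U V) {y q : Euc n} (hy : y ∈ V) (hq : q ∈ Uyset n c U y) :
    ContDiffAt ℝ 3 (xOf n c U y) q := by
  obtain ⟨x, hx, rfl⟩ := hq
  have h1 := (H.cdq hx hy)
  have h2 := h1.to_localInverse (H.hasDq hx hy) (by norm_num)
  refine h2.congr_of_eventuallyEq ?_
  have hs : HasStrictFDerivAt (qc n c y) (H.dqE hx hy : Euc n →L[ℝ] Euc n) x :=
    h1.hasStrictFDerivAt' (H.hasDq hx hy) (by norm_num)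
  have hr := hs.eventually_right_inverse
  have ht : Filter.Tendsto (hs.localInverse (qc n c y) _ x) (nhds (qc n c y x)) (nhds x) := hs.localInverse_tendsto
  have hU := ht.eventually (H.openU.mem_nhds hx)
  filter_upwards [hr, hU] with q hq1 hq2
  have := xOf_left H hy (subset_closure hq2)
  rw [hq1] at this
  exact this

theorem Raw.clUy_compact (H : Raw n c U V) {y : Euc n} (hy : y ∈ V) : IsCompact (clUy n c U y) :=
  H.compU.image_of_continuousOn (H.contq hy)

theorem Raw.clUy_eq (H : Raw n c U V) {y : Euc n} (hy : y ∈ V) :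
    clUy n c U y = closure (Uyset n c U y) := by
  apply Subset.antisymm
  · have := H.contq hy
    exact ContinuousOn.image_closure this
  · exact closure_minimal (image_mono subset_closure) (H.clUy_compact hy).isClosed

theorem Raw.clUy_convex (H : Raw n c U V) {y : Euc n} (hy : y ∈ V) : Convex ℝ (clUy n c U y) := by
  rw [H.clUy_eq hy]; exact (H.b2.1 y (subset_closure hy)).closure

theorem Raw.Uy_convex (H : Raw n c U V) {y : Euc n} (hy : y ∈ V) : Convex ℝ (Uyset n c U y) :=
  H.b2.1 y (subset_closure hy)

theorem Raw.qc_mem (x y : Euc n) (hx : x ∈ U) : qc n c y x ∈ Uyset n c U y := ⟨x, hx, rfl⟩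
theorem Raw.qc_mem_cl (x y : Euc n) (hx : x ∈ closure U) : qc n c y x ∈ clUy n c U y := ⟨x, hx, rfl⟩

theorem Raw.frontier_q (H : Raw n c U V) {x y : Euc n} (hy : y ∈ V) (hx : x ∈ closure U)
    (hxU : x ∉ U) : qc n c y x ∈ frontier (Uyset n c U y) := by
  rw [(H.openUy hy).frontier_eq, ← H.clUy_eq hy]
  refine ⟨⟨x, hx, rfl⟩, ?_⟩
  rintro ⟨x', hx', e⟩
  exact hxU ((H.injq hy (subset_closure hx') hx e) ▸ hx')

theorem Raw.lipX (H : Raw n c U V) {y : Euc n} (hy : y ∈ V) :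
    ∃ K : ℝ≥0, LipschitzOnWith K (xOf n c U y) (clUy n c U y) :=
  (H.b1.1 y (subset_closure hy)).2.2.exists_lipschitzOnWith (by norm_num) (H.clUy_convex hy)
    (H.clUy_compact hy)

theorem Raw.antilip (H : Raw n c U V) {y : Euc n} (hy : y ∈ V) :
    ∃ A : ℝ, 0 < A ∧ ∀ x ∈ closure U, ∀ x' ∈ closure U,
      ‖x - x'‖ ≤ A * ‖qc n c y x - qc n c y x'‖ := by
  obtain ⟨K, hK⟩ := H.lipX hy
  refine ⟨K + 1, by positivity, fun x hx x' hx' => ?_⟩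
  have := hK.dist_le_mul _ (Raw.qc_mem_cl x y hx) _ (Raw.qc_mem_cl x' y hx')
  rw [xOf_left H hy hx, xOf_left H hy hx', dist_eq_norm, dist_eq_norm] at this
  refine this.trans ?_
  gcongr
  simp

end q
end

end Part3

section Part4
open Set MeasureTheory Metric Bornology
open scoped ENNReal NNReal Pointwise InnerProductSpace

noncomputable section
set_option synthInstance.maxSize 2000
set_option synthInstance.maxHeartbeats 200000
set_option maxSynthPendingDepth 10
section seg
variable {n : ℕ} {c : Euc n → Euc n → ℝ} {U V : Set (Euc n)}

/-- `q_y`-segment -/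
def segX (n : ℕ) (c : Euc n → Euc n → ℝ) (U : Set (Euc n)) (y q v : Euc n) : ℝ → Euc n :=
  fun t => xOf n c U y (q + t • v)

def segA (n : ℕ) (c : Euc n → Euc n → ℝ) (U : Set (Euc n)) (y q v : Euc n) : ℝ → Euc n :=
  deriv (segX n c U y q v)

def segB (n : ℕ) (c : Euc n → Euc n → ℝ) (U : Set (Euc n)) (y q v : Euc n) : ℝ → Euc n :=
  deriv (segA n c U y q v)

theorem Raw.seg_cd (H : Raw n c U V) {y q v : Euc n} {t : ℝ} (hy : y ∈ V)
    (ht : q + t • v ∈ Uyset n c U y) : ContDiffAt ℝ 3 (segX n c U y q v) t := by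
  have h1 := H.cdX hy ht
  exact h1.comp t (f := fun t : ℝ => q + t • v) (by fun_prop)

theorem Raw.seg_a (H : Raw n c U V) {y q v : Euc n} {t : ℝ} (hy : y ∈ V)
    (ht : q + t • v ∈ Uyset n c U y) :
    HasDerivAt (segX n c U y q v) (segA n c U y q v t) t :=
  ((H.seg_cd hy ht).differentiableAt (by norm_num)).hasDerivAt

theorem Raw.seg_b (H : Raw n c U V) {y q v : Euc n} {t : ℝ} (hy : y ∈ V)
    (ht : q + t • v ∈ Uyset n c U y) :
    HasDerivAt (segA n c U y q v) (segB n c U y q v t) t := by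
  have h1 : ContDiffAt ℝ 2 (fderiv ℝ (segX n c U y q v)) t := (H.seg_cd hy ht).fderiv_right (by norm_num)
  have h2 : DifferentiableAt ℝ (segA n c U y q v) t := by
    have : segA n c U y q v = fun t => fderiv ℝ (segX n c U y q v) t 1 := by
      funext t; simp [segA]
    rw [this]
    exact (h1.differentiableAt (by norm_num)).clm_apply (by fun_prop)
  exact h2.hasDerivAt

theorem Raw.seg_mem (H : Raw n c U V) {y q v : Euc n} {t : ℝ} (hy : y ∈ V)
    (ht : q + t • v ∈ Uyset n c U y) :
    segX n c U y q v t ∈ U ∧ qc n c y (segX n c U y q v t) = q + t • v :=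
  xOf_memU H hy ht

theorem Raw.seg_ev (H : Raw n c U V) {y q v : Euc n} {t : ℝ} (hy : y ∈ V)
    (ht : q + t • v ∈ Uyset n c U y) : ∀ᶠ s : ℝ in nhds t, q + s • v ∈ Uyset n c U y :=
  (by fun_prop : ContinuousAt (fun s : ℝ => q + s • v) t).preimage_mem_nhds
    ((H.openUy hy).mem_nhds ht)

theorem Raw.seg_eq1 (H : Raw n c U V) {y q v : Euc n} {t : ℝ} (hy : y ∈ V)
    (ht : q + t • v ∈ Uyset n c U y) (η : Euc n) :
    cD2 n c (segX n c U y q v t, y) (segA n c U y q v t, 0) (0, η) = - ⟪v, η⟫_ℝ := by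
  have h1 := H.k1 (x := segX n c U y q v) (y := fun _ => y) (t := t) (y' := 0) (v' := 0)
    (v := fun _ => ((0 : Euc n), η)) (H.seg_a hy ht) (hasDerivAt_const _ _) (hasDerivAt_const _ _)
    ⟨(H.seg_mem hy ht).1, hy⟩
  have h2 : HasDerivAt (fun t : ℝ => -⟪q + t • v, η⟫_ℝ) (-⟪v, η⟫_ℝ) t := by
    have h3 : HasDerivAt (fun t : ℝ => q + t • v) v t := by
      simpa using ((hasDerivAt_id t).smul_const v).const_add q
    have := (h3.inner ℝ (hasDerivAt_const t η)).neg
    exact this.congr_deriv (by simp)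
  have h3 := h2.congr_of_eventuallyEq (f₁ := fun t => cD1 n c (segX n c U y q v t, y) (0, η))
    ((H.seg_ev hy ht).mono fun s hs => by
      have := H.inner_q (H.seg_mem hy hs).1 hy η
      rw [(H.seg_mem hy hs).2] at this
      simp only; rw [this, neg_neg])
  have := h1.unique h3
  simpa using this

theorem Raw.seg_eq2 (H : Raw n c U V) {y q v : Euc n} {t : ℝ} (hy : y ∈ V)
    (ht : q + t • v ∈ Uyset n c U y) (η : Euc n) :
    cD3 n c (segX n c U y q v t, y) (segA n c U y q v t, 0) (segA n c U y q v t, 0) (0, η) +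
    cD2 n c (segX n c U y q v t, y) (segB n c U y q v t, 0) (0, η) = 0 := by
  have h1 := H.k2 (x := segX n c U y q v) (y := fun _ => y) (t := t) (y' := 0) (w' := 0)
    (v := fun t => (segA n c U y q v t, 0)) (v' := (segB n c U y q v t, 0))
    (w := fun _ => ((0 : Euc n), η)) (H.seg_a hy ht) (hasDerivAt_const _ _)
    ((H.seg_b hy ht).prodMk (hasDerivAt_const _ _)) (hasDerivAt_const _ _)
    ⟨(H.seg_mem hy ht).1, hy⟩
  have h3 := (hasDerivAt_const t (-⟪v, η⟫_ℝ)).congr_of_eventuallyEq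
    (f₁ := fun t => cD2 n c (segX n c U y q v t, y) (segA n c U y q v t, 0) (0, η))
    ((H.seg_ev hy ht).mono fun s hs => H.seg_eq1 hy hs η)
  have := h1.unique h3
  simpa using this

/-- Tensorial form of (B3). -/
def MTW (n : ℕ) (c : Euc n → Euc n → ℝ) (U V : Set (Euc n)) : Prop :=
  ∀ x ∈ U, ∀ y ∈ V, ∀ a b α β : Euc n, cD2 n c (x, y) (a, 0) (0, α) = 0 →
    (∀ η, cD3 n c (x, y) (a, 0) (a, 0) (0, η) + cD2 n c (x, y) (b, 0) (0, η) = 0) →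
    (∀ ξ, cD3 n c (x, y) (0, α) (0, α) (ξ, 0) + cD2 n c (x, y) (0, β) (ξ, 0) = 0) →
    cD4 n c (x, y) (a, 0) (a, 0) (0, α) (0, α) - cD2 n c (x, y) (b, 0) (0, β) ≤ 0

theorem MTW.swap (H : Raw n c U V) (h : MTW n c U V) : MTW n (swapC n c) V U := by
  intro y hy x hx α β a b h2 h3 h3'
  have hz : (y, x) ∈ V ×ˢ U := ⟨hy, hx⟩
  have hz' : (x, y) ∈ U ×ˢ V := ⟨hx, hy⟩
  simp only [H.swap2 hz, H.swap3 hz, H.swap4 hz, Prod.swap] at h2 h3 h3' ⊢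
  rw [H.symm2 hz'] at h2
  have := h x hx y hy a b α β h2 h3' h3
  rw [H.symm2 hz' (0, β)]
  have e : cD4 n c (x, y) (0, α) (0, α) (a, 0) (a, 0) = cD4 n c (x, y) (a, 0) (a, 0) (0, α) (0, α) := by
    rw [H.symm4' hz' (0, α) (0, α) (a, 0), H.symm4 hz' (0, α) (a, 0),
      H.symm4'' hz' (a, 0) (0, α) (0, α), H.symm4' hz' (a, 0) (0, α) (a, 0)]
  rw [e]; exact this

theorem Raw.seg_swap_eq1 (H : Raw n c U V) {x p w : Euc n} {t : ℝ} (hx : x ∈ U)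
    (ht : p + t • w ∈ Uyset n (swapC n c) V x) (ξ : Euc n) :
    cD2 n c (x, segX n (swapC n c) V x p w t) (0, segA n (swapC n c) V x p w t) (ξ, 0)
      = - ⟪w, ξ⟫_ℝ := by
  have := H.swap.seg_eq1 hx ht ξ
  rwa [H.swap2 ⟨(H.swap.seg_mem hx ht).1, hx⟩] at this

theorem Raw.seg_swap_eq2 (H : Raw n c U V) {x p w : Euc n} {t : ℝ} (hx : x ∈ U)
    (ht : p + t • w ∈ Uyset n (swapC n c) V x) (ξ : Euc n) :
    cD3 n c (x, segX n (swapC n c) V x p w t) (0, segA n (swapC n c) V x p w t)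
      (0, segA n (swapC n c) V x p w t) (ξ, 0) +
    cD2 n c (x, segX n (swapC n c) V x p w t) (0, segB n (swapC n c) V x p w t) (ξ, 0) = 0 := by
  have := H.swap.seg_eq2 hx ht ξ
  rwa [H.swap2 ⟨(H.swap.seg_mem hx ht).1, hx⟩, H.swap3 ⟨(H.swap.seg_mem hx ht).1, hx⟩] at this

/-- Tensor inequality for directions whose segments fit into `[-1,1]`. -/
theorem Raw.mtw_aux (H : Raw n c U V) (h3 : B3cond n c U V) {x y v w : Euc n} (hx : x ∈ U) (hy : y ∈ V)
    (hv : ∀ t ∈ Icc (-1:ℝ) 1, qc n c y x + t • v ∈ Uyset n c U y)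
    (hw : ∀ t ∈ Icc (-1:ℝ) 1, qc n (swapC n c) x y + t • w ∈ Uyset n (swapC n c) V x)
    {a b α β : Euc n}
    (ha : ∀ η, cD2 n c (x, y) (a, 0) (0, η) = - ⟪v, η⟫_ℝ)
    (hα : ∀ ξ, cD2 n c (x, y) (0, α) (ξ, 0) = - ⟪w, ξ⟫_ℝ)
    (h0 : cD2 n c (x, y) (a, 0) (0, α) = 0)
    (hb : ∀ η, cD3 n c (x, y) (a, 0) (a, 0) (0, η) + cD2 n c (x, y) (b, 0) (0, η) = 0)
    (hβ : ∀ ξ, cD3 n c (x, y) (0, α) (0, α) (ξ, 0) + cD2 n c (x, y) (0, β) (ξ, 0) = 0) :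
    cD4 n c (x, y) (a, 0) (a, 0) (0, α) (0, α) - cD2 n c (x, y) (b, 0) (0, β) ≤ 0 := by
  set X := segX n c U y (qc n c y x) v with hX
  set A := segA n c U y (qc n c y x) v with hA
  set B := segB n c U y (qc n c y x) v with hB
  set Y := segX n (swapC n c) V x (qc n (swapC n c) x y) w with hY
  set Y1 := segA n (swapC n c) V x (qc n (swapC n c) x y) w with hY1
  set Y2 := segB n (swapC n c) V x (qc n (swapC n c) x y) w with hY2
  have z0 : (0:ℝ) ∈ Icc (-1:ℝ) 1 := by norm_num
  have hz' : (x, y) ∈ U ×ˢ V := ⟨hx, hy⟩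
  have X0 : X 0 = x := by
    simp only [hX, segX, zero_smul, add_zero]; exact xOf_left H hy (subset_closure hx)
  have Y0 : Y 0 = y := by
    simp only [hY, segX, zero_smul, add_zero]; exact xOf_left H.swap hx (subset_closure hy)
  have hv0 := hv 0 z0
  have hw0 := hw 0 z0
  have A0 : A 0 = a := by
    have e := H.seg_eq1 hy hv0
    rw [← sub_eq_zero]
    apply H.nondeg hx hy
    intro η
    have e1 := e η
    rw [← hX, ← hA, X0] at e1
    have : ((A 0 - a, (0 : Euc n))) = (A 0, 0) - (a, 0) := by simp
    rw [this, map_sub, sub_apply, e1, ha, sub_self]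
  have Y10 : Y1 0 = α := by
    have e := H.seg_swap_eq1 hx hw0
    rw [← sub_eq_zero]
    apply H.nondeg' hx hy
    intro η
    have e1 := e η
    rw [← hY, ← hY1, Y0] at e1
    have : (((0 : Euc n), Y1 0 - α)) = (0, Y1 0) - (0, α) := by simp
    rw [this, map_sub, sub_apply, e1, hα, sub_self]
  have B0 : B 0 = b := by
    have e := H.seg_eq2 hy hv0
    rw [← sub_eq_zero]
    apply H.nondeg hx hy
    intro η
    have e1 := e η
    rw [← hX, ← hA, ← hB, X0, A0] at e1
    have : ((B 0 - b, (0 : Euc n))) = (B 0, 0) - (b, 0) := by simp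
    rw [this, map_sub, sub_apply]
    linarith [hb η]
  have Y20 : Y2 0 = β := by
    have e := H.seg_swap_eq2 hx hw0
    rw [← sub_eq_zero]
    apply H.nondeg' hx hy
    intro η
    have e1 := e η
    rw [← hY, ← hY1, ← hY2, Y0, Y10] at e1
    have : (((0 : Euc n), Y2 0 - β)) = (0, Y2 0) - (0, β) := by simp
    rw [this, map_sub, sub_apply]
    linarith [hβ η]
  have dA : ∀ᶠ s in nhds (0:ℝ), X s ∈ U ∧ HasDerivAt X (A s) s ∧ HasDerivAt A (B s) s :=
    (H.seg_ev hy hv0).mono fun s hs => ⟨(H.seg_mem hy hs).1, H.seg_a hy hs, H.seg_b hy hs⟩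
  have dY : ∀ᶠ s in nhds (0:ℝ), Y s ∈ V ∧ HasDerivAt Y (Y1 s) s ∧ HasDerivAt Y1 (Y2 s) s :=
    (H.swap.seg_ev hx hw0).mono fun s hs =>
      ⟨(H.swap.seg_mem hx hs).1, H.swap.seg_a hx hs, H.swap.seg_b hx hs⟩
  -- first t derivative
  have t1 : ∀ s, X s ∈ U → ∀ᶠ t in nhds (0:ℝ), deriv (fun t => c (X s) (Y t)) t
      = cD1 n c (X s, Y t) (0, Y1 t) := by
    intro s hs
    filter_upwards [dY] with t ht
    exact (H.k0 (x := fun _ => X s) (y := Y) (hasDerivAt_const t (X s)) ht.2.1 ⟨hs, ht.1⟩).deriv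
  have t2 : ∀ s, X s ∈ U → deriv (deriv (fun t => c (X s) (Y t))) 0
      = cD2 n c (X s, y) (0, α) (0, α) + cD1 n c (X s, y) (0, β) := by
    intro s hs
    rw [Filter.EventuallyEq.deriv_eq (t1 s hs)]
    have ht := dY.self_of_nhds
    have := H.k1 (x := fun _ => X s) (y := Y) (v := fun t => ((0 : Euc n), Y1 t)) (t := 0)
      (hasDerivAt_const 0 (X s)) ht.2.1 ((hasDerivAt_const _ _).prodMk ht.2.2) ⟨hs, ht.1⟩
    rw [this.deriv, Y0, Y10, Y20]
  have c2 : crossDiff2 n c X Y = 0 := by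
    have e : (fun s => deriv (fun t => c (X s) (Y t)) 0) =ᶠ[nhds 0]
        fun s => cD1 n c (X s, y) (0, α) := by
      filter_upwards [dA] with s hs
      rw [(t1 s hs.1).self_of_nhds, Y0, Y10]
    unfold crossDiff2
    rw [e.deriv_eq]
    have hs := dA.self_of_nhds
    have := H.k1 (x := X) (y := fun _ => y) (v := fun t => ((0 : Euc n), α)) (t := 0) (v' := 0)
      hs.2.1 (hasDerivAt_const 0 y) (hasDerivAt_const _ _) ⟨hs.1, hy⟩
    rw [this.deriv, X0, A0, h0, map_zero, zero_add]
  have s1 : ∀ᶠ s in nhds (0:ℝ), deriv (fun s => deriv (deriv (fun t => c (X s) (Y t))) 0) s =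
      cD3 n c (X s, y) (A s, 0) (0, α) (0, α) + cD2 n c (X s, y) (A s, 0) (0, β) := by
    filter_upwards [dA.eventually_nhds] with s hs
    have e : (fun s => deriv (deriv (fun t => c (X s) (Y t))) 0) =ᶠ[nhds s]
        fun s => cD2 n c (X s, y) (0, α) (0, α) + cD1 n c (X s, y) (0, β) := by
      filter_upwards [hs] with s hs
      exact t2 s hs.1
    rw [e.deriv_eq]
    have hs := hs.self_of_nhds
    have r1 := H.k2 (x := X) (y := fun _ => y) (v := fun t => ((0 : Euc n), α))
      (w := fun t => ((0 : Euc n), α)) (t := s) (v' := 0) (w' := 0)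
      hs.2.1 (hasDerivAt_const s y) (hasDerivAt_const _ _) (hasDerivAt_const _ _) ⟨hs.1, hy⟩
    have r2 := H.k1 (x := X) (y := fun _ => y) (v := fun t => ((0 : Euc n), β)) (t := s) (v' := 0)
      hs.2.1 (hasDerivAt_const s y) (hasDerivAt_const _ _) ⟨hs.1, hy⟩
    have r3 := r1.add r2
    refine r3.deriv.trans ?_
    simp
  have c4 : crossDiff4 n c X Y = cD4 n c (x, y) (a, 0) (a, 0) (0, α) (0, α)
      + cD3 n c (x, y) (b, 0) (0, α) (0, α) + cD3 n c (x, y) (a, 0) (a, 0) (0, β)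
      + cD2 n c (x, y) (b, 0) (0, β) := by
    unfold crossDiff4
    rw [Filter.EventuallyEq.deriv_eq s1]
    have hs := dA.self_of_nhds
    have r1 := H.k3 (x := X) (y := fun _ => y) (v := fun t => (A t, (0 : Euc n)))
      (w := fun t => ((0 : Euc n), α)) (u := fun t => ((0 : Euc n), α)) (t := 0) (u' := 0) (w' := 0)
      hs.2.1 (hasDerivAt_const 0 y) (hs.2.2.prodMk (hasDerivAt_const _ _)) (hasDerivAt_const _ _)
      (hasDerivAt_const _ _) ⟨hs.1, hy⟩
    have r2 := H.k2 (x := X) (y := fun _ => y) (v := fun t => (A t, (0 : Euc n)))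
      (w := fun t => ((0 : Euc n), β)) (t := 0) (w' := 0)
      hs.2.1 (hasDerivAt_const 0 y) (hs.2.2.prodMk (hasDerivAt_const _ _)) (hasDerivAt_const _ _)
      ⟨hs.1, hy⟩
    refine (r1.add r2).deriv.trans ?_
    rw [X0, A0, B0]
    simp only [map_zero, zero_apply, add_zero]
    ring
  have := h3 X Y (fun t ht => subset_closure (H.seg_mem hy (hv t ht)).1)
    (fun t ht => subset_closure (H.swap.seg_mem hx (hw t ht)).1) ?_ c2
  · rw [c4] at this
    have e1 := hβ b
    have e2 := hb β
    have e3 : cD3 n c (x, y) (b, 0) (0, α) (0, α) = cD3 n c (x, y) (0, α) (0, α) (b, 0) := by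
      rw [H.symm3 hz' (b, 0) (0, α), H.symm3' hz' (0, α) (b, 0) (0, α)]
    rw [H.symm2 hz' (0, β) (b, 0)] at e1
    linarith
  · refine ⟨(-qc n c y x, -qc n (swapC n c) x y), (-v, -w), fun t ht => ?_⟩
    rw [X0, Y0]
    have e1 := (H.seg_mem hy (hv t ht)).2
    have e2 := (H.swap.seg_mem hx (hw t ht)).2
    refine Prod.ext ?_ ?_
    · have : gradY n c (X t) y = - qc n c y (X t) := by simp [qc]
      simp only [Prod.fst_add, Prod.smul_fst]
      rw [this, e1]; simp [neg_add, add_comm]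
    · have : gradX n c x (Y t) = - qc n (swapC n c) x (Y t) := by simp [qc_swap]
      simp only [Prod.snd_add, Prod.smul_snd]
      rw [this, e2]; simp [neg_add, add_comm]

theorem exists_small_seg {S : Set (Euc n)} (hS : IsOpen S) {q : Euc n} (hq : q ∈ S) (v : Euc n) :
    ∃ r : ℝ, 0 < r ∧ ∀ t ∈ Icc (-1:ℝ) 1, q + t • (r • v) ∈ S := by
  obtain ⟨ε, hε, hsub⟩ := Metric.isOpen_iff.1 hS q hq
  refine ⟨ε / (2 * (‖v‖ + 1)), by positivity, fun t ht => hsub ?_⟩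
  rw [mem_ball, dist_eq_norm, add_sub_cancel_left, norm_smul, norm_smul, Real.norm_eq_abs,
    Real.norm_eq_abs, abs_of_pos (by positivity : 0 < ε / (2 * (‖v‖ + 1)))]
  have h1 : |t| ≤ 1 := abs_le.2 ht
  have h2 : ε / (2 * (‖v‖ + 1)) * ‖v‖ ≤ ε / 2 := by
    rw [div_mul_eq_mul_div, div_le_div_iff₀ (by positivity) (by norm_num)]
    nlinarith [norm_nonneg v]
  have h3 : 0 ≤ ε / (2 * (‖v‖ + 1)) * ‖v‖ := by positivity
  nlinarith [abs_nonneg t]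

theorem Raw.mtw (H : Raw n c U V) (h3 : B3cond n c U V) : MTW n c U V := by
  intro x hx y hy a b α β h0 hb hβ
  obtain ⟨r, hr, hvr⟩ := exists_small_seg (H.openUy hy) (Raw.qc_mem (c := c) x y hx)
    (fderiv ℝ (qc n c y) x a)
  obtain ⟨ρ, hρ, hwr⟩ := exists_small_seg (H.swap.openUy hx) (Raw.qc_mem (c := swapC n c) y x hy)
    (fderiv ℝ (qc n (swapC n c) x) y α)
  have s1 : ∀ (k : ℝ) (e : Euc n), ((k • e, (0 : Euc n))) = k • (e, (0 : Euc n)) := by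
    intro k e; simp
  have s2 : ∀ (k : ℝ) (e : Euc n), (((0 : Euc n), k • e)) = k • ((0 : Euc n), e) := by
    intro k e; simp
  have := H.mtw_aux h3 hx hy hvr hwr (a := r • a) (b := (r ^ 2) • b) (α := ρ • α) (β := (ρ ^ 2) • β)
    ?_ ?_ ?_ ?_ ?_
  · simp only [s1, s2, map_smul, smul_apply, smul_eq_mul] at this
    have hp : 0 < r ^ 2 * ρ ^ 2 := by positivity
    by_contra hcon
    push Not at hcon
    have := mul_pos hp hcon
    linarith
  · intro η
    rw [s1, map_smul, smul_apply, real_inner_smul_left, H.inner_dq hx hy]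
    simp
  · intro ξ
    rw [s2, map_smul, smul_apply, real_inner_smul_left, H.swap.inner_dq hy hx,
      H.swap2 (z := (y, x)) ⟨hy, hx⟩]
    simp
  · simp only [s1, s2, map_smul, smul_apply, smul_eq_mul, h0, mul_zero]
  · intro η
    simp only [s1, map_smul, smul_apply, smul_eq_mul]
    linear_combination r ^ 2 * hb η
  · intro η
    simp only [s2, map_smul, smul_apply, smul_eq_mul]
    linear_combination ρ ^ 2 * hβ η

end seg
end

end Part4

section Part5
open Set MeasureTheory Metric Bornology
open scoped ENNReal NNReal Pointwise InnerProductSpace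

noncomputable section
set_option synthInstance.maxSize 2000
set_option synthInstance.maxHeartbeats 200000
set_option maxSynthPendingDepth 10
section quant
variable {n : ℕ} {c : Euc n → Euc n → ℝ} {U V : Set (Euc n)}

theorem Raw.bds (H : Raw n c U V) : ∃ M : ℝ, 0 < M ∧ ∀ z ∈ U ×ˢ V,
    (∀ v, |cD1 n c z v| ≤ M * ‖v‖) ∧ (∀ v w, |cD2 n c z v w| ≤ M * ‖v‖ * ‖w‖) ∧
    (∀ u v w, |cD3 n c z u v w| ≤ M * ‖u‖ * ‖v‖ * ‖w‖) ∧
    (∀ r u v w, |cD4 n c z r u v w| ≤ M * ‖r‖ * ‖u‖ * ‖v‖ * ‖w‖) := by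
  obtain ⟨M, hM, h⟩ := H.bounds
  refine ⟨M, hM, fun z hz => ?_⟩
  obtain ⟨h1, h2, h3, h4⟩ := h z hz
  refine ⟨fun v => ?_, fun v w => ?_, fun u v w => ?_, fun r u v w => ?_⟩
  · exact (cD1 n c z).le_of_opNorm_le h1 v
  · exact (cD2 n c z v).le_of_opNorm_le ((cD2 n c z).le_of_opNorm_le h2 v) w
  · exact (cD3 n c z u v).le_of_opNorm_le ((cD3 n c z u).le_of_opNorm_le
      ((cD3 n c z).le_of_opNorm_le h3 u) v) w
  · exact (cD4 n c z r u v).le_of_opNorm_le ((cD4 n c z r u).le_of_opNorm_le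
      ((cD4 n c z r).le_of_opNorm_le ((cD4 n c z).le_of_opNorm_le h4 r) u) v) w

theorem nrm1 (a : Euc n) : ‖(a, (0 : Euc n))‖ = ‖a‖ := by simp [Prod.norm_def]
theorem nrm2 (a : Euc n) : ‖((0 : Euc n), a)‖ = ‖a‖ := by simp [Prod.norm_def]

theorem Raw.dq_eq (H : Raw n c U V) {z : Euc n × Euc n} (hz : z ∈ U ×ˢ V) (a : Euc n) :
    fderiv ℝ (qc n c z.2) z.1 a = fderiv ℝ (fun z : Euc n × Euc n => qc n c z.2 z.1) z (a, 0) := by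
  have h1 := ((H.cdq2 hz).differentiableAt (by norm_num)).hasFDerivAt
  have h2 : HasFDerivAt (fun x : Euc n => (x, z.2)) (ContinuousLinearMap.inl ℝ (Euc n) (Euc n)) z.1 :=
    hasFDerivAt_prodMk_left z.1 z.2
  have h3 := HasFDerivAt.comp z.1 (f := fun x : Euc n => (x, z.2))
    (g := fun z : Euc n × Euc n => qc n c z.2 z.1) h1 h2
  have h4 : fderiv ℝ (qc n c z.2) z.1 = _ := h3.fderiv
  rw [h4]; rfl

theorem Raw.dq_cont (H : Raw n c U V) : ContinuousOn
    (fun p : (Euc n × Euc n) × Euc n => fderiv ℝ (qc n c p.1.2) p.1.1 p.2)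
    ((U ×ˢ V) ×ˢ univ) := by
  have h : ContinuousOn (fun p : (Euc n × Euc n) × Euc n =>
      fderiv ℝ (fun z : Euc n × Euc n => qc n c z.2 z.1) p.1 (p.2, 0)) ((U ×ˢ V) ×ˢ univ) := by
    intro p hp
    have h1 : ContinuousAt (fderiv ℝ (fun z : Euc n × Euc n => qc n c z.2 z.1)) p.1 :=
      ((H.cdq2 hp.1).fderiv_right (m := 2) (by norm_num)).continuousAt
    have h2 : ContinuousAt (fun p : (Euc n × Euc n) × Euc n =>
      fderiv ℝ (fun z : Euc n × Euc n => qc n c z.2 z.1) p.1) p :=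
        ContinuousAt.comp (f := fun p : (Euc n × Euc n) × Euc n => p.1) h1 continuousAt_fst
    exact (h2.clm_apply (by fun_prop)).continuousWithinAt
  exact h.congr fun p hp => H.dq_eq hp.1 p.2

/-- uniform nondegeneracy -/
theorem Raw.nd (H : Raw n c U V) {K : Set (Euc n × Euc n)} (hK : IsCompact K) (hKU : K ⊆ U ×ˢ V) :
    ∃ m : ℝ, 0 < m ∧ ∀ z ∈ K, ∀ a : Euc n, m * ‖a‖ ≤ ‖fderiv ℝ (qc n c z.2) z.1 a‖ := by
  set S : Set ((Euc n × Euc n) × Euc n) := K ×ˢ sphere (0 : Euc n) 1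
  have hS : IsCompact S := hK.prod (isCompact_sphere 0 1)
  have hc : ContinuousOn (fun p : (Euc n × Euc n) × Euc n =>
      ‖fderiv ℝ (qc n c p.1.2) p.1.1 p.2‖) S :=
    (H.dq_cont.mono (by intro p hp; exact ⟨hKU hp.1, mem_univ _⟩)).norm
  rcases S.eq_empty_or_nonempty with hE | hN
  · refine ⟨1, one_pos, fun z hz a => ?_⟩
    by_cases ha : a = 0
    · simp [ha]
    · exfalso
      have : (z, (‖a‖⁻¹) • a) ∈ S := ⟨hz, by
        simp [norm_smul, inv_mul_cancel₀ (norm_ne_zero_iff.2 ha)]⟩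
      rw [hE] at this; exact this
  · obtain ⟨p, hp, hmin⟩ := hS.exists_isMinOn hN hc
    refine ⟨‖fderiv ℝ (qc n c p.1.2) p.1.1 p.2‖, ?_, fun z hz a => ?_⟩
    · rw [norm_pos_iff]
      intro h0
      have hU := hKU hp.1
      have := H.dq_inj hU.1 hU.2 (h0.trans (map_zero _).symm)
      have h1 : ‖p.2‖ = 1 := by simpa using hp.2
      rw [this] at h1; simp at h1
    · by_cases ha : a = 0
      · simp [ha]
      · have hna := norm_ne_zero_iff.2 ha
        have : (z, (‖a‖⁻¹) • a) ∈ S := ⟨hz, by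
          simp [norm_smul, inv_mul_cancel₀ hna]⟩
        have h1 := hmin this
        simp only [mem_ofPred_eq, map_smul, norm_smul, norm_inv, norm_norm] at h1
        calc _ ≤ (‖a‖⁻¹ * ‖fderiv ℝ (qc n c z.2) z.1 a‖) * ‖a‖ := by gcongr
          _ = _ := by field_simp

theorem Raw.nd_le (H : Raw n c U V) {x y : Euc n} (hx : x ∈ U) (hy : y ∈ V) {m T : ℝ} {b : Euc n}
    (hT0 : 0 ≤ T) (hm : m * ‖b‖ ≤ ‖fderiv ℝ (qc n c y) x b‖) (hT : ∀ η, |cD2 n c (x, y) (b, 0) (0, η)| ≤ T * ‖η‖) :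
    m * ‖b‖ ≤ T := by
  refine hm.trans ?_
  set w := fderiv ℝ (qc n c y) x b with hw
  have h1 := H.inner_dq hx hy b w
  rw [← hw, real_inner_self_eq_norm_sq] at h1
  have h2 := hT w
  have h3 := neg_abs_le (cD2 n c (x, y) (b, 0) (0, w))
  by_cases h : ‖w‖ = 0
  · rw [h]; exact hT0
  · have hp : 0 < ‖w‖ := lt_of_le_of_ne (norm_nonneg _) (Ne.symm h)
    nlinarith

theorem Raw.solve (H : Raw n c U V) {x y : Euc n} (hx : x ∈ U) (hy : y ∈ V) (l : Euc n →L[ℝ] ℝ) :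
    ∃ b : Euc n, ∀ η, cD2 n c (x, y) (b, 0) (0, η) = l η := by
  refine ⟨(H.dqE hx hy).symm (-((InnerProductSpace.toDual ℝ (Euc n)).symm l)), fun η => ?_⟩
  have h1 := H.inner_dq hx hy ((H.dqE hx hy).symm (-((InnerProductSpace.toDual ℝ (Euc n)).symm l))) η
  rw [← H.dqE_coe hx hy] at h1
  simp only [ContinuousLinearEquiv.coe_coe, ContinuousLinearEquiv.apply_symm_apply, inner_neg_left,
    InnerProductSpace.toDual_symm_apply] at h1
  linarith

set_option maxHeartbeats 1000000 in
theorem Raw.quant (H : Raw n c U V) (h3 : MTW n c U V) {K : Set (Euc n × Euc n)} (hK : IsCompact K)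
    (hKU : K ⊆ U ×ˢ V) : ∃ C : ℝ, 0 ≤ C ∧ ∀ x y, (x, y) ∈ K → ∀ a b α β : Euc n,
    (∀ η, cD3 n c (x, y) (a, 0) (a, 0) (0, η) + cD2 n c (x, y) (b, 0) (0, η) = 0) →
    (∀ ξ, cD3 n c (x, y) (0, α) (0, α) (ξ, 0) + cD2 n c (x, y) (0, β) (ξ, 0) = 0) →
    cD4 n c (x, y) (a, 0) (a, 0) (0, α) (0, α) - cD2 n c (x, y) (b, 0) (0, β) ≤
      C * (‖a‖ * ‖α‖ * |cD2 n c (x, y) (a, 0) (0, α)|) := by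
  obtain ⟨M, hM, hb⟩ := H.bds
  obtain ⟨m, hm, hnd⟩ := H.nd hK hKU
  refine ⟨(M / m) * (2 + M / m) * (1 + M / m), by positivity, ?_⟩
  intro x y hxy a b α β hab hαβ
  have hz := hKU hxy
  obtain ⟨-, b2, b3, b4⟩ := hb _ hz
  by_cases hα : α = 0
  · have e : cD2 n c (x, y) (b, 0) (0, β) = 0 := by
      have := hαβ b
      rw [hα] at this
      rw [H.symm2 hz]
      have z0 : ((0 : Euc n), (0 : Euc n)) = 0 := rfl
      rw [z0, map_zero, zero_apply, zero_add] at this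
      exact this
    have z0 : ((0 : Euc n), (0 : Euc n)) = 0 := rfl
    rw [e, hα, z0, map_zero]
    simp
  have hαp : 0 < ‖α‖ := norm_pos_iff.2 hα
  set k := cD2 n c (x, y) (a, 0) (0, α) with hk
  obtain ⟨e, he⟩ := H.solve hz.1 hz.2 ((‖α‖ ^ 2)⁻¹ • (innerSL ℝ α))
  have heα : cD2 n c (x, y) (e, 0) (0, α) = 1 := by
    rw [he]; simp only [smul_apply, innerSL_apply_apply, smul_eq_mul, real_inner_self_eq_norm_sq]
    field_simp
  have hen : m * ‖e‖ ≤ ‖α‖⁻¹ := by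
    refine H.nd_le hz.1 hz.2 (by positivity) (hnd _ hxy e) fun η => ?_
    rw [he]
    simp only [smul_apply, innerSL_apply_apply, smul_eq_mul, abs_mul, abs_inv, abs_pow, abs_norm]
    calc _ ≤ (‖α‖ ^ 2)⁻¹ * (‖α‖ * ‖η‖) := by gcongr; exact abs_real_inner_le_norm α η
      _ = _ := by field_simp
  have hen' : ‖e‖ * ‖α‖ ≤ 1 / m := by
    rw [le_div_iff₀ hm]
    calc ‖e‖ * ‖α‖ * m = (m * ‖e‖) * ‖α‖ := by ring
      _ ≤ ‖α‖⁻¹ * ‖α‖ := by gcongr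
      _ = 1 := inv_mul_cancel₀ hαp.ne'
  have hkM : |k| ≤ M * ‖a‖ * ‖α‖ := by have := b2 (a, 0) (0, α); rwa [nrm1, nrm2] at this
  set a0 := a - k • e with ha0
  have ea : ((a, (0 : Euc n))) = (a0, 0) + k • (e, 0) := by simp [ha0]
  have ea' : ((a0, (0 : Euc n))) = (a, 0) - k • (e, 0) := by simp [ha0]
  have hk0 : cD2 n c (x, y) (a0, 0) (0, α) = 0 := by
    rw [ea', map_sub, sub_apply, map_smul, smul_apply, heα, ← hk]; simp
  have hna0 : ‖a0‖ ≤ (1 + M / m) * ‖a‖ := by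
    calc ‖a0‖ ≤ ‖a‖ + |k| * ‖e‖ := by
          refine (norm_sub_le _ _).trans ?_
          rw [norm_smul, Real.norm_eq_abs]
      _ ≤ ‖a‖ + M * ‖a‖ * ‖α‖ * ‖e‖ := by gcongr
      _ = ‖a‖ + M * ‖a‖ * (‖e‖ * ‖α‖) := by ring
      _ ≤ ‖a‖ + M * ‖a‖ * (1 / m) := by gcongr
      _ = _ := by ring
  obtain ⟨b0, hb0⟩ := H.solve hz.1 hz.2
    (-((cD3 n c (x, y) (a0, 0) (a0, 0)).comp (ContinuousLinearMap.inr ℝ (Euc n) (Euc n))))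
  have hb0' : ∀ η, cD3 n c (x, y) (a0, 0) (a0, 0) (0, η) + cD2 n c (x, y) (b0, 0) (0, η) = 0 := by
    intro η; rw [hb0]; simp
  have main := h3 x hz.1 y hz.2 a0 b0 α β hk0 hb0' hαβ
  have d4 : cD4 n c (x, y) (a, 0) (a, 0) (0, α) (0, α) = cD4 n c (x, y) (a0, 0) (a0, 0) (0, α) (0, α)
      + k * (cD4 n c (x, y) (e, 0) (a, 0) (0, α) (0, α) + cD4 n c (x, y) (a0, 0) (e, 0) (0, α) (0, α)) := by
    have e1 : cD4 n c (x, y) (a, 0) (a, 0) (0, α) (0, α) = cD4 n c (x, y) (a0, 0) (a, 0) (0, α) (0, α)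
       + k * cD4 n c (x, y) (e, 0) (a, 0) (0, α) (0, α) := by
      have g : ∀ w, cD4 n c (x, y) (a, 0) w (0, α) (0, α) = cD4 n c (x, y) (a0, 0) w (0, α) (0, α)
          + k * cD4 n c (x, y) (e, 0) w (0, α) (0, α) := by
        intro w; rw [ea, map_add, map_smul]; rfl
      exact g _
    have e2 : cD4 n c (x, y) (a0, 0) (a, 0) (0, α) (0, α) = cD4 n c (x, y) (a0, 0) (a0, 0) (0, α) (0, α)
       + k * cD4 n c (x, y) (a0, 0) (e, 0) (0, α) (0, α) := by
      conv_lhs => rw [ea, map_add, map_smul]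
      rfl
    rw [e1, e2]; ring
  have d3 : ∀ η, cD3 n c (x, y) (a, 0) (a, 0) (0, η) = cD3 n c (x, y) (a0, 0) (a0, 0) (0, η)
      + k * (cD3 n c (x, y) (e, 0) (a, 0) (0, η) + cD3 n c (x, y) (a0, 0) (e, 0) (0, η)) := by
    intro η
    have e1 : cD3 n c (x, y) (a, 0) (a, 0) (0, η) = cD3 n c (x, y) (a0, 0) (a, 0) (0, η)
       + k * cD3 n c (x, y) (e, 0) (a, 0) (0, η) := by
      have g : ∀ w, cD3 n c (x, y) (a, 0) w (0, η) = cD3 n c (x, y) (a0, 0) w (0, η)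
          + k * cD3 n c (x, y) (e, 0) w (0, η) := by
        intro w; rw [ea, map_add, map_smul]; rfl
      exact g _
    have e2 : cD3 n c (x, y) (a0, 0) (a, 0) (0, η) = cD3 n c (x, y) (a0, 0) (a0, 0) (0, η)
       + k * cD3 n c (x, y) (a0, 0) (e, 0) (0, η) := by
      conv_lhs => rw [ea, map_add, map_smul]
      rfl
    rw [e1, e2]; ring
  have eb : ((b - b0, (0 : Euc n))) = (b, 0) - (b0, 0) := by simp
  set T := |k| * (M * ‖e‖ * (2 + M / m) * ‖a‖) with hTd
  have hT : 0 ≤ T := by positivity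
  have hbb : m * ‖b - b0‖ ≤ T := by
    refine H.nd_le hz.1 hz.2 hT (hnd _ hxy _) fun η => ?_
    have : cD2 n c (x, y) (b - b0, 0) (0, η) =
        -(k * (cD3 n c (x, y) (e, 0) (a, 0) (0, η) + cD3 n c (x, y) (a0, 0) (e, 0) (0, η))) := by
      rw [eb, map_sub, sub_apply]
      linarith [hab η, hb0' η, d3 η]
    rw [this, abs_neg, abs_mul]
    have i1 := b3 (e, 0) (a, 0) (0, η)
    have i2 := b3 (a0, 0) (e, 0) (0, η)
    rw [nrm1, nrm1, nrm2] at i1 i2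
    calc _ ≤ |k| * (M * ‖e‖ * ‖a‖ * ‖η‖ + M * ‖a0‖ * ‖e‖ * ‖η‖) := by
          gcongr; exact (abs_add_le _ _).trans (add_le_add i1 i2)
      _ ≤ |k| * (M * ‖e‖ * ‖a‖ * ‖η‖ + M * ((1 + M / m) * ‖a‖) * ‖e‖ * ‖η‖) := by gcongr
      _ = _ := by rw [hTd]; ring
  have d2 : cD2 n c (x, y) (b, 0) (0, β) = cD2 n c (x, y) (b0, 0) (0, β)
      - cD3 n c (x, y) (0, α) (0, α) (b - b0, 0) := by
    have := hαβ (b - b0)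
    rw [H.symm2 hz, eb, map_sub (cD2 n c (x, y)), sub_apply, ← eb] at this
    linarith
  have i3 : |cD3 n c (x, y) (0, α) (0, α) (b - b0, 0)| ≤ M * ‖α‖ * ‖α‖ * ‖b - b0‖ := by
    have := b3 (0, α) (0, α) (b - b0, 0)
    rwa [nrm1, nrm2] at this
  have i4 : |k * (cD4 n c (x, y) (e, 0) (a, 0) (0, α) (0, α) + cD4 n c (x, y) (a0, 0) (e, 0) (0, α) (0, α))|
      ≤ T * ‖α‖ * ‖α‖ := by
    rw [abs_mul]
    have i1 := b4 (e, 0) (a, 0) (0, α) (0, α)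
    have i2 := b4 (a0, 0) (e, 0) (0, α) (0, α)
    rw [nrm1, nrm1, nrm2] at i1 i2
    calc _ ≤ |k| * (M * ‖e‖ * ‖a‖ * ‖α‖ * ‖α‖ + M * ‖a0‖ * ‖e‖ * ‖α‖ * ‖α‖) := by
          gcongr; exact (abs_add_le _ _).trans (add_le_add i1 i2)
      _ ≤ |k| * (M * ‖e‖ * ‖a‖ * ‖α‖ * ‖α‖ + M * ((1 + M / m) * ‖a‖) * ‖e‖ * ‖α‖ * ‖α‖) := by gcongr
      _ = _ := by rw [hTd]; ring
  have i5 : ‖b - b0‖ ≤ T / m := by rw [le_div_iff₀ hm]; linarith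
  have i6 : T * ‖α‖ ≤ |k| * ((M / m) * (2 + M / m) * ‖a‖) := by
    calc T * ‖α‖ = |k| * (M * (2 + M / m) * ‖a‖) * (‖e‖ * ‖α‖) := by rw [hTd]; ring
      _ ≤ |k| * (M * (2 + M / m) * ‖a‖) * (1 / m) := by gcongr
      _ = _ := by ring
  rw [d4, d2]
  have j1 := (le_abs_self _).trans i4
  have j2 := (le_abs_self _).trans i3
  have j3 : M * ‖α‖ * ‖α‖ * ‖b - b0‖ ≤ (M / m) * (T * ‖α‖ * ‖α‖) := by
    calc _ ≤ M * ‖α‖ * ‖α‖ * (T / m) := by gcongr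
      _ = _ := by ring
  have j4 : (1 + M / m) * (T * ‖α‖ * ‖α‖) ≤ (1 + M / m) * (|k| * ((M / m) * (2 + M / m) * ‖a‖) * ‖α‖) := by
    gcongr
  nlinarith
end quant
end

end Part5

section Part6
open Set MeasureTheory Metric Bornology
open scoped ENNReal NNReal Pointwise InnerProductSpace

noncomputable section
set_option synthInstance.maxSize 2000
set_option synthInstance.maxHeartbeats 200000
set_option maxSynthPendingDepth 10
section di
variable {n : ℕ} {c : Euc n → Euc n → ℝ} {U V : Set (Euc n)}

theorem Raw.seg_in (H : Raw n c U V) {y x0 x1 : Euc n} (hy : y ∈ V) (h0 : x0 ∈ U) (h1 : x1 ∈ U)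
    {t : ℝ} (ht : t ∈ Icc (0:ℝ) 1) :
    qc n c y x0 + t • (qc n c y x1 - qc n c y x0) ∈ Uyset n c U y := by
  have := (H.Uy_convex hy) (Raw.qc_mem x0 y h0) (Raw.qc_mem x1 y h1)
    (sub_nonneg.2 ht.2) ht.1 (by ring)
  convert this using 1
  module

theorem Raw.hull (H : Raw n c U V) {K W : Set (Euc n)} (hK : IsCompact K) (hKU : K ⊆ U)
    (hW : IsCompact W) (hWV : W ⊆ V) : ∃ S : Set (Euc n), IsCompact S ∧ S ⊆ U ∧ K ⊆ S ∧
    ∀ y ∈ W, ∀ x0 ∈ K, ∀ x1 ∈ K, ∀ t ∈ Icc (0:ℝ) 1,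
      segX n c U y (qc n c y x0) (qc n c y x1 - qc n c y x0) t ∈ S := by
  set D : Set (Euc n × Euc n × Euc n × Euc n × ℝ) := closure U ×ˢ W ×ˢ K ×ˢ K ×ˢ Icc (0:ℝ) 1 with hD
  have hDc : IsCompact D := H.compU.prod (hW.prod (hK.prod (hK.prod isCompact_Icc)))
  set F : Euc n × Euc n × Euc n × Euc n × ℝ → Euc n := fun p =>
    qc n c p.2.1 p.1 - (qc n c p.2.1 p.2.2.1 + p.2.2.2.2 • (qc n c p.2.1 p.2.2.2.1 - qc n c p.2.1 p.2.2.1))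
    with hF
  have hFc : ContinuousOn F D := by
    have g : ∀ f : Euc n × Euc n × Euc n × Euc n × ℝ → Euc n, Continuous f →
        (∀ p ∈ D, f p ∈ closure U) → ContinuousOn (fun p => qc n c p.2.1 (f p)) D := by
      intro f hf hm
      exact H.contq2.comp (f := fun p => (f p, p.2.1)) (by fun_prop)
        (fun p hp => ⟨hm p hp, hWV hp.2.1⟩)
    have g1 := g (fun p => p.1) (by fun_prop) (fun p hp => hp.1)
    have g2 := g (fun p => p.2.2.1) (by fun_prop) (fun p hp => subset_closure (hKU hp.2.2.1))
    have g3 := g (fun p => p.2.2.2.1) (by fun_prop) (fun p hp => subset_closure (hKU hp.2.2.2.1))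
    have g4 : ContinuousOn (fun p : Euc n × Euc n × Euc n × Euc n × ℝ => p.2.2.2.2) D := by fun_prop
    exact g1.sub (g2.add (g4.smul (g3.sub g2)))
  have hcl : IsClosed (D ∩ F ⁻¹' {0}) := hFc.preimage_isClosed_of_isClosed hDc.isClosed isClosed_singleton
  have hcc : IsCompact (D ∩ F ⁻¹' {0}) := hDc.of_isClosed_subset hcl inter_subset_left
  refine ⟨K ∪ Prod.fst '' (D ∩ F ⁻¹' {0}), hK.union (hcc.image continuous_fst), ?_, subset_union_left, ?_⟩
  · refine union_subset hKU ?_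
    rintro _ ⟨⟨x, y, x0, x1, t⟩, ⟨⟨hx, hy, h0, h1, ht⟩, h⟩, rfl⟩
    have hyV := hWV hy
    have hin := H.seg_in hyV (hKU h0) (hKU h1) ht
    obtain ⟨hm, he⟩ := xOf_memU H hyV hin
    have : qc n c y x = qc n c y x0 + t • (qc n c y x1 - qc n c y x0) := by
      have : F (x, y, x0, x1, t) = 0 := h
      exact sub_eq_zero.1 this
    rw [← he] at this
    rw [show x = _ from H.injq hyV hx (subset_closure hm) this]
    exact hm
  · intro y hy x0 h0 x1 h1 t ht
    right
    have hyV := hWV hy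
    have hin := H.seg_in hyV (hKU h0) (hKU h1) ht
    obtain ⟨hm, he⟩ := xOf_memU H hyV hin
    refine ⟨(_, y, x0, x1, t), ⟨⟨subset_closure hm, hy, h0, h1, ht⟩, ?_⟩, rfl⟩
    show F _ = 0
    exact sub_eq_zero.2 he

theorem Raw.q_le (H : Raw n c U V) {M : ℝ} {x y : Euc n} (hx : x ∈ U) (hy : y ∈ V) (hM : 0 ≤ M)
    (h : ∀ v, |cD1 n c (x, y) v| ≤ M * ‖v‖) : ‖qc n c y x‖ ≤ M := by
  have h1 := H.inner_q hx hy (qc n c y x)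
  rw [real_inner_self_eq_norm_sq] at h1
  have h2 := h (0, qc n c y x)
  rw [nrm2] at h2
  have := neg_abs_le (cD1 n c (x, y) (0, qc n c y x))
  by_contra hc
  push Not at hc
  nlinarith

theorem Raw.swap_inner_q (H : Raw n c U V) {x y : Euc n} (hx : x ∈ U) (hy : y ∈ V) (ξ : Euc n) :
    ⟪qc n (swapC n c) x y, ξ⟫_ℝ = - cD1 n c (x, y) (ξ, 0) := by
  rw [H.swap.inner_q hy hx, H.swap1 (z := (y, x)) ⟨hy, hx⟩]; rfl

set_option maxHeartbeats 1000000 in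
theorem Raw.di (H : Raw n c U V) (h3 : MTW n c U V) {K W : Set (Euc n)} (hK : IsCompact K) (hKU : K ⊆ U)
    (hW : IsCompact W) (hWV : W ⊆ V) : ∃ C : ℝ, 0 ≤ C ∧
    ∀ y0 ∈ W, ∀ y1 ∈ W, ∀ x0 ∈ K, ∀ x1 ∈ K, ∀ X A B : ℝ → Euc n,
      X = segX n c U y0 (qc n c y0 x0) (qc n c y0 x1 - qc n c y0 x0) →
      A = segA n c U y0 (qc n c y0 x0) (qc n c y0 x1 - qc n c y0 x0) →
      B = segB n c U y0 (qc n c y0 x0) (qc n c y0 x1 - qc n c y0 x0) →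
      DIneq C (fun t => -c (X t) y1 + c (X t) y0)
        (fun t => -cD1 n c (X t, y1) (A t, 0) + cD1 n c (X t, y0) (A t, 0))
        (fun t => -(cD2 n c (X t, y1) (A t, 0) (A t, 0) + cD1 n c (X t, y1) (B t, 0)) +
          (cD2 n c (X t, y0) (A t, 0) (A t, 0) + cD1 n c (X t, y0) (B t, 0))) := by
  obtain ⟨S, hS, hSU, hKS, hSm⟩ := H.hull hK hKU hW hWV
  obtain ⟨S', hS', hSV, hWS, hSm'⟩ := H.swap.hull hW hWV hS hSU
  have hSS : S ×ˢ S' ⊆ U ×ˢ V := prod_mono hSU hSV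
  obtain ⟨C, hC, hq⟩ := H.quant h3 (hS.prod hS') hSS
  obtain ⟨m, hm, hnd⟩ := H.nd (hS.prod hS') hSS
  obtain ⟨m', hm', hnd'⟩ := H.swap.nd (hS'.prod hS) (prod_mono hSV hSU)
  obtain ⟨M, hM, hb⟩ := H.bds
  obtain ⟨M', hM', hbs⟩ := H.swap.bds
  refine ⟨C * ((2 * M / m) * (2 * M' / m')), by positivity, ?_⟩
  intro y0 hy0 y1 hy1 x0 hx0 x1 hx1 X A B hX hA hB
  have hy0V := hWV hy0
  have hy1V := hWV hy1
  have hin : ∀ t ∈ Icc (0:ℝ) 1, _ := fun t ht => H.seg_in hy0V (hKU hx0) (hKU hx1) ht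
  refine ⟨by positivity, fun t ht => ?_, fun t ht => ?_, fun t ht => ?_⟩
  · have ha := H.seg_a hy0V (hin t ht)
    have hmU := (H.seg_mem hy0V (hin t ht)).1
    rw [← hX, ← hA] at ha
    rw [← hX] at hmU
    have r1 := H.k0 (y := fun _ => y1) ha (hasDerivAt_const t y1) ⟨hmU, hy1V⟩
    have r2 := H.k0 (y := fun _ => y0) ha (hasDerivAt_const t y0) ⟨hmU, hy0V⟩
    exact r1.neg.add r2
  · have ha := H.seg_a hy0V (hin t ht)
    have hbb := H.seg_b hy0V (hin t ht)
    have hmU := (H.seg_mem hy0V (hin t ht)).1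
    rw [← hX, ← hA] at ha
    rw [← hA, ← hB] at hbb
    rw [← hX] at hmU
    have r1 := H.k1 (y := fun _ => y1) (v := fun t => (A t, (0 : Euc n))) ha (hasDerivAt_const t y1)
      (hbb.prodMk (hasDerivAt_const _ _)) ⟨hmU, hy1V⟩
    have r2 := H.k1 (y := fun _ => y0) (v := fun t => (A t, (0 : Euc n))) ha (hasDerivAt_const t y0)
      (hbb.prodMk (hasDerivAt_const _ _)) ⟨hmU, hy0V⟩
    exact r1.neg.add r2
  · have hmU := (H.seg_mem hy0V (hin t ht)).1
    have eq1 := H.seg_eq1 hy0V (hin t ht)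
    have eq2 := H.seg_eq2 hy0V (hin t ht)
    have hxS := hSm y0 hy0 x0 hx0 x1 hx1 t ht
    rw [← hX] at hmU hxS
    rw [← hX, ← hA] at eq1
    rw [← hX, ← hA, ← hB] at eq2
    set x := X t with hx
    set a := A t with ha
    set b := B t with hbd
    set p := qc n (swapC n c) x y0 with hp
    set w := qc n (swapC n c) x y1 - p with hw
    set Y := segX n (swapC n c) V x p w with hY
    set Y1 := segA n (swapC n c) V x p w with hY1
    set Y2 := segB n (swapC n c) V x p w with hY2
    have hin' : ∀ s ∈ Icc (0:ℝ) 1, p + s • w ∈ Uyset n (swapC n c) V x :=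
      fun s hs => H.swap.seg_in hmU hy0V hy1V hs
    have Yin : ∀ s ∈ Icc (0:ℝ) 1, Y s ∈ S' := fun s hs => hSm' x hxS y0 hy0 y1 hy1 s hs
    have Y0e : Y 0 = y0 := by
      simp only [hY, segX, zero_smul, add_zero]; exact xOf_left H.swap hmU (subset_closure hy0V)
    have Y1e : Y 1 = y1 := by
      simp only [hY, segX, one_smul, hw, add_sub_cancel]
      exact xOf_left H.swap hmU (subset_closure hy1V)
    have hφ : -cD1 n c (x, y1) (a, 0) + cD1 n c (x, y0) (a, 0) = ⟪w, a⟫_ℝ := by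
      rw [hw, inner_sub_left, H.swap_inner_q hmU hy1V, hp, H.swap_inner_q hmU hy0V]; ring
    set h : ℝ → ℝ := fun s => -(cD2 n c (x, Y s) (a, 0) (a, 0) + cD1 n c (x, Y s) (b, 0)) with hh
    set h' : ℝ → ℝ := fun s => -(cD3 n c (x, Y s) (0, Y1 s) (a, 0) (a, 0) +
      cD2 n c (x, Y s) (0, Y1 s) (b, 0)) with hh'
    set h'' : ℝ → ℝ := fun s => -(cD4 n c (x, Y s) (0, Y1 s) (0, Y1 s) (a, 0) (a, 0) +
      cD3 n c (x, Y s) (0, Y2 s) (a, 0) (a, 0)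
      + (cD3 n c (x, Y s) (0, Y1 s) (0, Y1 s) (b, 0) + cD2 n c (x, Y s) (0, Y2 s) (b, 0))) with hh''
    have dh : ∀ s ∈ Icc (0:ℝ) 1, HasDerivAt h (h' s) s := by
      intro s hs
      have d1 := H.swap.seg_a hmU (hin' s hs)
      rw [← hY, ← hY1] at d1
      have r1 := H.k2 (x := fun _ => x) (y := Y) (v := fun _ => (a, (0 : Euc n)))
        (w := fun _ => (a, (0 : Euc n))) (t := s) (v' := 0) (w' := 0) (hasDerivAt_const s x) d1
        (hasDerivAt_const _ _) (hasDerivAt_const _ _) ⟨hmU, hSV (Yin s hs)⟩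
      have r2 := H.k1 (x := fun _ => x) (y := Y) (v := fun _ => (b, (0 : Euc n))) (t := s) (v' := 0)
        (hasDerivAt_const s x) d1 (hasDerivAt_const _ _) ⟨hmU, hSV (Yin s hs)⟩
      refine (r1.add r2).neg.congr_deriv ?_
      simp only [map_zero, zero_apply, add_zero, hh']
    have dh' : ∀ s ∈ Icc (0:ℝ) 1, HasDerivAt h' (h'' s) s := by
      intro s hs
      have d1 := H.swap.seg_a hmU (hin' s hs)
      have d2 := H.swap.seg_b hmU (hin' s hs)
      rw [← hY, ← hY1] at d1
      rw [← hY1, ← hY2] at d2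
      have d3 : HasDerivAt (fun s => ((0 : Euc n), Y1 s)) (0, Y2 s) s :=
        (hasDerivAt_const _ _).prodMk d2
      have r1 := H.k3 (x := fun _ => x) (y := Y) (v := fun s => ((0 : Euc n), Y1 s))
        (w := fun _ => (a, (0 : Euc n))) (u := fun _ => (a, (0 : Euc n))) (t := s) (u' := 0) (w' := 0)
        (hasDerivAt_const s x) d1 d3
        (hasDerivAt_const _ _) (hasDerivAt_const _ _) ⟨hmU, hSV (Yin s hs)⟩
      have r2 := H.k2 (x := fun _ => x) (y := Y) (v := fun s => ((0 : Euc n), Y1 s))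
        (w := fun _ => (b, (0 : Euc n))) (t := s) (w' := 0)
        (hasDerivAt_const s x) d1 d3 (hasDerivAt_const _ _) ⟨hmU, hSV (Yin s hs)⟩
      refine (r1.add r2).neg.congr_deriv ?_
      simp only [map_zero, zero_apply, add_zero, hh'']
    have h'0 : h' 0 = 0 := by
      simp only [hh', Y0e]
      have hz : (x, y0) ∈ U ×ˢ V := ⟨hmU, hy0V⟩
      rw [H.symm2 hz]
      have e : cD3 n c (x, y0) (a, 0) (a, 0) (0, Y1 0) = cD3 n c (x, y0) (0, Y1 0) (a, 0) (a, 0) := by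
        rw [H.symm3' hz, H.symm3 hz]
      linarith [eq2 (Y1 0)]
    have h2b : ∀ s ∈ Icc (0:ℝ) 1, -(C * ((2 * M / m) * (2 * M' / m'))) * |⟪w, a⟫_ℝ| ≤ h'' s := by
      intro s hs
      have hz : (x, Y s) ∈ U ×ˢ V := ⟨hmU, hSV (Yin s hs)⟩
      have e2 := H.seg_swap_eq2 hmU (hin' s hs)
      have e1 := H.seg_swap_eq1 hmU (hin' s hs)
      rw [← hY, ← hY1] at e1
      rw [← hY, ← hY1, ← hY2] at e2
      obtain ⟨b', hb'⟩ := H.solve hz.1 hz.2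
        (-((cD3 n c (x, Y s) (a, 0) (a, 0)).comp (ContinuousLinearMap.inr ℝ (Euc n) (Euc n))))
      have hb'' : ∀ η, cD3 n c (x, Y s) (a, 0) (a, 0) (0, η) + cD2 n c (x, Y s) (b', 0) (0, η) = 0 := by
        intro η; rw [hb']; simp
      have q := hq x (Y s) ⟨hxS, Yin s hs⟩ a b' (Y1 s) (Y2 s) hb'' e2
      rw [H.symm2 hz (a, 0), e1 a, abs_neg] at q
      have f1 : cD4 n c (x, Y s) (0, Y1 s) (0, Y1 s) (a, 0) (a, 0)
          = cD4 n c (x, Y s) (a, 0) (a, 0) (0, Y1 s) (0, Y1 s) := by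
        rw [H.symm4' hz (0, Y1 s) (0, Y1 s) (a, 0), H.symm4 hz (0, Y1 s) (a, 0),
          H.symm4'' hz (a, 0) (0, Y1 s) (0, Y1 s), H.symm4' hz (a, 0) (0, Y1 s) (a, 0)]
      have f2 : cD3 n c (x, Y s) (a, 0) (a, 0) (0, Y2 s) = cD3 n c (x, Y s) (0, Y2 s) (a, 0) (a, 0) := by
        rw [H.symm3' hz, H.symm3 hz]
      have na : ‖a‖ ≤ 2 * M / m := by
        rw [le_div_iff₀ hm, mul_comm]
        refine H.nd_le hmU hy0V (by positivity) (hnd (x, y0) ⟨hxS, hWS hy0⟩ a) fun η => ?_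
        rw [eq1, abs_neg]
        refine (abs_real_inner_le_norm _ _).trans ?_
        gcongr
        refine (norm_sub_le _ _).trans ?_
        have := H.q_le (hKU hx1) hy0V hM.le (hb (x1, y0) ⟨hKU hx1, hy0V⟩).1
        have := H.q_le (hKU hx0) hy0V hM.le (hb (x0, y0) ⟨hKU hx0, hy0V⟩).1
        linarith
      have nw : ‖w‖ ≤ 2 * M' := by
        refine (norm_sub_le _ _).trans ?_
        have := H.swap.q_le hy1V hmU hM'.le (hbs (y1, x) ⟨hy1V, hmU⟩).1
        have := H.swap.q_le hy0V hmU hM'.le (hbs (y0, x) ⟨hy0V, hmU⟩).1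
        linarith
      have nα : ‖Y1 s‖ ≤ 2 * M' / m' := by
        rw [le_div_iff₀ hm', mul_comm]
        refine H.swap.nd_le hz.2 hmU (by positivity) (hnd' (Y s, x) ⟨Yin s hs, hxS⟩ _) fun η => ?_
        have : cD2 n (swapC n c) (Y s, x) (Y1 s, 0) (0, η) = -⟪w, η⟫_ℝ :=
          H.swap.seg_eq1 hmU (hin' s hs) η
        rw [this, abs_neg]
        refine (abs_real_inner_le_norm _ _).trans ?_
        gcongr
      have q' : C * (‖a‖ * ‖Y1 s‖ * |⟪w, a⟫_ℝ|) ≤ C * ((2 * M / m) * (2 * M' / m') * |⟪w, a⟫_ℝ|) := by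
        gcongr
      simp only [hh'']
      rw [e2 b, f1]
      have := hb'' (Y2 s)
      linarith
    have hψ : -(cD2 n c (x, y1) (a, 0) (a, 0) + cD1 n c (x, y1) (b, 0)) +
          (cD2 n c (x, y0) (a, 0) (a, 0) + cD1 n c (x, y0) (b, 0)) = h 1 - h 0 := by
      simp only [hh, Y0e, Y1e]; ring
    rw [hφ, hψ]
    set R := C * ((2 * M / m) * (2 * M' / m')) with hR
    have hR0 : 0 ≤ R := by positivity
    obtain ⟨s, hs, es⟩ := exists_hasDerivAt_eq_slope h h' (one_pos : (0:ℝ) < 1)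
      (fun s hs => (dh s hs).continuousAt.continuousWithinAt)
      (fun s hs => dh s ⟨hs.1.le, hs.2.le⟩)
    obtain ⟨r, hr, er⟩ := exists_hasDerivAt_eq_slope h' h'' hs.1
      (fun r hr => (dh' r ⟨hr.1, hr.2.trans hs.2.le⟩).continuousAt.continuousWithinAt)
      (fun r hr => dh' r ⟨hr.1.le, hr.2.le.trans hs.2.le⟩)
    have hb2 := h2b r ⟨hr.1.le, hr.2.le.trans hs.2.le⟩
    rw [h'0, eq_div_iff (by linarith [hs.1])] at er
    rw [sub_zero, div_one] at es
    rw [← es]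
    have : h' s = h'' r * s := by linarith
    rw [this]
    have hs1 := hs.1
    have hs2 := hs.2
    have hn : 0 ≤ R * |⟪w, a⟫_ℝ| := by positivity
    nlinarith
end di
end

end Part6

section Part7
open Set MeasureTheory Metric Bornology
open scoped ENNReal NNReal Pointwise InnerProductSpace

noncomputable section
section slopes
variable {n : ℕ} {c : Euc n → Euc n → ℝ} {U V : Set (Euc n)}

/-- slope of `-c(·,y1)+c(·,y0)` in `q_{y0}`-coordinates -/
def slope' (n : ℕ) (c : Euc n → Euc n → ℝ) (x y0 y1 : Euc n) : Euc n :=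
  ContinuousLinearMap.adjoint ((fderiv ℝ (qc n c y0) x).inverse)
    (qc n (swapC n c) x y1 - qc n (swapC n c) x y0)

theorem Raw.slope_inner (H : Raw n c U V) {x y0 : Euc n} (hx : x ∈ U) (hy : y0 ∈ V) (y1 a : Euc n) :
    ⟪slope' n c x y0 y1, fderiv ℝ (qc n c y0) x a⟫_ℝ =
      ⟪qc n (swapC n c) x y1 - qc n (swapC n c) x y0, a⟫_ℝ := by
  rw [slope', ContinuousLinearMap.adjoint_inner_left, ← H.dqE_coe hx hy,
    ContinuousLinearMap.inverse_equiv]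
  simp

theorem Raw.slope_unique (H : Raw n c U V) {x y0 : Euc n} (hx : x ∈ U) (hy : y0 ∈ V) {p w : Euc n}
    (h : ∀ a, ⟪p, fderiv ℝ (qc n c y0) x a⟫_ℝ = ⟪w, a⟫_ℝ) :
    p = ContinuousLinearMap.adjoint ((fderiv ℝ (qc n c y0) x).inverse) w := by
  apply ext_inner_right ℝ
  intro e
  have h1 := h ((H.dqE hx hy).symm e)
  rw [← H.dqE_coe hx hy] at h1
  rw [ContinuousLinearMap.adjoint_inner_left, ← H.dqE_coe hx hy,
    ContinuousLinearMap.inverse_equiv]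
  simpa using h1

theorem Raw.seg_dq (H : Raw n c U V) {y q v : Euc n} {t : ℝ} (hy : y ∈ V)
    (ht : q + t • v ∈ Uyset n c U y) :
    fderiv ℝ (qc n c y) (segX n c U y q v t) (segA n c U y q v t) = v := by
  apply ext_inner_right ℝ
  intro η
  rw [H.inner_dq (H.seg_mem hy ht).1 hy, H.seg_eq1 hy ht, neg_neg]

theorem Raw.I2 (H : Raw n c U V) (h3 : MTW n c U V) {K W : Set (Euc n)} (hK : IsCompact K) (hKU : K ⊆ U)
    (hW : IsCompact W) (hWV : W ⊆ V) : ∃ C : ℝ, 0 < C ∧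
    ∀ y0 ∈ W, ∀ y1 ∈ W, ∀ x0 ∈ K, ∀ x1 ∈ K, ∀ d D : ℝ,
      d = ⟪slope' n c x0 y0 y1, qc n c y0 x1 - qc n c y0 x0⟫_ℝ →
      D = (-c x1 y1 + c x1 y0) - (-c x0 y1 + c x0 y0) →
      (0 ≤ d → d ≤ C * D) ∧ (d ≤ 0 → C * d ≤ D) := by
  obtain ⟨C, hC, hdi⟩ := H.di h3 hK hKU hW hWV
  refine ⟨Real.exp C, Real.exp_pos C, ?_⟩
  intro y0 hy0 y1 hy1 x0 hx0 x1 hx1 d D hd hD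
  have hy0V := hWV hy0
  have hdi := hdi y0 hy0 y1 hy1 x0 hx0 x1 hx1 _ _ _ rfl rfl rfl
  have hin0 := H.seg_in hy0V (hKU hx0) (hKU hx1) (t := 0) (by simp)
  have e0 : segX n c U y0 (qc n c y0 x0) (qc n c y0 x1 - qc n c y0 x0) 0 = x0 := by
    simp only [segX, zero_smul, add_zero]; exact xOf_left H hy0V (subset_closure (hKU hx0))
  have e1 : segX n c U y0 (qc n c y0 x0) (qc n c y0 x1 - qc n c y0 x0) 1 = x1 := by
    simp only [segX, one_smul, add_sub_cancel]; exact xOf_left H hy0V (subset_closure (hKU hx1))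
  have ed := H.seg_dq hy0V hin0
  have hφ : -cD1 n c (x0, y1) (segA n c U y0 (qc n c y0 x0) (qc n c y0 x1 - qc n c y0 x0) 0, 0) +
      cD1 n c (x0, y0) (segA n c U y0 (qc n c y0 x0) (qc n c y0 x1 - qc n c y0 x0) 0, 0) = d := by
    rw [e0] at ed
    have := H.slope_inner (hKU hx0) hy0V y1 (segA n c U y0 (qc n c y0 x0) (qc n c y0 x1 - qc n c y0 x0) 0)
    rw [ed] at this
    rw [hd, this, inner_sub_left, H.swap_inner_q (hKU hx0) (hWV hy1), H.swap_inner_q (hKU hx0) hy0V]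
    ring
  have d1 := hdi.D1
  have d2 := hdi.D2
  simp only [e0, e1] at d1 d2
  rw [hφ, ← hD] at d1 d2
  refine ⟨fun h => ?_, fun h => d2 h⟩
  have := d1 h
  calc d = Real.exp C * (Real.exp (-C) * d) := by rw [← mul_assoc, ← Real.exp_add]; simp
    _ ≤ _ := by have := Real.exp_pos C; gcongr

theorem Raw.I1_int (H : Raw n c U V) (h3 : MTW n c U V) {x0 x1 y0 y1 : Euc n} (hx0 : x0 ∈ U) (hx1 : x1 ∈ U)
    (hy0 : y0 ∈ V) (hy1 : y1 ∈ V) {t : ℝ} (ht : t ∈ Icc (0:ℝ) 1) {x : Euc n}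
    (hx : x = xOf n c U y0 (qc n c y0 x0 + t • (qc n c y0 x1 - qc n c y0 x0))) :
    -c x y1 + c x y0 ≤ max (-c x0 y1 + c x0 y0) (-c x1 y1 + c x1 y0) := by
  have hK : IsCompact ({x0, x1} : Set (Euc n)) := (Set.toFinite _).isCompact
  have hW : IsCompact ({y0, y1} : Set (Euc n)) := (Set.toFinite _).isCompact
  obtain ⟨C, hC, hdi⟩ := H.di h3 hK (by intro z hz; rcases hz with rfl | rfl <;> assumption) hW
    (by intro z hz; rcases hz with rfl | rfl <;> assumption)
  have hdi := hdi y0 (by simp) y1 (by simp) x0 (by simp) x1 (by simp) _ _ _ rfl rfl rfl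
  have e0 : segX n c U y0 (qc n c y0 x0) (qc n c y0 x1 - qc n c y0 x0) 0 = x0 := by
    simp only [segX, zero_smul, add_zero]; exact xOf_left H hy0 (subset_closure hx0)
  have e1 : segX n c U y0 (qc n c y0 x0) (qc n c y0 x1 - qc n c y0 x0) 1 = x1 := by
    simp only [segX, one_smul, add_sub_cancel]; exact xOf_left H hy0 (subset_closure hx1)
  have := hdi.D3 ht
  simp only [e0, e1] at this
  rw [show segX n c U y0 (qc n c y0 x0) (qc n c y0 x1 - qc n c y0 x0) t = x from hx.symm] at this
  exact this

/-- quasi-convexity along `q_{y0}`-segments, up to the boundary. -/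
theorem Raw.I1 (H : Raw n c U V) (h3 : MTW n c U V) {x0 x1 y0 y1 : Euc n} (hx0 : x0 ∈ closure U)
    (hx1 : x1 ∈ closure U) (hy0 : y0 ∈ V) (hy1 : y1 ∈ closure V) {t : ℝ} (ht : t ∈ Icc (0:ℝ) 1) {x : Euc n}
    (hx : x ∈ closure U) (hq : qc n c y0 x = qc n c y0 x0 + t • (qc n c y0 x1 - qc n c y0 x0)) :
    -c x y1 + c x y0 ≤ max (-c x0 y1 + c x0 y0) (-c x1 y1 + c x1 y0) := by
  have hx' : x = xOf n c U y0 (qc n c y0 x0 + t • (qc n c y0 x1 - qc n c y0 x0)) := by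
    rw [← hq, xOf_left H hy0 hx]
  set X : Euc n × Euc n × Euc n → Euc n := fun p =>
    xOf n c U y0 (qc n c y0 p.1 + t • (qc n c y0 p.2.1 - qc n c y0 p.1)) with hX
  set D := closure U ×ˢ closure U ×ˢ closure V with hD
  have hDe : D = closure (U ×ˢ U ×ˢ V) := by rw [closure_prod_eq, closure_prod_eq]
  have hmem : ∀ p ∈ D, qc n c y0 p.1 + t • (qc n c y0 p.2.1 - qc n c y0 p.1) ∈ clUy n c U y0 := by
    intro p hp
    have := (H.clUy_convex hy0) (Raw.qc_mem_cl p.1 y0 hp.1) (Raw.qc_mem_cl p.2.1 y0 hp.2.1)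
      (sub_nonneg.2 ht.2) ht.1 (by ring)
    convert this using 1
    module
  have g1 : ContinuousOn (fun p : Euc n × Euc n × Euc n => qc n c y0 p.1) D :=
    (H.contq hy0).comp (by fun_prop) (fun p hp => hp.1)
  have g2 : ContinuousOn (fun p : Euc n × Euc n × Euc n => qc n c y0 p.2.1) D :=
    (H.contq hy0).comp (f := fun p : Euc n × Euc n × Euc n => p.2.1) (by fun_prop) (fun p hp => hp.2.1)
  have g3 : ContinuousOn X D := by
    obtain ⟨K, hK⟩ := H.lipX hy0
    exact hK.continuousOn.comp (g1.add ((g2.sub g1).const_smul t)) hmem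
  have hXm : ∀ p ∈ D, X p ∈ closure U := fun p hp => (xOf_mem (hmem p hp)).1
  have gc : ∀ f g : Euc n × Euc n × Euc n → Euc n, ContinuousOn f D → ContinuousOn g D →
      (∀ p ∈ D, f p ∈ closure U) → (∀ p ∈ D, g p ∈ closure V) →
      ContinuousOn (fun p => c (f p) (g p)) D := by
    intro f g hf hg hfm hgm
    exact H.contOn.comp (f := fun p => (f p, g p)) (hf.prodMk hg) (fun p hp => ⟨hfm p hp, hgm p hp⟩)
  have c1 : ContinuousOn (fun p : Euc n × Euc n × Euc n => p.1) D := by fun_prop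
  have c2 : ContinuousOn (fun p : Euc n × Euc n × Euc n => p.2.1) D := by fun_prop
  have c3 : ContinuousOn (fun p : Euc n × Euc n × Euc n => p.2.2) D := by fun_prop
  have c4 : ContinuousOn (fun p : Euc n × Euc n × Euc n => y0) D := by fun_prop
  have m4 : ∀ p ∈ D, y0 ∈ closure V := fun p hp => subset_closure hy0
  have key := le_on_closure (s := U ×ˢ U ×ˢ V)
    (f := fun p : Euc n × Euc n × Euc n => -c (X p) p.2.2 + c (X p) y0)
    (g := fun p => max (-c p.1 p.2.2 + c p.1 y0) (-c p.2.1 p.2.2 + c p.2.1 y0))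
    (fun p hp => H.I1_int h3 hp.1 hp.2.1 hy0 hp.2.2 ht rfl)
    (by
      rw [← hDe]
      exact (gc _ _ g3 c3 hXm (fun p hp => hp.2.2)).neg.add (gc _ _ g3 c4 hXm m4))
    (by
      rw [← hDe]
      exact ((gc _ _ c1 c3 (fun p hp => hp.1) (fun p hp => hp.2.2)).neg.add
        (gc _ _ c1 c4 (fun p hp => hp.1) m4)).sup
        ((gc _ _ c2 c3 (fun p hp => hp.2.1) (fun p hp => hp.2.2)).neg.add
        (gc _ _ c2 c4 (fun p hp => hp.2.1) m4)))
    (x := (x0, x1, y1)) (by rw [← hDe]; exact ⟨hx0, hx1, hy1⟩)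
  rw [hx']; exact key

/-- uniform anti-Lipschitz on compacts -/
theorem Raw.antilipU (H : Raw n c U V) {K W : Set (Euc n)} (hK : IsCompact K) (hKU : K ⊆ U)
    (hW : IsCompact W) (hWV : W ⊆ V) : ∃ A : ℝ, 0 < A ∧ ∀ y ∈ W, ∀ x ∈ K, ∀ x' ∈ K,
      ‖x - x'‖ ≤ A * ‖qc n c y x - qc n c y x'‖ := by
  obtain ⟨S, hS, hSU, hKS, hSm⟩ := H.hull hK hKU hW hWV
  obtain ⟨m, hm, hnd⟩ := H.nd (hS.prod hW) (prod_mono hSU hWV)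
  refine ⟨1 / m, by positivity, fun y hy x hx x' hx' => ?_⟩
  have hyV := hWV hy
  have hin : ∀ t ∈ Icc (0:ℝ) 1, _ := fun t ht => H.seg_in hyV (hKU hx') (hKU hx) ht
  have e0 : segX n c U y (qc n c y x') (qc n c y x - qc n c y x') 0 = x' := by
    simp only [segX, zero_smul, add_zero]; exact xOf_left H hyV (subset_closure (hKU hx'))
  have e1 : segX n c U y (qc n c y x') (qc n c y x - qc n c y x') 1 = x := by
    simp only [segX, one_smul, add_sub_cancel]; exact xOf_left H hyV (subset_closure (hKU hx))
  have := norm_image_sub_le_of_norm_deriv_le_segment_01' (C := 1 / m * ‖qc n c y x - qc n c y x'‖)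
    (fun t ht => (H.seg_a hyV (hin t ht)).hasDerivWithinAt) (fun t ht => by
      have ht' : t ∈ Icc (0:ℝ) 1 := ⟨ht.1, ht.2.le⟩
      have h1 : m * ‖segA n c U y (qc n c y x') (qc n c y x - qc n c y x') t‖ ≤
          ‖fderiv ℝ (qc n c y) (segX n c U y (qc n c y x') (qc n c y x - qc n c y x') t)
            (segA n c U y (qc n c y x') (qc n c y x - qc n c y x') t)‖ :=
        hnd (segX n c U y (qc n c y x') (qc n c y x - qc n c y x') t, y)
          ⟨hSm y hy x' hx' x hx t ht', hy⟩
          (segA n c U y (qc n c y x') (qc n c y x - qc n c y x') t)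
      rw [H.seg_dq hyV (hin t ht')] at h1
      rw [one_div, inv_mul_eq_div, le_div_iff₀ hm, mul_comm]; exact h1)
  rwa [e0, e1] at this

theorem Raw.dq_norm (H : Raw n c U V) : ∃ M : ℝ, 0 < M ∧ ∀ x ∈ U, ∀ y ∈ V,
    ‖fderiv ℝ (qc n c y) x‖ ≤ M := by
  obtain ⟨M, hM, hb⟩ := H.bds
  refine ⟨M, hM, fun x hx y hy => ?_⟩
  refine ContinuousLinearMap.opNorm_le_bound _ hM.le fun a => ?_
  set w := fderiv ℝ (qc n c y) x a with hw
  have h1 := H.inner_dq hx hy a w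
  rw [← hw, real_inner_self_eq_norm_sq] at h1
  have h2 := (hb (x, y) ⟨hx, hy⟩).2.1 (a, 0) (0, w)
  rw [nrm1, nrm2] at h2
  have h3 := neg_abs_le (cD2 n c (x, y) (a, 0) (0, w))
  by_contra hc
  push Not at hc
  have : 0 ≤ M * ‖a‖ := by positivity
  nlinarith

theorem Raw.lipq (H : Raw n c U V) : ∃ M : ℝ, 0 < M ∧ ∀ B : Set (Euc n), Convex ℝ B → B ⊆ U →
    ∀ y ∈ V, ∀ x ∈ B, ∀ x' ∈ B, ‖qc n c y x - qc n c y x'‖ ≤ M * ‖x - x'‖ := by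
  obtain ⟨M, hM, hb⟩ := H.dq_norm
  refine ⟨M, hM, fun B hB hBU y hy x hx x' hx' => ?_⟩
  exact hB.norm_image_sub_le_of_norm_fderiv_le (𝕜 := ℝ)
    (fun z hz => (H.cdq (hBU hz) hy).differentiableAt (by norm_num))
    (fun z hz => hb z (hBU hz) y hy) hx' hx
end slopes
end

end Part7

section Part8
open Set MeasureTheory Metric Bornology
open scoped ENNReal NNReal Pointwise InnerProductSpace

noncomputable section
section slopes2
variable {n : ℕ} {c : Euc n → Euc n → ℝ} {U V : Set (Euc n)}

theorem Raw.slope_deriv (H : Raw n c U V) {y0 y q v : Euc n} {t : ℝ} (hy0 : y0 ∈ V)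
    (hy : y ∈ closure V) (ht : q + t • v ∈ Uyset n c U y0) :
    HasDerivAt (fun t => -c (segX n c U y0 q v t) y + c (segX n c U y0 q v t) y0)
      ⟪slope' n c (segX n c U y0 q v t) y0 y, v⟫_ℝ t := by
  have hx := (H.seg_mem hy0 ht).1
  have ha := H.seg_a hy0 ht
  have g1 : HasGradientAt (fun x' => c x' y) (gradY n (swapC n c) y (segX n c U y0 q v t))
    (segX n c U y0 q v t) := H.swap.hasGradY hy hx
  have g2 : HasGradientAt (fun x' => c x' y0) (gradY n (swapC n c) y0 (segX n c U y0 q v t))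
    (segX n c U y0 q v t) := H.swap.hasGradY (subset_closure hy0) hx
  have d1 := HasFDerivAt.comp_hasDerivAt t g1.hasFDerivAt ha
  have d2 := HasFDerivAt.comp_hasDerivAt t g2.hasFDerivAt ha
  have d := d1.neg.add d2
  refine d.congr_deriv ?_
  have h := H.slope_inner hx hy0 y (segA n c U y0 q v t)
  rw [H.seg_dq hy0 ht] at h
  rw [h]
  simp only [InnerProductSpace.toDual_apply_apply, qc, inner_sub_left, inner_neg_left]
  ring

theorem Raw.slope_cont (H : Raw n c U V) {y0 : Euc n} (hy0 : y0 ∈ V) :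
    ContinuousOn (fun z : Euc n × Euc n => slope' n c z.1 y0 z.2) (U ×ˢ closure V) := by
  have h1 : ContinuousOn (fun x => ContinuousLinearMap.adjoint ((fderiv ℝ (qc n c y0) x).inverse)) U := by
    intro x hx
    have a1 : ContinuousAt (fderiv ℝ (qc n c y0)) x :=
      ((H.cdq hx hy0).fderiv_right (m := 2) (by norm_num)).continuousAt
    have a2 : ContinuousAt (ContinuousLinearMap.inverse (M := Euc n) (M₂ := Euc n) (R := ℝ))
        (fderiv ℝ (qc n c y0) x) := by
      rw [← H.dqE_coe hx hy0]
      exact (contDiffAt_map_inverse (n := 0) (𝕜 := ℝ) (H.dqE hx hy0)).continuousAt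
    have a3 : ContinuousAt (fun x => (fderiv ℝ (qc n c y0) x).inverse) x :=
      ContinuousAt.comp (g := ContinuousLinearMap.inverse) a2 a1
    exact ((ContinuousLinearMap.adjoint (𝕜 := ℝ) (E := Euc n) (F := Euc n)).continuous.continuousAt.comp
      a3).continuousWithinAt
  have h2 : ContinuousOn (fun z : Euc n × Euc n => qc n (swapC n c) z.1 z.2 - qc n (swapC n c) z.1 y0)
      (U ×ˢ closure V) := by
    refine ContinuousOn.sub ?_ ?_
    · exact H.swap.contq2.comp (f := fun z : Euc n × Euc n => (z.2, z.1)) (by fun_prop)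
        (fun z hz => ⟨hz.2, hz.1⟩)
    · exact H.swap.contq2.comp (f := fun z : Euc n × Euc n => (y0, z.1)) (by fun_prop)
        (fun z hz => ⟨subset_closure hy0, hz.1⟩)
  exact (h1.comp continuousOn_fst (fun z hz => hz.1)).clm_apply h2

theorem Raw.slope_sub (x y0 y y' : Euc n) : slope' n c x y0 y - slope' n c x y0 y' =
    ContinuousLinearMap.adjoint ((fderiv ℝ (qc n c y0) x).inverse)
    (qc n (swapC n c) x y - qc n (swapC n c) x y') := by
  simp only [slope', ← map_sub]; congr 1; abel

theorem slope_self (x y0 : Euc n) : slope' n c x y0 y0 = 0 := by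
  simp [slope']

theorem slope_affine {x y0 y y1 y' : Euc n} {t : ℝ}
    (h : qc n (swapC n c) x y = qc n (swapC n c) x y1 + t • (qc n (swapC n c) x y' - qc n (swapC n c) x y1)) :
    slope' n c x y0 y = slope' n c x y0 y1 + t • (slope' n c x y0 y' - slope' n c x y0 y1) := by
  rw [Raw.slope_sub, ← map_smul, slope', slope', ← map_add, h]; congr 1; abel

/-- Lipschitz bound for the p-coordinates -/
theorem Raw.p_le_slope (H : Raw n c U V) : ∃ M : ℝ, 0 < M ∧ ∀ x ∈ U, ∀ y0 ∈ V, ∀ y y',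
    ‖qc n (swapC n c) x y - qc n (swapC n c) x y'‖ ≤ M * ‖slope' n c x y0 y - slope' n c x y0 y'‖ := by
  obtain ⟨M, hM, hb⟩ := H.dq_norm
  refine ⟨M, hM, fun x hx y0 hy0 y y' => ?_⟩
  set w := qc n (swapC n c) x y - qc n (swapC n c) x y' with hw
  have h1 : ⟪slope' n c x y0 y - slope' n c x y0 y', fderiv ℝ (qc n c y0) x w⟫_ℝ = ⟪w, w⟫_ℝ := by
    rw [inner_sub_left, H.slope_inner hx hy0, H.slope_inner hx hy0, ← inner_sub_left]
    congr 1; rw [hw]; abel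
  rw [real_inner_self_eq_norm_sq] at h1
  have h2 := real_inner_le_norm (slope' n c x y0 y - slope' n c x y0 y') (fderiv ℝ (qc n c y0) x w)
  have h3 : ‖fderiv ℝ (qc n c y0) x w‖ ≤ M * ‖w‖ :=
    (ContinuousLinearMap.le_opNorm _ _).trans (by gcongr; exact hb x hx y0 hy0)
  rcases eq_or_lt_of_le (norm_nonneg w) with h0 | h0
  · rw [← h0]; positivity
  · have : ‖w‖ * ‖w‖ ≤ (M * ‖slope' n c x y0 y - slope' n c x y0 y'‖) * ‖w‖ := by
      calc ‖w‖ * ‖w‖ = ‖w‖^2 := by ring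
        _ ≤ ‖slope' n c x y0 y - slope' n c x y0 y'‖ * ‖fderiv ℝ (qc n c y0) x w‖ := by rw [← h1]; exact h2
        _ ≤ ‖slope' n c x y0 y - slope' n c x y0 y'‖ * (M * ‖w‖) := by gcongr
        _ = _ := by ring
    exact le_of_mul_le_mul_right this h0

theorem Raw.slope_le_p (H : Raw n c U V) {K W : Set (Euc n)} (hK : IsCompact K) (hKU : K ⊆ U)
    (hW : IsCompact W) (hWV : W ⊆ V) : ∃ M : ℝ, 0 < M ∧ ∀ x ∈ K, ∀ y0 ∈ W, ∀ y y',
    ‖slope' n c x y0 y - slope' n c x y0 y'‖ ≤ M * ‖qc n (swapC n c) x y - qc n (swapC n c) x y'‖ := by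
  obtain ⟨m, hm, hnd⟩ := H.nd (hK.prod hW) (prod_mono hKU hWV)
  refine ⟨1 / m, by positivity, fun x hx y0 hy0 y y' => ?_⟩
  have hxU := hKU hx
  have hyV := hWV hy0
  set P := slope' n c x y0 y - slope' n c x y0 y' with hP
  set a := (H.dqE hxU hyV).symm P with ha
  have e1 : fderiv ℝ (qc n c y0) x a = P := by
    rw [← H.dqE_coe hxU hyV, ha]; simp
  have h1 : ⟪P, P⟫_ℝ = ⟪qc n (swapC n c) x y - qc n (swapC n c) x y', a⟫_ℝ := by
    conv_lhs => rw [← e1]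
    rw [e1]
    conv_lhs => rw [← e1]
    rw [e1]
    nth_rewrite 2 [← e1]
    rw [hP, inner_sub_left, H.slope_inner hxU hyV, H.slope_inner hxU hyV, ← inner_sub_left]
    congr 1; abel
  have h2 : m * ‖a‖ ≤ ‖P‖ := by
    have := hnd (x, y0) ⟨hx, hy0⟩ a
    rwa [e1] at this
  rw [real_inner_self_eq_norm_sq] at h1
  have h3 := real_inner_le_norm (qc n (swapC n c) x y - qc n (swapC n c) x y') a
  rw [← h1] at h3
  set w := qc n (swapC n c) x y - qc n (swapC n c) x y'
  have h4 : m * ‖P‖ * ‖P‖ ≤ ‖w‖ * ‖P‖ := by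
    nlinarith [norm_nonneg w, norm_nonneg a]
  rw [one_div, inv_mul_eq_div, le_div_iff₀ hm]
  rcases eq_or_lt_of_le (norm_nonneg P) with h0 | h0
  · rw [← h0]; simp
  · have := le_of_mul_le_mul_right h4 h0
    linarith

/-- (S4) -/
theorem Raw.slope_antilip (H : Raw n c U V) {K W : Set (Euc n)} (hK : IsCompact K) (hKU : K ⊆ U)
    (hW : IsCompact W) (hWV : W ⊆ V) : ∃ M : ℝ, 0 < M ∧ ∀ x ∈ K, ∀ y0 ∈ V, ∀ y ∈ W, ∀ y' ∈ W,
    ‖y - y'‖ ≤ M * ‖slope' n c x y0 y - slope' n c x y0 y'‖ := by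
  obtain ⟨A, hA, h1⟩ := H.swap.antilipU hW hWV hK hKU
  obtain ⟨M, hM, h2⟩ := H.p_le_slope
  refine ⟨A * M, by positivity, fun x hx y0 hy0 y hy y' hy' => (h1 x hx y hy y' hy').trans ?_⟩
  rw [mul_assoc]; gcongr; exact h2 x (hKU hx) y0 hy0 y y'

theorem Raw.slope_lip (H : Raw n c U V) {K W : Set (Euc n)} (hK : IsCompact K) (hKU : K ⊆ U)
    (hW : IsCompact W) (hWV : W ⊆ V) (hWc : Convex ℝ W) :
    ∃ M : ℝ, 0 < M ∧ ∀ x ∈ K, ∀ y0 ∈ W, ∀ y ∈ W, ∀ y' ∈ W,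
    ‖slope' n c x y0 y - slope' n c x y0 y'‖ ≤ M * ‖y - y'‖ := by
  obtain ⟨A, hA, h1⟩ := H.slope_le_p hK hKU hW hWV
  obtain ⟨M, hM, h2⟩ := H.swap.lipq
  refine ⟨A * M, by positivity, fun x hx y0 hy0 y hy y' hy' => (h1 x hx y0 hy0 y y').trans ?_⟩
  rw [mul_assoc]; gcongr; exact h2 W hWc hWV x (hKU hx) y hy y' hy'

theorem Raw.slope_small (H : Raw n c U V) {K W : Set (Euc n)} (hK : IsCompact K) (hKU : K ⊆ U)
    (hW : IsCompact W) (hWV : W ⊆ V) {r : ℝ} (hr : 0 < r) : ∃ δ : ℝ, 0 < δ ∧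
    ∀ x ∈ K, ∀ y0 ∈ W, ∀ y ∈ closure V, ‖slope' n c x y0 y‖ ≤ δ → ‖y - y0‖ < r := by
  obtain ⟨M, hM, h2⟩ := H.p_le_slope
  set A : Set (Euc n × Euc n × Euc n) := (K ×ˢ W ×ˢ closure V) ∩ {z | r ≤ ‖z.2.2 - z.2.1‖} with hA
  have hAc : IsCompact A := by
    refine (hK.prod (hW.prod H.compV)).inter_right ?_
    exact isClosed_le continuous_const (by fun_prop)
  have hf : ContinuousOn (fun z : Euc n × Euc n × Euc n =>
      ‖qc n (swapC n c) z.1 z.2.2 - qc n (swapC n c) z.1 z.2.1‖) A := by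
    refine ContinuousOn.norm (ContinuousOn.sub ?_ ?_)
    · exact H.swap.contq2.comp (f := fun z : Euc n × Euc n × Euc n => (z.2.2, z.1)) (by fun_prop)
        (fun z hz => ⟨hz.1.2.2, hKU hz.1.1⟩)
    · exact H.swap.contq2.comp (f := fun z : Euc n × Euc n × Euc n => (z.2.1, z.1)) (by fun_prop)
        (fun z hz => ⟨subset_closure (hWV hz.1.2.1), hKU hz.1.1⟩)
  rcases A.eq_empty_or_nonempty with he | hne
  · refine ⟨1, one_pos, fun x hx y0 hy0 y hy _ => ?_⟩
    by_contra hc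
    push Not at hc
    have : (x, y0, y) ∈ A := ⟨⟨hx, hy0, hy⟩, hc⟩
    rw [he] at this; exact this
  · obtain ⟨z, hz, hmin⟩ := hAc.exists_isMinOn hne hf
    set g := ‖qc n (swapC n c) z.1 z.2.2 - qc n (swapC n c) z.1 z.2.1‖ with hg
    have hg0 : 0 < g := by
      rw [hg, norm_pos_iff, sub_ne_zero]
      intro he
      have h5 := H.swap.injq (hKU hz.1.1) hz.1.2.2 (subset_closure (hWV hz.1.2.1)) he
      have h6 := hz.2
      simp only [mem_ofPred_eq, h5, sub_self, norm_zero] at h6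
      linarith
    refine ⟨g / (2 * M), by positivity, fun x hx y0 hy0 y hy hs => ?_⟩
    by_contra hc
    push Not at hc
    have hmem : (x, y0, y) ∈ A := ⟨⟨hx, hy0, hy⟩, hc⟩
    have h7 := isMinOn_iff.1 hmin _ hmem
    simp only [← hg] at h7
    have h8 := h2 x (hKU hx) y0 (hWV hy0) y y0
    rw [slope_self, sub_zero] at h8
    have h9 : M * ‖slope' n c x y0 y‖ ≤ M * (g / (2 * M)) := by gcongr
    have h10 : M * (g / (2 * M)) = g / 2 := by field_simp
    linarith

/-- (S5) -/
theorem Raw.slope_quad (H : Raw n c U V) {K W : Set (Euc n)} (hK : IsCompact K) (hKU : K ⊆ U)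
    (hW : IsCompact W) (hWV : W ⊆ V) (hWc : Convex ℝ W) :
    ∃ M : ℝ, 0 < M ∧ ∀ x ∈ K, ∀ y0 ∈ W, ∀ y ∈ W,
    ‖slope' n c x y0 y - (y - y0)‖ ≤ M * ‖y - y0‖ ^ 2 := by
  obtain ⟨m, hm, hnd⟩ := H.nd (hK.prod hW) (prod_mono hKU hWV)
  obtain ⟨M, hM, hb⟩ := H.bds
  refine ⟨M / m, by positivity, fun x hx y0 hy0 y hy => ?_⟩
  have hxU := hKU hx
  have hyV := hWV hy0
  set η := y - y0 with hη
  set P := slope' n c x y0 y with hP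
  set a := (H.dqE hxU hyV).symm (P - η) with ha
  have e1 : fderiv ℝ (qc n c y0) x a = P - η := by
    rw [← H.dqE_coe hxU hyV, ha]; simp
  have h2 : m * ‖a‖ ≤ ‖P - η‖ := by
    have := hnd (x, y0) ⟨hx, hy0⟩ a
    rwa [e1] at this
  have hsW : ∀ s ∈ Icc (0:ℝ) 1, y0 + s • η ∈ W := fun s hs => by
    have := hWc.add_smul_sub_mem hy0 hy hs; simpa [hη] using this
  have hd : ∀ s, HasDerivAt (fun s : ℝ => y0 + s • η) η s := fun s => by
    simpa using ((hasDerivAt_id s).smul_const η).const_add y0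
  have k1 : ∀ s ∈ Icc (0:ℝ) 1, HasDerivAt (fun s => -cD1 n c (x, y0 + s • η) (a, 0))
      (-cD2 n c (x, y0 + s • η) (0, η) (a, 0)) s := fun s hs => by
    have := (H.k1 (x := fun _ => x) (y := fun s : ℝ => y0 + s • η) (v := fun _ => (a, 0))
      (hasDerivAt_const s x) (hd s) (hasDerivAt_const s _) ⟨hxU, hWV (hsW s hs)⟩).neg
    refine this.congr_deriv ?_
    rw [map_zero, add_zero]
  have k2 : ∀ s ∈ Icc (0:ℝ) 1, HasDerivAt (fun s => -cD2 n c (x, y0 + s • η) (0, η) (a, 0))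
      (-cD3 n c (x, y0 + s • η) (0, η) (0, η) (a, 0)) s := fun s hs => by
    have := (H.k2 (x := fun _ => x) (y := fun s : ℝ => y0 + s • η) (v := fun _ => (0, η))
      (w := fun _ => (a, 0)) (v' := 0) (w' := 0)
      (hasDerivAt_const s x) (hd s) (hasDerivAt_const s _) (hasDerivAt_const s _)
      ⟨hxU, hWV (hsW s hs)⟩).neg
    refine this.congr_deriv ?_
    rw [map_zero, map_zero, zero_apply, add_zero, add_zero]
  set B := M * ‖η‖ * ‖η‖ * ‖a‖ with hB
  have b2 : ∀ s ∈ Icc (0:ℝ) 1, ‖-cD2 n c (x, y0 + s • η) (0, η) (a, 0) -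
      -cD2 n c (x, y0 + (0:ℝ) • η) (0, η) (a, 0)‖ ≤ B := by
    intro s hs
    have := norm_image_sub_le_of_norm_deriv_le_segment'
      (f := fun s => -cD2 n c (x, y0 + s • η) (0, η) (a, 0)) (C := B)
      (fun t ht => (k2 t ht).hasDerivWithinAt) (fun t ht => by
        have h := (hb (x, y0 + t • η) ⟨hxU, hWV (hsW t ⟨ht.1, ht.2.le⟩)⟩).2.2.1 (0, η) (0, η) (a, 0)
        rw [nrm1, nrm2] at h
        rw [norm_neg, Real.norm_eq_abs]; exact h) s hs
    refine this.trans ?_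
    have hB0 : 0 ≤ B := by positivity
    nlinarith [hs.1, hs.2]
  have b1 := norm_image_sub_le_of_norm_deriv_le_segment_01'
      (f := fun s => -cD1 n c (x, y0 + s • η) (a, 0) - s * -cD2 n c (x, y0 + (0:ℝ) • η) (0, η) (a, 0))
      (C := B)
      (fun t ht => ((k1 t ht).sub ((hasDerivAt_id t).mul_const _)).hasDerivWithinAt) (fun t ht => by
        rw [one_mul]; exact b2 t ⟨ht.1, ht.2.le⟩)
  simp only [zero_smul, one_smul, add_zero, zero_mul, sub_zero, one_mul, neg_neg] at b1
  have ey : y0 + η = y := by rw [hη]; abel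
  rw [ey] at b1
  have i1 : ⟪P - η, P - η⟫_ℝ = (-cD1 n c (x, y) (a, 0) - -cD2 n c (x, y0) (0, η) (a, 0)) -
      -cD1 n c (x, y0) (a, 0) := by
    have j1 : ⟪P, fderiv ℝ (qc n c y0) x a⟫_ℝ = -cD1 n c (x, y) (a, 0) - -cD1 n c (x, y0) (a, 0) := by
      rw [hP, H.slope_inner hxU hyV, inner_sub_left, H.swap_inner_q hxU (hWV hy),
        H.swap_inner_q hxU hyV]
    have j2 : ⟪η, fderiv ℝ (qc n c y0) x a⟫_ℝ = -cD2 n c (x, y0) (0, η) (a, 0) := by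
      rw [real_inner_comm, H.inner_dq hxU hyV, H.symm2 ⟨hxU, hyV⟩]
    rw [e1] at j1 j2
    rw [inner_sub_left, j1, j2]; ring
  have i2 : ⟪P - η, P - η⟫_ℝ ≤ B := by
    rw [i1]; refine (le_abs_self _).trans ?_
    rw [← Real.norm_eq_abs]
    convert b1 using 2
  rw [real_inner_self_eq_norm_sq] at i2
  have i3 : m * ‖P - η‖ * ‖P - η‖ ≤ (M * ‖η‖^2) * ‖P - η‖ := by
    have : 0 ≤ M * ‖η‖^2 := by positivity
    calc m * ‖P - η‖ * ‖P - η‖ = m * ‖P - η‖^2 := by ring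
      _ ≤ m * B := by gcongr
      _ = (M * ‖η‖^2) * (m * ‖a‖) := by rw [hB]; ring
      _ ≤ _ := by gcongr
  rw [div_mul_eq_mul_div, le_div_iff₀ hm]
  rcases eq_or_lt_of_le (norm_nonneg (P - η)) with h0 | h0
  · rw [← h0]; simp; positivity
  · have := le_of_mul_le_mul_right i3 h0
    linarith

end slopes2
end

end Part8

section Part9
open Set MeasureTheory Metric Bornology
open scoped ENNReal NNReal Pointwise InnerProductSpace

noncomputable section
section potentials
variable {n : ℕ} {c : Euc n → Euc n → ℝ} {U V : Set (Euc n)}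

/-- a pair of conjugate potentials -/
structure Pot (n : ℕ) (c : Euc n → Euc n → ℝ) (U V : Set (Euc n)) (u v : Euc n → ℝ) : Prop where
  contu : ContinuousOn u (closure U)
  contv : ContinuousOn v (closure V)
  ineq : ∀ x ∈ closure U, ∀ y ∈ closure V, 0 ≤ u x + v y + c x y
  exY : ∀ x ∈ closure U, ∃ y ∈ closure V, u x + v y + c x y = 0
  exX : ∀ y ∈ closure V, ∃ x ∈ closure U, u x + v y + c x y = 0

theorem Pot.swap {u v : Euc n → ℝ} (h : Pot n c U V u v) : Pot n (swapC n c) V U v u where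
  contu := h.contv
  contv := h.contu
  ineq y hy x hx := by have := h.ineq x hx y hy; simp only [swapC]; linarith
  exY y hy := by
    obtain ⟨x, hx, e⟩ := h.exX y hy
    exact ⟨x, hx, by simp only [swapC]; linarith⟩
  exX x hx := by
    obtain ⟨y, hy, e⟩ := h.exY x hx
    exact ⟨y, hy, by simp only [swapC]; linarith⟩

theorem Raw.modulus (H : Raw n c U V) {ε : ℝ} (hε : 0 < ε) : ∃ δ > 0, ∀ x ∈ closure U, ∀ x' ∈ closure U,
    dist x x' < δ → ∀ y ∈ closure V, |c x y - c x' y| < ε := by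
  have huc := (H.compU.prod H.compV).uniformContinuousOn_of_continuous H.contOn
  rw [Metric.uniformContinuousOn_iff] at huc
  obtain ⟨δ, hδ, h⟩ := huc ε hε
  refine ⟨δ, hδ, fun x hx x' hx' hd y hy => ?_⟩
  have := h (x, y) ⟨hx, hy⟩ (x', y) ⟨hx', hy⟩ (by simpa [Prod.dist_eq] using hd)
  simpa [Real.dist_eq, Function.uncurry] using this

/-- sup of an equicontinuous family is continuous -/
theorem cont_sup {A B : Set (Euc n)} {k : Euc n → Euc n → ℝ} {w f : Euc n → ℝ}
    (hB : B.Nonempty)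
    (hw : ∀ x ∈ A, IsLUB ((fun y => -k x y - f y) '' B) (w x))
    (hk : ∀ ε > 0, ∃ δ > 0, ∀ x ∈ A, ∀ x' ∈ A, dist x x' < δ → ∀ y ∈ B, |k x y - k x' y| < ε) :
    ContinuousOn w A := by
  rw [Metric.continuousOn_iff]
  intro x hx ε hε
  obtain ⟨δ, hδ, h⟩ := hk (ε / 2) (by positivity)
  have key : ∀ x ∈ A, ∀ x' ∈ A, dist x x' < δ → w x ≤ w x' + ε / 2 := by
    intro x hx x' hx' hd
    apply (hw x hx).2
    rintro _ ⟨y, hy, rfl⟩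
    have h1 := (hw x' hx').1 ⟨y, hy, rfl⟩
    have h2 := abs_lt.1 (h x hx x' hx' hd y hy)
    simp only at h1 ⊢
    linarith
  refine ⟨δ, hδ, fun x' hx' hd => ?_⟩
  have h1 := key x hx x' hx' (by rwa [dist_comm])
  have h2 := key x' hx' x hx hd
  rw [Real.dist_eq, abs_lt]
  constructor <;> linarith

theorem Raw.pot (H : Raw n c U V) (hU : U.Nonempty) (hV : V.Nonempty) {u : Euc n → ℝ}
    (hu : CConvexOn n c (closure U) (closure V) u) :
    Pot n c U V u (cStarT n c (closure U) u) := by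
  obtain ⟨Bd, hBd⟩ := (H.compU.prod H.compV).exists_bound_of_continuousOn H.contOn
  have hc : ∀ x ∈ closure U, ∀ y ∈ closure V, |c x y| ≤ Bd := fun x hx y hy => by
    simpa [Function.uncurry] using hBd (x, y) ⟨hx, hy⟩
  set v := cStarT n c (closure U) u with hv
  have hUc := hU.closure
  have hVc := hV.closure
  -- `u` is bounded below
  have hlow : ∃ m : ℝ, ∀ x ∈ closure U, m ≤ u x := by
    by_contra hcon
    push Not at hcon
    have hv0 : ∀ y ∈ closure V, v y = 0 := by
      intro y hy
      rw [hv]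
      unfold cStarT
      apply Real.sSup_of_not_bddAbove
      rintro ⟨b, hb⟩
      obtain ⟨x, hx, hlt⟩ := hcon (-b - Bd)
      have h1 : -c x y - u x ≤ b := hb ⟨x, hx, rfl⟩
      have h2 := abs_le.1 (hc x hx y hy)
      linarith
    obtain ⟨x, hx, hlt⟩ := hcon (-Bd)
    have h1 := hu x hx
    obtain ⟨y, hy⟩ := hVc
    have h2 : -c x y - v y ≤ u x := by
      rw [h1]
      refine le_csSup ⟨Bd, ?_⟩ ⟨y, hy, rfl⟩
      rintro _ ⟨y', hy', rfl⟩
      have h2 := abs_le.1 (hc x hx y' hy')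
      have h3 := hv0 y' hy'
      simp only [← hv, h3]; linarith
    rw [hv0 y hy] at h2
    have h3 := abs_le.1 (hc x hx y hy)
    linarith
  obtain ⟨m, hm⟩ := hlow
  have lubv : ∀ y ∈ closure V, IsLUB ((fun x => -swapC n c y x - u x) '' closure U) (v y) := by
    intro y hy
    refine isLUB_csSup (hUc.image _) ⟨Bd - m, ?_⟩
    rintro _ ⟨x, hx, rfl⟩
    have h2 := abs_le.1 (hc x hx y hy)
    have h3 := hm x hx
    simp only [swapC]; linarith
  have ineq : ∀ x ∈ closure U, ∀ y ∈ closure V, 0 ≤ u x + v y + c x y := by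
    intro x hx y hy
    have : -swapC n c y x - u x ≤ v y := (lubv y hy).1 ⟨x, hx, rfl⟩
    simp only [swapC] at this; linarith
  have lubu : ∀ x ∈ closure U, IsLUB ((fun y => -c x y - v y) '' closure V) (u x) := by
    intro x hx
    rw [hu x hx]
    refine isLUB_csSup (hVc.image _) ⟨u x, ?_⟩
    rintro _ ⟨y, hy, rfl⟩
    have h2 := ineq x hx y hy
    simp only [← hv]; linarith
  have contu : ContinuousOn u (closure U) := cont_sup hVc lubu (fun ε hε => H.modulus hε)
  have contv : ContinuousOn v (closure V) := cont_sup hUc lubv (fun ε hε => H.swap.modulus hε)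
  refine ⟨contu, contv, ineq, fun x hx => ?_, fun y hy => ?_⟩
  · have hco : ContinuousOn (fun y => -c x y - v y) (closure V) :=
      (H.contOn.comp (f := fun y => (x, y)) (by fun_prop) (fun y hy => ⟨hx, hy⟩)).neg.sub contv
    obtain ⟨y, hy, hmax⟩ := H.compV.exists_isMaxOn hVc hco
    refine ⟨y, hy, ?_⟩
    have : u x ≤ -c x y - v y := (lubu x hx).2 (by
      rintro _ ⟨y', hy', rfl⟩; exact isMaxOn_iff.1 hmax y' hy')
    have := ineq x hx y hy
    linarith
  · have hco : ContinuousOn (fun x => -c x y - u x) (closure U) :=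
      (H.contOn.comp (f := fun x => (x, y)) (by fun_prop) (fun x hx => ⟨hx, hy⟩)).neg.sub contu
    obtain ⟨x, hx, hmax⟩ := H.compU.exists_isMaxOn hUc hco
    refine ⟨x, hx, ?_⟩
    have : v y ≤ -c x y - u x := (lubv y hy).2 (by
      rintro _ ⟨x', hx', rfl⟩; exact isMaxOn_iff.1 hmax x' hx')
    have := ineq x hx y hy
    linarith

theorem Raw.cont_x (H : Raw n c U V) {y : Euc n} (hy : y ∈ closure V) :
    ContinuousOn (fun x => c x y) (closure U) :=
  H.contOn.comp (f := fun x => (x, y)) (by fun_prop) (fun _ hx => ⟨hx, hy⟩)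

theorem Raw.cont_y (H : Raw n c U V) {x : Euc n} (hx : x ∈ closure U) :
    ContinuousOn (fun y => c x y) (closure V) :=
  H.contOn.comp (f := fun y => (x, y)) (by fun_prop) (fun _ hy => ⟨hx, hy⟩)

/-- the contact set -/
def Gam (n : ℕ) (c : Euc n → Euc n → ℝ) (U V : Set (Euc n)) (u v : Euc n → ℝ) : Set (Euc n × Euc n) :=
  {z | z.1 ∈ closure U ∧ z.2 ∈ closure V ∧ u z.1 + v z.2 + c z.1 z.2 = 0}

theorem Pot.gam_compact (H : Raw n c U V) {u v : Euc n → ℝ} (h : Pot n c U V u v) :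
    IsCompact (Gam n c U V u v) := by
  have hco : ContinuousOn (fun z : Euc n × Euc n => u z.1 + v z.2 + c z.1 z.2) (closure U ×ˢ closure V) :=
    ((h.contu.comp continuousOn_fst (fun z hz => hz.1)).add
      (h.contv.comp continuousOn_snd (fun z hz => hz.2))).add H.contOn
  have hcl := hco.preimage_isClosed_of_isClosed (t := {0}) (isClosed_closure.prod isClosed_closure)
    isClosed_singleton
  have : Gam n c U V u v = (closure U ×ˢ closure V) ∩
      ((fun z : Euc n × Euc n => u z.1 + v z.2 + c z.1 z.2) ⁻¹' {0}) := by
    ext z; simp only [Gam, mem_ofPred_eq, mem_inter_iff, mem_prod, mem_preimage, mem_singleton_iff]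
    tauto
  rw [this]
  exact (H.compU.prod H.compV).of_isClosed_subset hcl inter_subset_left

/-- two-point monotonicity -/
theorem Pot.mono {u v : Euc n → ℝ} (h : Pot n c U V u v) {x x' y : Euc n} (hx' : x' ∈ closure U)
    (hxy : (x, y) ∈ Gam n c U V u v) : u x + (-c x' y + c x y) ≤ u x' := by
  have h1 := h.ineq x' hx' y hxy.2.1
  have h2 := hxy.2.2
  simp only at h2
  linarith

/-- volume of Lipschitz images -/
theorem vol_lip {K : ℝ≥0} {f : Euc n → Euc n} {s : Set (Euc n)} (hf : LipschitzOnWith K f s) :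
    volume (f '' s) ≤ (K : ℝ≥0∞) ^ n * volume s := by
  have hd : (n : ℝ) = Module.finrank ℝ (Euc n) := by simp
  have : (Measure.hausdorffMeasure (n : ℝ) : Measure (Euc n)).IsAddHaarMeasure := by
    rw [hd]; infer_instance
  have e := Measure.isAddLeftInvariant_eq_smul (volume : Measure (Euc n)) (Measure.hausdorffMeasure (n : ℝ))
  rw [e]
  simp only [Measure.smul_apply]
  have h := hf.hausdorffMeasure_image_le (d := (n : ℝ)) (by positivity)
  rw [ENNReal.rpow_natCast] at h
  calc _ ≤ _ • ((K : ℝ≥0∞) ^ n * (Measure.hausdorffMeasure (n : ℝ)) s) := by gcongr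
    _ = _ := by rw [mul_smul_comm]

theorem vol_lip' {M : ℝ} (hM : 0 ≤ M) {f : Euc n → Euc n} {s : Set (Euc n)}
    (hf : ∀ x ∈ s, ∀ y ∈ s, ‖f x - f y‖ ≤ M * ‖x - y‖) :
    volume (f '' s) ≤ ENNReal.ofReal (M ^ n) * volume s := by
  have : LipschitzOnWith M.toNNReal f s := LipschitzOnWith.of_dist_le_mul (fun x hx y hy => by
    rw [dist_eq_norm, dist_eq_norm, Real.coe_toNNReal _ hM]; exact hf x hx y hy)
  refine (vol_lip this).trans (le_of_eq ?_)
  rw [ENNReal.ofReal_pow hM]; rfl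

end potentials
end

end Part9

section Part10
open Set MeasureTheory Metric Bornology
open scoped ENNReal NNReal Pointwise InnerProductSpace

noncomputable section
set_option synthInstance.maxSize 2000
set_option synthInstance.maxHeartbeats 200000
set_option maxSynthPendingDepth 10
section boundary
variable {n : ℕ} {c : Euc n → Euc n → ℝ} {U V : Set (Euc n)}

theorem Raw.ndU (H : Raw n c U V) {y : Euc n} (hy : y ∈ V) :
    ∃ m : ℝ, 0 < m ∧ ∀ x ∈ U, ∀ a : Euc n, m * ‖a‖ ≤ ‖fderiv ℝ (qc n c y) x a‖ := by
  obtain ⟨K, hK⟩ := H.lipX hy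
  refine ⟨1 / (K + 1), by positivity, fun x hx a => ?_⟩
  have hq : qc n c y x ∈ Uyset n c U y := Raw.qc_mem x y hx
  have hX : HasFDerivAt (xOf n c U y) (fderiv ℝ (xOf n c U y) (qc n c y x)) (qc n c y x) :=
    ((H.cdX hy hq).differentiableAt (by norm_num)).hasFDerivAt
  have hnh : clUy n c U y ∈ nhds (qc n c y x) := by
    rw [H.clUy_eq hy]
    exact Filter.mem_of_superset ((H.openUy hy).mem_nhds hq) subset_closure
  have hb := norm_fderiv_le_of_lipschitzOn ℝ hnh hK
  have hcomp := HasFDerivAt.comp (f := qc n c y) x hX ((H.cdq hx hy).differentiableAt (by norm_num)).hasFDerivAt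
  have hid : HasFDerivAt (xOf n c U y ∘ qc n c y) (ContinuousLinearMap.id ℝ (Euc n)) x := by
    refine (hasFDerivAt_id x).congr_of_eventuallyEq ?_
    filter_upwards [H.openU.mem_nhds hx] with x' hx'
    exact xOf_left H hy (subset_closure hx')
  have e := hcomp.unique hid
  have e1 : a = fderiv ℝ (xOf n c U y) (qc n c y x) (fderiv ℝ (qc n c y) x a) := by
    have := congrArg (fun L : Euc n →L[ℝ] Euc n => L a) e
    simpa using this.symm
  have h1 : ‖a‖ ≤ K * ‖fderiv ℝ (qc n c y) x a‖ := by
    calc ‖a‖ = ‖fderiv ℝ (xOf n c U y) (qc n c y x) (fderiv ℝ (qc n c y) x a)‖ := by rw [← e1]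
      _ ≤ ‖fderiv ℝ (xOf n c U y) (qc n c y x)‖ * ‖fderiv ℝ (qc n c y) x a‖ :=
        ContinuousLinearMap.le_opNorm _ _
      _ ≤ _ := by gcongr
  rw [one_div, inv_mul_eq_div, div_le_iff₀ (by positivity)]
  nlinarith [norm_nonneg (fderiv ℝ (qc n c y) x a)]

/-- the slope map is close to the identity -/
theorem Raw.slope_approx (H : Raw n c U V) {y0 : Euc n} (hy0 : y0 ∈ V) :
    ∃ M : ℝ, 0 < M ∧ ∀ r, closedBall y0 r ⊆ V → ∀ x ∈ U, ∀ y ∈ closedBall y0 r, ∀ y' ∈ closedBall y0 r,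
    ‖slope' n c x y0 y - slope' n c x y0 y' - (y - y')‖ ≤ M * r * ‖y - y'‖ := by
  obtain ⟨m, hm, hnd⟩ := H.ndU hy0
  obtain ⟨M, hM, hb⟩ := H.bds
  refine ⟨M / m, by positivity, fun r hr x hxU y hy y' hy' => ?_⟩
  have hr0 : 0 ≤ r := dist_nonneg.trans (mem_closedBall.1 hy)
  set η := y - y' with hη
  set P := slope' n c x y0 y - slope' n c x y0 y' with hP
  set a := (H.dqE hxU hy0).symm (P - η) with ha
  have e1 : fderiv ℝ (qc n c y0) x a = P - η := by
    rw [← H.dqE_coe hxU hy0, ha]; simp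
  have h2 : m * ‖a‖ ≤ ‖P - η‖ := by
    have := hnd x hxU a
    rwa [e1] at this
  have hsW : ∀ s ∈ Icc (0:ℝ) 1, y' + s • η ∈ closedBall y0 r := fun s hs => by
    have := (convex_closedBall y0 r).add_smul_sub_mem hy' hy hs; simpa [hη] using this
  have k1 : ∀ s ∈ Icc (0:ℝ) 1, HasDerivAt (fun s => -cD1 n c (x, y' + s • η) (a, 0))
      (-cD2 n c (x, y' + s • η) (0, η) (a, 0)) s := fun s hs => by
    have hd : HasDerivAt (fun s : ℝ => y' + s • η) η s := by
      simpa using ((hasDerivAt_id s).smul_const η).const_add y'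
    have := (H.k1 (x := fun _ => x) (y := fun s : ℝ => y' + s • η) (v := fun _ => (a, 0))
      (hasDerivAt_const s x) hd (hasDerivAt_const s _) ⟨hxU, hr (hsW s hs)⟩).neg
    refine this.congr_deriv ?_
    rw [map_zero, add_zero]
  have b2 : ∀ y1 ∈ closedBall y0 r, |cD2 n c (x, y1) (0, η) (a, 0) - cD2 n c (x, y0) (0, η) (a, 0)|
      ≤ M * r * ‖η‖ * ‖a‖ := by
    intro y1 hy1
    have hin : ∀ s ∈ Icc (0:ℝ) 1, y0 + s • (y1 - y0) ∈ closedBall y0 r := fun s hs =>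
      (convex_closedBall y0 r).add_smul_sub_mem (mem_closedBall_self hr0) hy1 hs
    have k2 : ∀ s ∈ Icc (0:ℝ) 1, HasDerivAt (fun s : ℝ => cD2 n c (x, y0 + s • (y1 - y0)) (0, η) (a, 0))
      (cD3 n c (x, y0 + s • (y1 - y0)) (0, y1 - y0) (0, η) (a, 0)) s := fun s hs => by
      have hd : HasDerivAt (fun s : ℝ => y0 + s • (y1 - y0)) (y1 - y0) s := by
        simpa using ((hasDerivAt_id s).smul_const (y1 - y0)).const_add y0
      have := (H.k2 (x := fun _ => x) (y := fun s : ℝ => y0 + s • (y1 - y0)) (v := fun _ => (0, η))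
        (w := fun _ => (a, 0)) (v' := 0) (w' := 0)
        (hasDerivAt_const s x) hd (hasDerivAt_const s _) (hasDerivAt_const s _)
        ⟨hxU, hr (hin s hs)⟩)
      refine this.congr_deriv ?_
      rw [map_zero, map_zero, zero_apply, add_zero, add_zero]
    have := norm_image_sub_le_of_norm_deriv_le_segment_01'
      (f := fun s : ℝ => cD2 n c (x, y0 + s • (y1 - y0)) (0, η) (a, 0)) (C := M * r * ‖η‖ * ‖a‖)
      (fun t ht => (k2 t ht).hasDerivWithinAt) (fun t ht => by
        have h := (hb (x, y0 + t • (y1 - y0)) ⟨hxU, hr (hin t ⟨ht.1, ht.2.le⟩)⟩).2.2.1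
          (0, y1 - y0) (0, η) (a, 0)
        rw [nrm1, nrm2, nrm2] at h
        rw [Real.norm_eq_abs]
        refine h.trans ?_
        have : ‖y1 - y0‖ ≤ r := by rw [← dist_eq_norm]; exact hy1
        gcongr)
    simp only [one_smul, zero_smul, add_zero, add_sub_cancel] at this
    exact this
  have b1 := norm_image_sub_le_of_norm_deriv_le_segment_01'
      (f := fun s => -cD1 n c (x, y' + s • η) (a, 0) - s * -cD2 n c (x, y0) (0, η) (a, 0))
      (C := M * r * ‖η‖ * ‖a‖)
      (fun t ht => ((k1 t ht).sub ((hasDerivAt_id t).mul_const _)).hasDerivWithinAt) (fun t ht => by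
        rw [one_mul, Real.norm_eq_abs, abs_sub_comm, sub_neg_eq_add, neg_add_eq_sub]
        exact b2 _ (hsW t ⟨ht.1, ht.2.le⟩))
  simp only [zero_smul, one_smul, add_zero, zero_mul, sub_zero, one_mul] at b1
  have ey : y' + η = y := by rw [hη]; abel
  rw [ey] at b1
  have i1 : ⟪P - η, P - η⟫_ℝ = (-cD1 n c (x, y) (a, 0) - -cD2 n c (x, y0) (0, η) (a, 0)) -
      -cD1 n c (x, y') (a, 0) := by
    have j1 : ⟪P, fderiv ℝ (qc n c y0) x a⟫_ℝ = -cD1 n c (x, y) (a, 0) - -cD1 n c (x, y') (a, 0) := by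
      rw [hP, inner_sub_left, H.slope_inner hxU hy0, H.slope_inner hxU hy0, inner_sub_left,
        inner_sub_left, H.swap_inner_q hxU (hr hy),
        H.swap_inner_q hxU hy0, H.swap_inner_q hxU (hr hy')]
      ring
    have j2 : ⟪η, fderiv ℝ (qc n c y0) x a⟫_ℝ = -cD2 n c (x, y0) (0, η) (a, 0) := by
      rw [real_inner_comm, H.inner_dq hxU hy0, H.symm2 ⟨hxU, hy0⟩]
    rw [e1] at j1 j2
    rw [inner_sub_left, j1, j2]; ring
  have i2 : ⟪P - η, P - η⟫_ℝ ≤ M * r * ‖η‖ * ‖a‖ := by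
    rw [i1]; refine (le_abs_self _).trans ?_
    rw [← Real.norm_eq_abs]
    convert b1 using 2
  rw [real_inner_self_eq_norm_sq] at i2
  have i3 : m * ‖P - η‖ * ‖P - η‖ ≤ (M * r * ‖η‖) * ‖P - η‖ := by
    have : 0 ≤ M * r * ‖η‖ := by positivity
    calc m * ‖P - η‖ * ‖P - η‖ = m * ‖P - η‖^2 := by ring
      _ ≤ m * (M * r * ‖η‖ * ‖a‖) := by gcongr
      _ = (M * r * ‖η‖) * (m * ‖a‖) := by ring
      _ ≤ _ := by gcongr
  have e9 : M / m * r * ‖η‖ = M * r * ‖η‖ / m := by ring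
  rw [e9, le_div_iff₀ hm]
  rcases eq_or_lt_of_le (norm_nonneg (P - η)) with h0 | h0
  · rw [← h0]; simp; positivity
  · have := le_of_mul_le_mul_right i3 h0
    linarith

/-- second order estimate up to the boundary -/
theorem Raw.taylor (H : Raw n c U V) {y0 : Euc n} (hy0 : y0 ∈ V) :
    ∃ M : ℝ, 0 < M ∧ ∀ r, closedBall y0 r ⊆ V → ∀ x' ∈ U, ∀ x ∈ closure U, ∀ y ∈ closedBall y0 r,
    |(-c x y + c x y0) - (-c x' y + c x' y0) - ⟪slope' n c x' y0 y, qc n c y0 x - qc n c y0 x'⟫_ℝ| ≤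
      M * ‖y - y0‖ ^ 2 * ‖qc n c y0 x - qc n c y0 x'‖ ^ 2 := by
  obtain ⟨m, hm, hnd⟩ := H.ndU hy0
  obtain ⟨M, hM, hb⟩ := H.bds
  set C := M * ((1 / m) ^ 2 + M * (1 / m) ^ 3) with hC
  refine ⟨C, by positivity, fun r hr x' hx' x hx y hy => ?_⟩
  have hr0 : 0 ≤ r := dist_nonneg.trans (mem_closedBall.1 hy)
  have hyV := hr hy
  set η := y - y0 with hη
  have hsW : ∀ s ∈ Icc (0:ℝ) 1, y0 + s • η ∈ V := fun s hs =>
    hr ((convex_closedBall y0 r).add_smul_sub_mem (mem_closedBall_self hr0) hy hs)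
  have hds : ∀ s, HasDerivAt (fun s : ℝ => y0 + s • η) η s := fun s => by
      simpa using ((hasDerivAt_id s).smul_const η).const_add y0
  set q := qc n c y0 x' with hq
  set v := qc n c y0 x - q with hv
  have hin : ∀ t ∈ Ico (0:ℝ) 1, q + t • v ∈ Uyset n c U y0 := by
    intro t ht
    rcases eq_or_lt_of_le ht.1 with h | h
    · rw [← h]; simpa using Raw.qc_mem x' y0 hx'
    · have h1 := (H.Uy_convex hy0).add_smul_sub_mem_interior' (x := qc n c y0 x) (y := q) (t := 1 - t)
        (by rw [← H.clUy_eq hy0]; exact Raw.qc_mem_cl x y0 hx)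
        (by rw [(H.openUy hy0).interior_eq]; exact Raw.qc_mem x' y0 hx') ⟨by linarith [ht.2], by linarith⟩
      rw [(H.openUy hy0).interior_eq] at h1
      convert h1 using 1
      rw [hv, sub_smul, one_smul, smul_sub, smul_sub]; abel
  set X := segX n c U y0 q v with hX
  set A := segA n c U y0 q v with hA
  set B := segB n c U y0 q v with hB
  have hAn : ∀ t ∈ Ico (0:ℝ) 1, ‖A t‖ ≤ 1 / m * ‖v‖ := fun t ht => by
    have h1 := hnd _ (H.seg_mem hy0 (hin t ht)).1 (A t)
    rw [hA, H.seg_dq hy0 (hin t ht)] at h1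
    rw [one_div, inv_mul_eq_div, le_div_iff₀ hm, mul_comm]; exact h1
  have hBn : ∀ t ∈ Ico (0:ℝ) 1, ‖B t‖ ≤ M * (1 / m) ^ 3 * ‖v‖ ^ 2 := fun t ht => by
    have hxU := (H.seg_mem hy0 (hin t ht)).1
    have h1 := H.nd_le hxU hy0 (T := M * ‖A t‖ ^ 2) (by positivity) (hnd _ hxU (B t)) (fun ξ => by
      have e := H.seg_eq2 hy0 (hin t ht) ξ
      have e' : cD2 n c (segX n c U y0 q v t, y0) (B t, 0) (0, ξ) =
        -cD3 n c (segX n c U y0 q v t, y0) (A t, 0) (A t, 0) (0, ξ) := by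
        rw [hA, hB]; linarith
      rw [e', abs_neg]
      have h := (hb (segX n c U y0 q v t, y0) ⟨hxU, hy0⟩).2.2.1 (A t, 0) (A t, 0) (0, ξ)
      rw [nrm1, nrm2] at h
      refine h.trans (le_of_eq (by ring)))
    have h2 : m * ‖B t‖ ≤ M * (1 / m * ‖v‖) ^ 2 := by
      refine h1.trans ?_
      have := hAn t ht
      gcongr
    have h3 : ‖B t‖ ≤ M * (1 / m * ‖v‖) ^ 2 / m := by rw [le_div_iff₀ hm]; linarith
    refine h3.trans (le_of_eq ?_)
    field_simp
  set G : ℝ → ℝ := fun t => -c (X t) y + c (X t) y0 with hG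
  set G1 : ℝ → ℝ := fun t => -cD1 n c (X t, y) (A t, 0) + cD1 n c (X t, y0) (A t, 0) with hG1
  set G2 : ℝ → ℝ := fun t => -(cD2 n c (X t, y) (A t, 0) (A t, 0) + cD1 n c (X t, y) (B t, 0)) +
          (cD2 n c (X t, y0) (A t, 0) (A t, 0) + cD1 n c (X t, y0) (B t, 0)) with hG2
  have d0 : ∀ t ∈ Ico (0:ℝ) 1, HasDerivAt G (G1 t) t := fun t ht => by
    have ha := H.seg_a hy0 (hin t ht)
    have hmU := (H.seg_mem hy0 (hin t ht)).1
    have r1 := H.k0 (y := fun _ => y) ha (hasDerivAt_const t y) ⟨hmU, hyV⟩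
    have r2 := H.k0 (y := fun _ => y0) ha (hasDerivAt_const t y0) ⟨hmU, hy0⟩
    exact r1.neg.add r2
  have d1 : ∀ t ∈ Ico (0:ℝ) 1, HasDerivAt G1 (G2 t) t := fun t ht => by
    have ha := H.seg_a hy0 (hin t ht)
    have hbb := H.seg_b hy0 (hin t ht)
    have hmU := (H.seg_mem hy0 (hin t ht)).1
    have r1 := H.k1 (y := fun _ => y) (v := fun t => (A t, (0 : Euc n))) ha (hasDerivAt_const t y)
      (hbb.prodMk (hasDerivAt_const _ _)) ⟨hmU, hyV⟩
    have r2 := H.k1 (y := fun _ => y0) (v := fun t => (A t, (0 : Euc n))) ha (hasDerivAt_const t y0)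
      (hbb.prodMk (hasDerivAt_const _ _)) ⟨hmU, hy0⟩
    exact r1.neg.add r2
  have d2 : ∀ t ∈ Ico (0:ℝ) 1, ‖G2 t‖ ≤ C * ‖η‖ ^ 2 * ‖v‖ ^ 2 := by
    intro t ht
    have hxU := (H.seg_mem hy0 (hin t ht)).1
    have an := hAn t ht
    have bn := hBn t ht
    have eq2 := H.seg_eq2 hy0 (hin t ht) η
    rw [← hX, ← hA, ← hB] at eq2
    rw [← hX] at hxU
    simp only [hG2]
    set x1 := X t
    set a := A t
    set b := B t
    set D := M * ‖η‖ ^ 2 * (‖a‖ ^ 2 + ‖b‖) with hD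
    have l1 : ∀ s ∈ Icc (0:ℝ) 1, HasDerivAt (fun s : ℝ => cD2 n c (x1, y0 + s • η) (a, 0) (a, 0) +
        cD1 n c (x1, y0 + s • η) (b, 0)) (cD3 n c (x1, y0 + s • η) (0, η) (a, 0) (a, 0) +
        cD2 n c (x1, y0 + s • η) (0, η) (b, 0)) s := fun s hs => by
      have z1 := H.k2 (x := fun _ => x1) (y := fun s : ℝ => y0 + s • η) (v := fun _ => (a, 0))
        (w := fun _ => (a, 0)) (v' := 0) (w' := 0)
        (hasDerivAt_const s x1) (hds s) (hasDerivAt_const s _) (hasDerivAt_const s _) ⟨hxU, hsW s hs⟩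
      have z2 := H.k1 (x := fun _ => x1) (y := fun s : ℝ => y0 + s • η) (v := fun _ => (b, 0)) (v' := 0)
        (hasDerivAt_const s x1) (hds s) (hasDerivAt_const s _) ⟨hxU, hsW s hs⟩
      refine (z1.add z2).congr_deriv ?_
      rw [map_zero, map_zero, map_zero, zero_apply, add_zero, add_zero, add_zero]
    have l2 : ∀ s ∈ Icc (0:ℝ) 1, HasDerivAt (fun s : ℝ => cD3 n c (x1, y0 + s • η) (0, η) (a, 0) (a, 0) +
        cD2 n c (x1, y0 + s • η) (0, η) (b, 0)) (cD4 n c (x1, y0 + s • η) (0, η) (0, η) (a, 0) (a, 0) +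
        cD3 n c (x1, y0 + s • η) (0, η) (0, η) (b, 0)) s := fun s hs => by
      have z1 := H.k3 (x := fun _ => x1) (y := fun s : ℝ => y0 + s • η) (v := fun _ => (0, η))
        (w := fun _ => (a, 0)) (u := fun _ => (a, 0)) (v' := 0) (w' := 0) (u' := 0)
        (hasDerivAt_const s x1) (hds s) (hasDerivAt_const s _) (hasDerivAt_const s _)
        (hasDerivAt_const s _) ⟨hxU, hsW s hs⟩
      have z2 := H.k2 (x := fun _ => x1) (y := fun s : ℝ => y0 + s • η) (v := fun _ => (0, η))
        (w := fun _ => (b, 0)) (v' := 0) (w' := 0)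
        (hasDerivAt_const s x1) (hds s) (hasDerivAt_const s _) (hasDerivAt_const s _) ⟨hxU, hsW s hs⟩
      refine (z1.add z2).congr_deriv ?_
      simp only [map_zero, zero_apply, add_zero]
    have l3 : cD3 n c (x1, y0 + (0:ℝ) • η) (0, η) (a, 0) (a, 0) +
        cD2 n c (x1, y0 + (0:ℝ) • η) (0, η) (b, 0) = 0 := by
      rw [zero_smul, add_zero, H.symm3 ⟨hxU, hy0⟩ (0, η) (a, 0), H.symm3' ⟨hxU, hy0⟩ _ (0, η) (a, 0),
        H.symm2 ⟨hxU, hy0⟩ (0, η) (b, 0)]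
      exact eq2
    have l4 : ∀ s ∈ Icc (0:ℝ) 1, ‖cD3 n c (x1, y0 + s • η) (0, η) (a, 0) (a, 0) +
        cD2 n c (x1, y0 + s • η) (0, η) (b, 0)‖ ≤ D := by
      intro s hs
      have := norm_image_sub_le_of_norm_deriv_le_segment' (C := D)
        (fun t ht => (l2 t ht).hasDerivWithinAt) (fun t ht => by
          have hbt := hb (x1, y0 + t • η) ⟨hxU, hsW t ⟨ht.1, ht.2.le⟩⟩
          have h4 := hbt.2.2.2 (0, η) (0, η) (a, 0) (a, 0)
          have h3 := hbt.2.2.1 (0, η) (0, η) (b, 0)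
          rw [nrm1, nrm2] at h4 h3
          rw [Real.norm_eq_abs]
          refine (abs_add_le _ _).trans ((add_le_add h4 h3).trans (le_of_eq ?_))
          rw [hD]; ring) s hs
      rw [l3, sub_zero] at this
      refine this.trans ?_
      have : 0 ≤ D := by positivity
      nlinarith [hs.1, hs.2]
    have l5 := norm_image_sub_le_of_norm_deriv_le_segment_01' (C := D)
        (fun t ht => (l1 t ht).hasDerivWithinAt) (fun t ht => l4 t ⟨ht.1, ht.2.le⟩)
    simp only [one_smul, zero_smul, add_zero] at l5
    have ey : y0 + η = y := by rw [hη]; abel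
    rw [ey] at l5
    rw [neg_add_eq_sub, norm_sub_rev]
    refine l5.trans ?_
    rw [hD, hC]
    have : ‖a‖ ^ 2 + ‖b‖ ≤ (1 / m * ‖v‖) ^ 2 + M * (1 / m) ^ 3 * ‖v‖ ^ 2 := by gcongr
    calc M * ‖η‖ ^ 2 * (‖a‖ ^ 2 + ‖b‖) ≤ M * ‖η‖ ^ 2 * ((1 / m * ‖v‖) ^ 2 + M * (1 / m) ^ 3 * ‖v‖ ^ 2) := by
          gcongr
      _ = _ := by ring
  set D := C * ‖η‖ ^ 2 * ‖v‖ ^ 2 with hD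
  have hD0 : 0 ≤ D := by positivity
  have d3 : ∀ t ∈ Ico (0:ℝ) 1, ‖G1 t - G1 0‖ ≤ D := fun t ht => by
    have := norm_image_sub_le_of_norm_deriv_le_segment' (f := G1) (a := 0) (b := t) (C := D)
      (fun s hs => (d1 s ⟨hs.1, hs.2.trans_lt ht.2⟩).hasDerivWithinAt)
      (fun s hs => d2 s ⟨hs.1, hs.2.trans ht.2⟩) t ⟨ht.1, le_rfl⟩
    refine this.trans ?_
    nlinarith [ht.1, ht.2]
  have hinc : ∀ t ∈ Icc (0:ℝ) 1, q + t • v ∈ clUy n c U y0 := fun t ht =>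
    (H.clUy_convex hy0).add_smul_sub_mem (Raw.qc_mem_cl x' y0 (subset_closure hx'))
      (Raw.qc_mem_cl x y0 hx) ht
  have hXc : ContinuousOn X (Icc 0 1) := by
    obtain ⟨K, hK⟩ := H.lipX hy0
    exact hK.continuousOn.comp (f := fun t : ℝ => q + t • v) (by fun_prop) hinc
  have hXm : ∀ t ∈ Icc (0:ℝ) 1, X t ∈ closure U := fun t ht => (xOf_mem (hinc t ht)).1
  have hGc : ContinuousOn G (Icc 0 1) :=
    ((H.cont_x (subset_closure hyV)).comp hXc hXm).neg.add
      ((H.cont_x (subset_closure hy0)).comp hXc hXm)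
  have fin := norm_image_sub_le_of_norm_deriv_right_le_segment (f := fun t => G t - t * G1 0) (a := 0)
    (b := 1) (C := D)
    (f' := fun t => G1 t - 1 * G1 0)
    (hGc.sub (by fun_prop))
    (fun t ht => ((d0 t ht).sub ((hasDerivAt_id t).mul_const _)).hasDerivWithinAt)
    (fun t ht => by rw [one_mul]; exact d3 t ht) 1 ⟨zero_le_one, le_rfl⟩
  have e0 : X 0 = x' := by
    simp only [hX, segX, zero_smul, add_zero]; exact xOf_left H hy0 (subset_closure hx')
  have e1 : X 1 = x := by
    simp only [hX, segX, one_smul, hv, add_sub_cancel]; exact xOf_left H hy0 hx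
  have e2 : G1 0 = ⟪slope' n c x' y0 y, v⟫_ℝ := by
    have s1 := H.slope_deriv hy0 (subset_closure hyV) (hin 0 ⟨le_rfl, zero_lt_one⟩)
    have s2 := (d0 0 ⟨le_rfl, zero_lt_one⟩).unique s1
    rw [← hX, e0] at s2
    exact s2
  simp only [hG, e0, e1, e2, one_mul, zero_mul, sub_zero, mul_one] at fin
  rw [Real.norm_eq_abs] at fin
  convert fin using 2
  ring

end boundary
end

end Part10

section Part11
open Set MeasureTheory Metric Bornology
open scoped ENNReal NNReal Pointwise InnerProductSpace

noncomputable section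
section boundary
variable {n : ℕ} {c : Euc n → Euc n → ℝ} {U V : Set (Euc n)}

/-- Stretch by `s` in the direction `ν`. -/
def stretch (n : ℕ) (ν : Euc n) (s : ℝ) : Euc n →ₗ[ℝ] Euc n :=
  LinearMap.transvection ((s - 1) • (innerₗ (Euc n) ν)) ν

theorem stretch_apply (ν : Euc n) (s : ℝ) (x : Euc n) :
    stretch n ν s x = x + ((s - 1) * ⟪ν, x⟫_ℝ) • ν := by
  simp [stretch, LinearMap.transvection.apply]

theorem stretch_det {ν : Euc n} (hν : ‖ν‖ = 1) (s : ℝ) : LinearMap.det (stretch n ν s) = s := by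
  have : ⟪ν, ν⟫_ℝ = 1 := by rw [real_inner_self_eq_norm_sq, hν]; norm_num
  rw [stretch, LinearMap.transvection.det]
  simp [hν]

theorem stretch_vol {ν : Euc n} (hν : ‖ν‖ = 1) {s θ : ℝ} (hs : 0 ≤ s) (hθ : 0 ≤ θ) (S : Set (Euc n)) :
    volume (θ • (stretch n ν s '' S)) = ENNReal.ofReal (θ ^ n * s) * volume S := by
  rw [Measure.addHaar_smul_of_nonneg _ hθ, Measure.addHaar_image_linearMap, stretch_det hν, abs_of_nonneg hs,
    ENNReal.ofReal_mul (by positivity), mul_assoc]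
  simp

theorem geo {ν : Euc n} (hν : ‖ν‖ = 1) {a C1 C2 ε : ℝ} (ha : 0 < a) (hC1 : 0 < C1) (hC2 : 0 < C2)
    (hε : 0 < ε) : ∃ θ : ℝ, 0 < θ ∧ θ ≤ 1 ∧
    0 < volume {p : Euc n | a / 2 ≤ ⟪ν, p⟫_ℝ ∧ ⟪ν, p⟫_ℝ ≤ a ∧ ‖p - ⟪ν, p⟫_ℝ • ν‖ ≤ θ * a / 2} ∧
    volume {p : Euc n | ‖p‖ ≤ C1 * θ ∧ |⟪ν, p⟫_ℝ| ≤ C2 * θ ^ 2} ≤ ENNReal.ofReal ε *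
    volume {p : Euc n | a / 2 ≤ ⟪ν, p⟫_ℝ ∧ ⟪ν, p⟫_ℝ ≤ a ∧ ‖p - ⟪ν, p⟫_ℝ • ν‖ ≤ θ * a / 2} := by
  have hνν : ⟪ν, ν⟫_ℝ = 1 := by rw [real_inner_self_eq_norm_sq, hν]; norm_num
  set S1 : Set (Euc n) := closedBall ((3 * a / 4) • ν) (a / 4) with hS1
  set S2 : Set (Euc n) := closedBall 0 (C1 * 2 + C2) with hS2
  have hv1 : 0 < volume S1 := measure_closedBall_pos _ _ (by positivity)
  have hv1' : volume S1 < ⊤ := measure_closedBall_lt_top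
  have hv2' : volume S2 < ⊤ := measure_closedBall_lt_top
  set k1 := (volume S1).toReal
  set k2 := (volume S2).toReal
  have hk1 : 0 < k1 := ENNReal.toReal_pos hv1.ne' hv1'.ne
  have hk2 : 0 ≤ k2 := ENNReal.toReal_nonneg
  have e1 : volume S1 = ENNReal.ofReal k1 := (ENNReal.ofReal_toReal hv1'.ne).symm
  have e2 : volume S2 = ENNReal.ofReal k2 := (ENNReal.ofReal_toReal hv2'.ne).symm
  set θ := min 1 (ε * k1 / (k2 + 1)) with hθd
  have hθ : 0 < θ := by positivity
  have hθ1 : θ ≤ 1 := min_le_left _ _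
  have hθ2 : θ * k2 ≤ ε * k1 := by
    have : θ ≤ ε * k1 / (k2 + 1) := min_le_right _ _
    rw [le_div_iff₀ (by positivity)] at this
    nlinarith
  have hC : θ • (stretch n ν θ⁻¹ '' S1) ⊆
      {p : Euc n | a / 2 ≤ ⟪ν, p⟫_ℝ ∧ ⟪ν, p⟫_ℝ ≤ a ∧ ‖p - ⟪ν, p⟫_ℝ • ν‖ ≤ θ * a / 2} := by
    rintro _ ⟨_, ⟨w, hw, rfl⟩, rfl⟩
    rw [hS1, mem_closedBall, dist_eq_norm] at hw
    set d := w - (3 * a / 4) • ν with hd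
    have hwd : w = (3 * a / 4) • ν + d := by rw [hd]; abel
    have hi : |⟪ν, d⟫_ℝ| ≤ a / 4 := (abs_real_inner_le_norm _ _).trans (by rw [hν]; linarith)
    have hin : ⟪ν, θ • stretch n ν θ⁻¹ w⟫_ℝ = 3 * a / 4 + ⟪ν, d⟫_ℝ := by
      rw [stretch_apply, hwd, inner_smul_right, inner_add_right, inner_smul_right, inner_add_right,
        inner_smul_right, hνν]
      field_simp; ring
    have hd2 : ‖d - ⟪ν, d⟫_ℝ • ν‖ ≤ a / 2 := by
      calc _ ≤ ‖d‖ + ‖⟪ν, d⟫_ℝ • ν‖ := norm_sub_le _ _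
        _ ≤ a / 4 + a / 4 := by
          rw [norm_smul, hν, mul_one]; exact add_le_add hw hi
        _ = a / 2 := by ring
    have hp : θ • stretch n ν θ⁻¹ w - (3 * a / 4 + ⟪ν, d⟫_ℝ) • ν = θ • (d - ⟪ν, d⟫_ℝ • ν) := by
      rw [stretch_apply, hwd, inner_add_right, inner_smul_right, hνν]
      match_scalars <;> field_simp <;> ring
    refine ⟨?_, ?_, ?_⟩
    · show a / 2 ≤ ⟪ν, θ • stretch n ν θ⁻¹ w⟫_ℝ
      rw [hin]; linarith [abs_le.1 hi]
    · show ⟪ν, θ • stretch n ν θ⁻¹ w⟫_ℝ ≤ a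
      rw [hin]; linarith [abs_le.1 hi]
    · show ‖θ • stretch n ν θ⁻¹ w - ⟪ν, θ • stretch n ν θ⁻¹ w⟫_ℝ • ν‖ ≤ _
      rw [hin, hp, norm_smul, Real.norm_of_nonneg hθ.le]
      nlinarith
  have hD : {p : Euc n | ‖p‖ ≤ C1 * θ ∧ |⟪ν, p⟫_ℝ| ≤ C2 * θ ^ 2} ⊆ θ • (stretch n ν θ '' S2) := by
    rintro p ⟨h1, h2⟩
    refine ⟨_, ⟨θ⁻¹ • (p - ⟪ν, p⟫_ℝ • ν) + (⟪ν, p⟫_ℝ / θ ^ 2) • ν, ?_, rfl⟩, ?_⟩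
    · rw [hS2, mem_closedBall, dist_zero_right]
      have h3 : ‖p - ⟪ν, p⟫_ℝ • ν‖ ≤ (C1 * 2) * θ := by
        calc _ ≤ ‖p‖ + ‖⟪ν, p⟫_ℝ • ν‖ := norm_sub_le _ _
          _ ≤ C1 * θ + C1 * θ := by
            rw [norm_smul, hν, mul_one]
            refine add_le_add h1 ((abs_real_inner_le_norm _ _).trans (by rw [hν]; linarith))
          _ = _ := by ring
      calc _ ≤ ‖θ⁻¹ • (p - ⟪ν, p⟫_ℝ • ν)‖ + ‖(⟪ν, p⟫_ℝ / θ ^ 2) • ν‖ := norm_add_le _ _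
        _ ≤ C1 * 2 + C2 := by
          rw [norm_smul, norm_smul, hν, mul_one]
          refine add_le_add ?_ ?_
          · rw [norm_inv, Real.norm_of_nonneg hθ.le, inv_mul_le_iff₀ hθ]; linarith
          · rw [Real.norm_eq_abs, abs_div, abs_of_pos (by positivity : (0:ℝ) < θ ^ 2),
              div_le_iff₀ (by positivity)]; exact h2
    · have : ⟪ν, θ⁻¹ • (p - ⟪ν, p⟫_ℝ • ν) + (⟪ν, p⟫_ℝ / θ ^ 2) • ν⟫_ℝ = ⟪ν, p⟫_ℝ / θ ^ 2 := by
        rw [inner_add_right, inner_smul_right, inner_sub_right, inner_smul_right, inner_smul_right, hνν]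
        ring
      show θ • stretch n ν θ _ = p
      rw [stretch_apply, this]
      match_scalars <;> field_simp <;> ring
  have hCv := measure_mono (μ := volume) hC
  have hDv := measure_mono (μ := volume) hD
  rw [stretch_vol hν (by positivity) hθ.le, e1, ← ENNReal.ofReal_mul (by positivity)] at hCv
  rw [stretch_vol hν (by positivity) hθ.le, e2, ← ENNReal.ofReal_mul (by positivity)] at hDv
  refine ⟨θ, hθ, hθ1, ?_, ?_⟩
  · refine lt_of_lt_of_le ?_ hCv
    rw [ENNReal.ofReal_pos]; positivity
  · refine hDv.trans (le_trans ?_ (mul_le_mul_right hCv _))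
    rw [← ENNReal.ofReal_mul hε.le]
    refine ENNReal.ofReal_le_ofReal ?_
    have h4 : θ * (θ * k2) ≤ 1 * (ε * k1) := mul_le_mul hθ1 hθ2 (by positivity) (by norm_num)
    have h5 : θ ^ n * θ * k2 = θ ^ n * θ⁻¹ * (θ * (θ * k2)) := by field_simp
    rw [h5]
    calc _ ≤ θ ^ n * θ⁻¹ * (1 * (ε * k1)) := by gcongr
      _ = _ := by ring

/-- A map close to the identity on a ball covers the ball of half the radius. -/
theorem surj_half {f : Euc n → Euc n} {y0 : Euc n} {r : ℝ} (hr : 0 ≤ r) (h0 : f y0 = 0)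
    (hf : ∀ y ∈ closedBall y0 r, ∀ y' ∈ closedBall y0 r, ‖f y - f y' - (y - y')‖ ≤ 1 / 2 * ‖y - y'‖) :
    ∀ p, ‖p‖ ≤ r / 2 → ∃ y ∈ closedBall y0 r, f y = p := by
  intro p hp
  have ha : ApproximatesLinearOn f (ContinuousLinearMap.id ℝ (Euc n)) (closedBall y0 r) (1 / 2) := by
    intro y hy y' hy'
    have := hf y hy y' hy'
    simpa using this
  let g : (ContinuousLinearMap.id ℝ (Euc n)).NonlinearRightInverse :=
    { toFun := id, nnnorm := 1, bound' := by intro y; simp, right_inv' := by intro y; simp }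
  have := ha.surjOn_closedBall_of_nonlinearRightInverse g hr Subset.rfl
  obtain ⟨y, hy, he⟩ := this (show p ∈ closedBall (f y0) _ by
    rw [h0, mem_closedBall, dist_zero_right]
    refine hp.trans (le_of_eq ?_)
    simp [g]; ring)
  exact ⟨y, hy, he⟩

end boundary
end

end Part11

section Part12
open Set MeasureTheory Metric Bornology
open scoped ENNReal NNReal Pointwise InnerProductSpace

noncomputable section
section boundary2
variable {n : ℕ} {c : Euc n → Euc n → ℝ} {U V : Set (Euc n)}

theorem Raw.ext_ball (H : Raw n c U V) {x0 y0 : Euc n} (hx0 : x0 ∈ closure U) (hx0U : x0 ∉ U)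
    (hy0 : y0 ∈ V) : ∃ R : ℝ, ∃ ν : Euc n, 0 < R ∧ ‖ν‖ = 1 ∧ ∀ x ∈ closure U,
      ‖qc n c y0 x - qc n c y0 x0‖ ^ 2 + 2 * R * ⟪ν, qc n c y0 x - qc n c y0 x0⟫_ℝ ≤ 0 := by
  obtain ⟨-, R, hR, hb⟩ := H.b2s.1 y0 (subset_closure hy0)
  obtain ⟨z, hz, hsub⟩ := hb _ (H.frontier_q hy0 hx0 hx0U)
  refine ⟨R, R⁻¹ • (qc n c y0 x0 - z), hR, ?_, ?_⟩
  · rw [norm_smul, ← dist_eq_norm, hz, norm_inv, Real.norm_of_nonneg hR.le, inv_mul_cancel₀ hR.ne']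
  · intro x hx
    have h1 : qc n c y0 x ∈ closedBall z R := by
      have := Raw.qc_mem_cl (c := c) x y0 hx
      rw [H.clUy_eq hy0] at this
      exact closure_minimal hsub isClosed_closedBall this
    rw [mem_closedBall, dist_eq_norm] at h1
    rw [dist_eq_norm] at hz
    have h2 : qc n c y0 x - z = (qc n c y0 x - qc n c y0 x0) + (qc n c y0 x0 - z) := by abel
    have h3 : ‖qc n c y0 x - z‖ ^ 2 ≤ R ^ 2 := by gcongr
    rw [h2, norm_add_sq_real, hz] at h3
    rw [inner_smul_left, real_inner_comm]
    simp only [conj_trivial]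
    have : 2 * R * (R⁻¹ * ⟪qc n c y0 x - qc n c y0 x0, qc n c y0 x0 - z⟫_ℝ) =
      2 * ⟪qc n c y0 x - qc n c y0 x0, qc n c y0 x0 - z⟫_ℝ := by field_simp
    rw [this]; linarith

theorem bd_alg {R θ D s a b N M : ℝ} (hR : 0 < R) (hθ : 0 < θ) (hD : 0 ≤ D) (hs : 0 < s) (hsa : s ≤ a)
    (hM : 0 < M) (ha : 128 * M * a * R ≤ 1) (hN : N ≤ 16 * M * s ^ 2)
    (hb : D ^ 2 + 2 * R * b ≤ 0) (h : 0 ≤ s * b + θ * s * D + N * (2 * D ^ 2 + 3 * θ ^ 2)) :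
    D ≤ (4 * R + 2) * θ ∧ |b| ≤ ((4 * R + 2) + (4 * R + 2) ^ 2 / (4 * R) + 1 / (2 * R)) * θ ^ 2 := by
  have hk : 16 * M * s ≤ 1 / (8 * R) := by
    rw [le_div_iff₀ (by positivity)]
    have : M * s * R ≤ M * a * R := by gcongr
    nlinarith
  have h1 : N * (2 * D ^ 2 + 3 * θ ^ 2) ≤ s * (1 / (8 * R)) * (2 * D ^ 2 + 3 * θ ^ 2) := by
    refine mul_le_mul_of_nonneg_right (hN.trans ?_) (by positivity)
    nlinarith
  have h2 : 0 ≤ b + θ * D + 1 / (8 * R) * (2 * D ^ 2 + 3 * θ ^ 2) := by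
    by_contra hc
    push Not at hc
    have := mul_neg_of_pos_of_neg hs hc
    nlinarith
  have h3 : 1 / (8 * R) * (2 * D ^ 2 + 3 * θ ^ 2) ≤ 1 / (4 * R) * D ^ 2 + 1 / (2 * R) * θ ^ 2 := by
    have : 1 / (4 * R) * D ^ 2 + 1 / (2 * R) * θ ^ 2 - 1 / (8 * R) * (2 * D ^ 2 + 3 * θ ^ 2) = θ ^ 2 / (8 * R) := by
      field_simp; ring
    have h5 : 0 ≤ θ ^ 2 / (8 * R) := by positivity
    linarith
  have hb0 : b ≤ 0 := by nlinarith [sq_nonneg D]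
  have h4 : D ^ 2 ≤ 4 * R * θ * D + 2 * θ ^ 2 := by
    have e1 : 4 * R * (1 / (4 * R) * D ^ 2 + 1 / (2 * R) * θ ^ 2) = D ^ 2 + 2 * θ ^ 2 := by field_simp; ring
    have := mul_nonneg (by positivity : 0 ≤ 4 * R) (h2.trans (by linarith : _ ≤ b + θ * D + (1 / (4 * R) * D ^ 2 + 1 / (2 * R) * θ ^ 2)))
    rw [mul_add, e1] at this
    nlinarith
  have h5 : D ≤ (4 * R + 2) * θ := by
    by_contra hc
    push Not at hc
    nlinarith [mul_pos hR hθ, mul_pos hθ hθ]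
  refine ⟨h5, ?_⟩
  rw [abs_of_nonpos hb0]
  have h6 : D ^ 2 ≤ ((4 * R + 2) * θ) ^ 2 := by gcongr
  have h7 : 1 / (4 * R) * D ^ 2 ≤ 1 / (4 * R) * ((4 * R + 2) * θ) ^ 2 := by gcongr
  have h8 : θ * D ≤ θ * ((4 * R + 2) * θ) := by gcongr
  have : ((4 * R + 2) + (4 * R + 2) ^ 2 / (4 * R) + 1 / (2 * R)) * θ ^ 2 =
    θ * ((4 * R + 2) * θ) + 1 / (4 * R) * ((4 * R + 2) * θ) ^ 2 + 1 / (2 * R) * θ ^ 2 := by ring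
  rw [this]; linarith

set_option maxHeartbeats 1000000 in
theorem Raw.boundary (H : Raw n c U V) {u v : Euc n → ℝ} (h : Pot n c U V u v) {x0 y0 : Euc n}
    (hx0 : x0 ∈ closure U) (hx0U : x0 ∉ U) (hy0 : y0 ∈ V) (hg : (x0, y0) ∈ Gam n c U V u v)
    {ε r : ℝ} (hε : 0 < ε) (hr : 0 < r) : ∃ E X : Set (Euc n), IsCompact E ∧ E ⊆ closedBall y0 r ∧
    E ⊆ V ∧ IsCompact X ∧ X ⊆ closure U ∧ 0 < volume E ∧ volume X ≤ ENNReal.ofReal ε * volume E ∧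
    ∀ x y, y ∈ E → (x, y) ∈ Gam n c U V u v → x ∈ X := by
  obtain ⟨R, ν, hR, hν, hball⟩ := H.ext_ball hx0 hx0U hy0
  obtain ⟨M1, hM1, hsl⟩ := H.slope_approx hy0
  obtain ⟨M2, hM2, hta⟩ := H.taylor hy0
  obtain ⟨K, hK⟩ := H.lipX hy0
  obtain ⟨r0, hr0, hr0V⟩ := Metric.isOpen_iff.1 H.openV y0 hy0
  set r1 := min (min r (r0 / 2)) (1 / (2 * M1)) with hr1d
  have hr1 : 0 < r1 := by positivity
  have hr1r : r1 ≤ r := (min_le_left _ _).trans (min_le_left _ _)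
  have hr1V : closedBall y0 r1 ⊆ V := by
    refine (closedBall_subset_ball ?_).trans hr0V
    have : r1 ≤ r0 / 2 := (min_le_left _ _).trans (min_le_right _ _)
    linarith
  have hM1r : M1 * r1 ≤ 1 / 2 := by
    have : r1 ≤ 1 / (2 * M1) := min_le_right _ _
    rw [le_div_iff₀ (by positivity)] at this
    linarith
  set a := min (r1 / 4) (1 / (128 * M2 * R)) with had
  have ha : 0 < a := by positivity
  have har : 2 * a ≤ r1 / 2 := by linarith [min_le_left (r1 / 4) (1 / (128 * M2 * R))]
  have haM : 128 * M2 * a * R ≤ 1 := by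
    have : a ≤ 1 / (128 * M2 * R) := min_le_right _ _
    rw [le_div_iff₀ (by positivity)] at this
    linarith
  set C1 := 4 * R + 2 with hC1
  set C2 := (4 * R + 2) + (4 * R + 2) ^ 2 / (4 * R) + 1 / (2 * R) with hC2
  set L : ℝ := (K : ℝ) ^ n * 2 ^ n + 1 with hL
  have hLp : 0 < L := by positivity
  obtain ⟨θ, hθ, hθ1, hCp, hvol⟩ := geo hν ha (by positivity : 0 < C1) (by positivity : 0 < C2)
    (by positivity : 0 < ε / L)
  set Cs : Set (Euc n) := {p : Euc n | a / 2 ≤ ⟪ν, p⟫_ℝ ∧ ⟪ν, p⟫_ℝ ≤ a ∧ ‖p - ⟪ν, p⟫_ℝ • ν‖ ≤ θ * a / 2}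
    with hCs
  set Ds : Set (Euc n) := {p : Euc n | ‖p‖ ≤ C1 * θ ∧ |⟪ν, p⟫_ℝ| ≤ C2 * θ ^ 2} with hDs
  have hCscl : IsClosed Cs := by
    simp only [hCs, ofPred_and]
    refine IsClosed.inter ?_ (IsClosed.inter ?_ ?_)
    · exact isClosed_le (by fun_prop) (by fun_prop)
    · exact isClosed_le (by fun_prop) (by fun_prop)
    · exact isClosed_le (by fun_prop) (by fun_prop)
  have hDscl : IsClosed Ds := by
    simp only [hDs, ofPred_and]
    refine IsClosed.inter ?_ ?_
    · exact isClosed_le (by fun_prop) (by fun_prop)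
    · exact isClosed_le (by fun_prop) (by fun_prop)
  -- interior point
  obtain ⟨x', hx', hx'q⟩ : ∃ x' ∈ U, ‖qc n c y0 x0 - qc n c y0 x'‖ ≤ θ := by
    have h1 : qc n c y0 x0 ∈ closure (Uyset n c U y0) := by
      rw [← H.clUy_eq hy0]; exact Raw.qc_mem_cl x0 y0 hx0
    obtain ⟨_, ⟨x', hx', rfl⟩, hd⟩ := Metric.mem_closure_iff.1 h1 θ hθ
    exact ⟨x', hx', by rw [dist_eq_norm] at hd; exact hd.le⟩
  set π : Euc n → Euc n := fun y => slope' n c x' y0 y with hπ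
  have hπ0 : π y0 = 0 := slope_self _ _
  have hap : ∀ y ∈ closedBall y0 r1, ∀ y' ∈ closedBall y0 r1, ‖π y - π y' - (y - y')‖ ≤ 1 / 2 * ‖y - y'‖ :=
    fun y hy y' hy' => (hsl r1 hr1V x' hx' y hy y' hy').trans (by gcongr)
  have hy0m : y0 ∈ closedBall y0 r1 := mem_closedBall_self hr1.le
  have hlip : ∀ y ∈ closedBall y0 r1, ∀ y' ∈ closedBall y0 r1, ‖π y - π y'‖ ≤ 2 * ‖y - y'‖ := by
    intro y hy y' hy'
    have h1 := hap y hy y' hy'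
    have h2 := norm_sub_norm_le (π y - π y') (y - y')
    linarith [norm_nonneg (y - y')]
  have hinv : ∀ y ∈ closedBall y0 r1, ‖y - y0‖ ≤ 2 * ‖π y‖ := by
    intro y hy
    have h1 := hap y hy y0 hy0m
    rw [hπ0, sub_zero] at h1
    have h2 := norm_sub_norm_le (y - y0) (π y)
    rw [norm_sub_rev (y - y0) (π y)] at h2
    linarith
  have hcont : ContinuousOn π (closedBall y0 r1) := by
    have : LipschitzOnWith 2 π (closedBall y0 r1) := by
      refine LipschitzOnWith.of_dist_le_mul fun y hy y' hy' => ?_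
      rw [dist_eq_norm, dist_eq_norm]; exact hlip y hy y' hy'
    exact this.continuousOn
  set E : Set (Euc n) := closedBall y0 r1 ∩ π ⁻¹' Cs with hE
  have hEc : IsCompact E :=
    (isCompact_closedBall y0 r1).of_isClosed_subset
      (hcont.preimage_isClosed_of_isClosed isClosed_closedBall hCscl) inter_subset_left
  set X : Set (Euc n) := xOf n c U y0 '' (clUy n c U y0 ∩ (fun q => q - qc n c y0 x0) ⁻¹' Ds) with hX
  have hset : IsCompact (clUy n c U y0 ∩ (fun q => q - qc n c y0 x0) ⁻¹' Ds) :=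
    (H.clUy_compact hy0).inter_right (hDscl.preimage (by fun_prop))
  have hXc : IsCompact X := hset.image_of_continuousOn (hK.continuousOn.mono inter_subset_left)
  have hCnorm : ∀ p ∈ Cs, ‖p‖ ≤ 2 * ⟪ν, p⟫_ℝ := by
    rintro p ⟨h1, h2, h3⟩
    have h4 : p = ⟪ν, p⟫_ℝ • ν + (p - ⟪ν, p⟫_ℝ • ν) := by abel
    calc ‖p‖ ≤ ‖⟪ν, p⟫_ℝ • ν‖ + ‖p - ⟪ν, p⟫_ℝ • ν‖ := by
          conv_lhs => rw [h4]
          exact norm_add_le _ _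
      _ ≤ ⟪ν, p⟫_ℝ + ⟪ν, p⟫_ℝ := by
          rw [norm_smul, hν, mul_one, Real.norm_of_nonneg (by linarith)]
          nlinarith
      _ = _ := by ring
  have hCE : Cs ⊆ π '' E := by
    intro p hp
    obtain ⟨y, hy, he⟩ := surj_half hr1.le hπ0 hap p ((hCnorm p hp).trans (by linarith [hp.2.1]))
    exact ⟨y, ⟨hy, by rw [mem_preimage, he]; exact hp⟩, he⟩
  have hvE : volume Cs ≤ ENNReal.ofReal (2 ^ n) * volume E :=
    (measure_mono hCE).trans (vol_lip' (by norm_num) fun y hy y' hy' => hlip y hy.1 y' hy'.1)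
  have hvX : volume X ≤ (K : ℝ≥0∞) ^ n * volume Ds := by
    refine (vol_lip (hK.mono inter_subset_left)).trans ?_
    refine mul_le_mul_right ?_ _
    refine (measure_mono inter_subset_right).trans (le_of_eq ?_)
    simp only [sub_eq_add_neg]
    exact measure_preimage_add_right volume _ _
  refine ⟨E, X, hEc, inter_subset_left.trans (closedBall_subset_closedBall hr1r),
    inter_subset_left.trans hr1V, hXc, ?_, ?_, ?_, ?_⟩
  · rintro _ ⟨q, hq, rfl⟩
    exact (xOf_mem hq.1).1
  · by_contra hc
    have h0 : volume E = 0 := by simpa using hc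
    rw [h0, mul_zero] at hvE
    exact absurd hvE (not_le.2 hCp)
  · have hKK : (K : ℝ≥0∞) ^ n = ENNReal.ofReal ((K : ℝ) ^ n) := by
      rw [ENNReal.ofReal_pow (by positivity), ENNReal.ofReal_coe_nnreal]
    calc volume X ≤ ENNReal.ofReal ((K : ℝ) ^ n) * (ENNReal.ofReal (ε / L) * (ENNReal.ofReal (2 ^ n) * volume E)) := by
          rw [← hKK]
          refine hvX.trans ?_
          gcongr
          exact hvol.trans (by gcongr)
      _ = ENNReal.ofReal ((K : ℝ) ^ n * (ε / L) * 2 ^ n) * volume E := by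
          rw [ENNReal.ofReal_mul (by positivity), ENNReal.ofReal_mul (by positivity)]; ring
      _ ≤ _ := by
          gcongr
          have : (K : ℝ) ^ n * (ε / L) * 2 ^ n = ε * (((K : ℝ) ^ n * 2 ^ n) / L) := by ring
          rw [this]
          refine mul_le_of_le_one_right hε.le ?_
          rw [div_le_one hLp]; linarith
  · intro x y hy hxy
    have hx : x ∈ closure U := hxy.1
    refine ⟨qc n c y0 x, ⟨Raw.qc_mem_cl x y0 hx, ?_⟩, xOf_left H hy0 hx⟩
    have hm1 := h.mono hx0 hxy
    have hm2 := h.mono hx hg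
    have ht1 := hta r1 hr1V x' hx' x hx y hy.1
    have ht2 := hta r1 hr1V x' hx' x0 hx0 y hy.1
    set p := π y with hp
    have hpC : p ∈ Cs := hy.2
    have hpe : slope' n c x' y0 y = p := rfl
    rw [hpe] at ht1 ht2
    set Δ := qc n c y0 x - qc n c y0 x0 with hΔ
    have e1 : qc n c y0 x - qc n c y0 x' = Δ + (qc n c y0 x0 - qc n c y0 x') := by rw [hΔ]; abel
    set e := qc n c y0 x0 - qc n c y0 x' with he
    rw [e1, inner_add_right] at ht1
    have hN0 : 0 ≤ M2 * ‖y - y0‖ ^ 2 := by positivity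
    have hD : ‖Δ + e‖ ^ 2 ≤ 2 * ‖Δ‖ ^ 2 + 2 * θ ^ 2 := by
      have h1 : ‖Δ + e‖ ≤ ‖Δ‖ + θ := (norm_add_le _ _).trans (by linarith)
      have h2 : ‖Δ + e‖ ^ 2 ≤ (‖Δ‖ + θ) ^ 2 := by gcongr
      nlinarith [sq_nonneg (‖Δ‖ - θ)]
    have he2 : ‖e‖ ^ 2 ≤ θ ^ 2 := by gcongr
    have hN1 := mul_le_mul_of_nonneg_left hD hN0
    have hN2 := mul_le_mul_of_nonneg_left he2 hN0
    have key : 0 ≤ ⟪p, Δ⟫_ℝ + M2 * ‖y - y0‖ ^ 2 * (2 * ‖Δ‖ ^ 2 + 3 * θ ^ 2) := by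
      have := (abs_le.1 ht1).2
      have := (abs_le.1 ht2).1
      nlinarith
    have hpd : ⟪p, Δ⟫_ℝ ≤ ⟪ν, p⟫_ℝ * ⟪ν, Δ⟫_ℝ + θ * ⟪ν, p⟫_ℝ * ‖Δ‖ := by
      have h1 : ⟪p, Δ⟫_ℝ = ⟪ν, p⟫_ℝ * ⟪ν, Δ⟫_ℝ + ⟪p - ⟪ν, p⟫_ℝ • ν, Δ⟫_ℝ := by
        rw [inner_sub_left, inner_smul_left]; simp
      have h2 := real_inner_le_norm (p - ⟪ν, p⟫_ℝ • ν) Δ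
      have h3 : ‖p - ⟪ν, p⟫_ℝ • ν‖ * ‖Δ‖ ≤ θ * ⟪ν, p⟫_ℝ * ‖Δ‖ := by
        refine mul_le_mul_of_nonneg_right ?_ (norm_nonneg _)
        have h5 := hpC.2.2
        have h6 := mul_le_mul_of_nonneg_left hpC.1 hθ.le
        linarith
      linarith
    have hN : M2 * ‖y - y0‖ ^ 2 ≤ 16 * M2 * ⟪ν, p⟫_ℝ ^ 2 := by
      have h1 : ‖y - y0‖ ≤ 4 * ⟪ν, p⟫_ℝ := by linarith [hinv y hy.1, hCnorm p hpC]
      have h2 : ‖y - y0‖ ^ 2 ≤ (4 * ⟪ν, p⟫_ℝ) ^ 2 := by gcongr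
      nlinarith
    have := bd_alg hR hθ (norm_nonneg Δ) (lt_of_lt_of_le (by positivity) hpC.1) hpC.2.1 hM2 haM hN
      (hball x hx) (by linarith)
    exact this

end boundary2
end

end Part12

section Part13
open Set MeasureTheory Metric Bornology
open scoped ENNReal NNReal Pointwise InnerProductSpace

noncomputable section
section sol
variable {n : ℕ} {c : Euc n → Euc n → ℝ} {U V : Set (Euc n)}

/-- Image of `X` under the contact relation. -/
def GI (n : ℕ) (c : Euc n → Euc n → ℝ) (U V : Set (Euc n)) (u v : Euc n → ℝ) (X : Set (Euc n)) :
    Set (Euc n) := {y | ∃ x ∈ X, (x, y) ∈ Gam n c U V u v}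

/-- All the hypotheses of the theorem in convenient form. -/
structure Sol (n : ℕ) (c : Euc n → Euc n → ℝ) (U V O : Set (Euc n)) (u v : Euc n → ℝ) (lam Lam : ℝ) :
    Prop where
  raw : Raw n c U V
  mtw : MTW n c U V
  pot : Pot n c U V u v
  openO : IsOpen O
  subO : O ⊆ U
  lampos : 0 < lam
  Lampos : 0 < Lam
  ge : ∀ X ⊆ O, MeasurableSet X → ENNReal.ofReal lam * volume X ≤ volume (GI n c U V u v X)
  le : ∀ X ⊆ closure U, MeasurableSet X → volume (GI n c U V u v X) ≤ ENNReal.ofReal Lam * volume X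

variable {O : Set (Euc n)} {u v : Euc n → ℝ} {lam Lam : ℝ}

theorem not_half {a : ℝ≥0∞} (h0 : 0 < a) (ht : a < ⊤) (h : a ≤ ENNReal.ofReal (1 / 2) * a) : False := by
  have h1 : 0 < a.toReal := ENNReal.toReal_pos h0.ne' ht.ne
  have := ENNReal.toReal_mono (ENNReal.mul_ne_top ENNReal.ofReal_ne_top ht.ne) h
  rw [ENNReal.toReal_mul, ENNReal.toReal_ofReal (by norm_num)] at this
  linarith

theorem Sol.memU (S : Sol n c U V O u v lam Lam) {x y : Euc n} (hxy : (x, y) ∈ Gam n c U V u v)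
    (hy : y ∈ V) : x ∈ U := by
  by_contra hx
  obtain ⟨E, X, hE, -, hEV, hX, hXU, hEp, hvol, hEX⟩ := S.raw.boundary S.pot hxy.1 hx hy hxy
    (ε := 1 / (2 * Lam)) (r := 1) (by have := S.Lampos; positivity) one_pos
  have h1 : E ⊆ GI n c U V u v X := by
    intro y hy
    obtain ⟨x, hx, he⟩ := S.pot.exX y (subset_closure (hEV hy))
    have : (x, y) ∈ Gam n c U V u v := ⟨hx, subset_closure (hEV hy), he⟩
    exact ⟨x, hEX x y hy this, this⟩
  have h2 := (measure_mono h1).trans (S.le X hXU hX.measurableSet)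
  refine not_half hEp hE.measure_lt_top (h2.trans ?_)
  refine (mul_le_mul_right hvol _).trans (le_of_eq ?_)
  rw [← mul_assoc, ← ENNReal.ofReal_mul S.Lampos.le]
  congr 2
  have := S.Lampos
  field_simp

theorem Gam_swap {x y : Euc n} (h : (x, y) ∈ Gam n c U V u v) : (y, x) ∈ Gam n (swapC n c) V U v u :=
  ⟨h.2.1, h.1, by have := h.2.2; simp only [swapC] at *; linarith⟩

theorem Sol.memV (S : Sol n c U V O u v lam Lam) {x y : Euc n} (hxy : (x, y) ∈ Gam n c U V u v)
    (hx : x ∈ O) : y ∈ V := by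
  by_contra hy
  obtain ⟨r0, hr0, hr0O⟩ := Metric.isOpen_iff.1 S.openO x hx
  obtain ⟨E, Y, hE, hEr, hEV, hY, hYV, hEp, hvol, hEY⟩ := S.raw.swap.boundary S.pot.swap hxy.2.1 hy
    (S.subO hx) (Gam_swap hxy) (ε := lam / 2) (r := r0 / 2) (by have := S.lampos; positivity) (by positivity)
  have hEO : E ⊆ O := hEr.trans ((closedBall_subset_ball (by linarith)).trans hr0O)
  have h1 : GI n c U V u v E ⊆ Y := by
    rintro y ⟨x, hx, hxy⟩
    exact hEY y x hx (Gam_swap hxy)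
  have h2 := (S.ge E hEO hE.measurableSet).trans ((measure_mono h1).trans hvol)
  have hl : ENNReal.ofReal lam⁻¹ * ENNReal.ofReal lam = 1 := by
    have := S.lampos
    rw [← ENNReal.ofReal_mul (by positivity), inv_mul_cancel₀ this.ne', ENNReal.ofReal_one]
  refine not_half hEp hE.measure_lt_top ?_
  have h3 := mul_le_mul_right h2 (ENNReal.ofReal lam⁻¹)
  rw [← mul_assoc, hl, one_mul, ← mul_assoc, ← ENNReal.ofReal_mul (by have := S.lampos; positivity)] at h3
  refine h3.trans (le_of_eq ?_)
  congr 2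
  have := S.lampos
  field_simp

theorem Sol.image_compact (S : Sol n c U V O u v lam Lam) {K : Set (Euc n)} (hK : IsCompact K) :
    IsCompact (GI n c U V u v K) := by
  have h1 : GI n c U V u v K = Prod.snd '' (Gam n c U V u v ∩ Prod.fst ⁻¹' K) := by
    ext y; constructor
    · rintro ⟨x, hx, h⟩; exact ⟨(x, y), ⟨h, hx⟩, rfl⟩
    · rintro ⟨⟨x, y'⟩, ⟨h, hx⟩, rfl⟩; exact ⟨x, hx, h⟩
  rw [h1]
  exact ((Pot.gam_compact S.raw S.pot).inter_right (hK.isClosed.preimage continuous_fst)).image continuous_snd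

theorem Sol.contact_compact (S : Sol n c U V O u v lam Lam) (y : Euc n) :
    IsCompact {x | (x, y) ∈ Gam n c U V u v} := by
  have h1 : {x | (x, y) ∈ Gam n c U V u v} = Prod.fst '' (Gam n c U V u v ∩ Prod.snd ⁻¹' {y}) := by
    ext x; constructor
    · intro h; exact ⟨(x, y), ⟨h, rfl⟩, rfl⟩
    · rintro ⟨⟨x, y'⟩, ⟨h, hx⟩, rfl⟩
      have : y' = y := hx
      subst this; exact h
  rw [h1]
  exact ((Pot.gam_compact S.raw S.pot).inter_right (isClosed_singleton.preimage continuous_snd)).image continuous_fst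

end sol
end

end Part13

section Part14
open Set MeasureTheory Metric Bornology
open scoped ENNReal NNReal Pointwise InnerProductSpace

noncomputable section
section john
variable {n : ℕ}

/-- Standard basis. -/
def sb (n : ℕ) : Module.Basis (Fin n) ℝ (Euc n) := (EuclideanSpace.basisFun (Fin n) ℝ).toBasis

/-- The determinant of a tuple of vectors. -/
def detv (n : ℕ) (b : Fin n → Euc n) : ℝ := (sb n).det b

/-- The linear map sending the standard basis to `b`. -/
def lmv (n : ℕ) (b : Fin n → Euc n) : Euc n →ₗ[ℝ] Euc n := (sb n).constr ℝ b

theorem lmv_apply (b : Fin n → Euc n) (a : Euc n) : lmv n b a = ∑ i, a i • b i := by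
  rw [lmv, Module.Basis.constr_apply_fintype]
  simp [sb]

theorem lmv_det (b : Fin n → Euc n) : LinearMap.det (lmv n b) = detv n b := by
  have h := (sb n).det_comp (lmv n b) (sb n)
  have h2 : (lmv n b) ∘ (sb n) = b := by
    funext i; simp [lmv]
  rw [h2, Module.Basis.det_self, mul_one] at h
  exact h.symm

theorem detv_cont : Continuous (detv n) := by
  unfold detv
  simp only [Module.Basis.det_apply]
  refine Continuous.matrix_det ?_
  refine continuous_matrix fun i j => ?_
  simp only [Module.Basis.toMatrix_apply, sb]
  simp only [OrthonormalBasis.coe_toBasis_repr_apply, EuclideanSpace.basisFun_repr]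
  fun_prop

theorem detv_smul (s : Fin n → ℝ) (b : Fin n → Euc n) :
    detv n (fun i => s i • b i) = (∏ i, s i) * detv n b := by
  have := (sb n).det.map_smul_univ s b
  simpa [detv] using this

theorem detv_update (b : Fin n → Euc n) (i : Fin n) (a : Fin n → ℝ) :
    detv n (Function.update b i (∑ k, a k • b k)) = a i * detv n b := by
  unfold detv
  rw [AlternatingMap.map_update_sum, Finset.sum_eq_single i]
  · rw [AlternatingMap.map_update_smul, Function.update_eq_self, smul_eq_mul]
  · intro k _ hk
    rw [AlternatingMap.map_update_smul, AlternatingMap.map_update_self _ _ hk.symm, smul_zero]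
  · simp

theorem detv_orth (f : OrthonormalBasis (Fin n) ℝ (Euc n)) : |detv n f| = 1 := by
  have := (EuclideanSpace.basisFun (Fin n) ℝ).det_to_matrix_orthonormalBasis f
  rwa [Real.norm_eq_abs] at this

theorem norm_le_of_coord {a : Euc n} {C : ℝ} (h : ∀ i, |a i| ≤ C) : ‖a‖ ≤ n * C := by
  have h1 : a = ∑ i, a i • EuclideanSpace.basisFun (Fin n) ℝ i := by
    conv_lhs => rw [← (EuclideanSpace.basisFun (Fin n) ℝ).sum_repr a]
    simp
  rw [h1]
  refine (norm_sum_le _ _).trans ?_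
  calc _ ≤ ∑ i : Fin n, C := by
        refine Finset.sum_le_sum fun i _ => ?_
        rw [norm_smul, OrthonormalBasis.norm_eq_one, mul_one]; exact h i
    _ = _ := by simp

theorem coord_le (a : Euc n) (i : Fin n) : |a i| ≤ ‖a‖ := by
  have := PiLp.norm_apply_le a i
  rwa [Real.norm_eq_abs] at this

theorem john {Q : Set (Euc n)} (hQ : IsCompact Q) (hc : Convex ℝ Q) (hi : (interior Q).Nonempty) :
    ∃ (zc : Euc n) (T : Euc n →ₗ[ℝ] Euc n), LinearMap.det T ≠ 0 ∧ (∀ a, ‖a‖ ≤ 1 → zc + T a ∈ Q) ∧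
    ∀ q ∈ Q, ∃ a, ‖a‖ ≤ n * (2 * (n + 1) ^ 2) ∧ q = zc + T a := by
  have hcomp : IsCompact (Q ×ˢ (Set.univ.pi fun _ : Fin n => Q)) :=
    hQ.prod (isCompact_univ_pi fun _ => hQ)
  obtain ⟨z, hz⟩ := hi
  obtain ⟨r, hr, hrQ⟩ := Metric.isOpen_iff.1 isOpen_interior z hz
  have hzQ : z ∈ Q := interior_subset hz
  set F : Euc n × (Fin n → Euc n) → ℝ := fun w => |detv n (fun i => w.2 i - w.1)| with hF
  have hFc : Continuous F := by
    refine Continuous.abs (detv_cont.comp ?_)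
    fun_prop
  set w0 : Euc n × (Fin n → Euc n) := (z, fun i => z + (r / 2) • EuclideanSpace.basisFun (Fin n) ℝ i) with hw0
  have hw0m : w0 ∈ Q ×ˢ (Set.univ.pi fun _ : Fin n => Q) := by
    refine ⟨hzQ, fun i _ => interior_subset (hrQ ?_)⟩
    rw [mem_ball, dist_eq_norm, add_sub_cancel_left, norm_smul, OrthonormalBasis.norm_eq_one, mul_one,
      Real.norm_of_nonneg (by positivity)]
    linarith
  obtain ⟨⟨b0, b⟩, ⟨hb0, hb⟩, hmax⟩ := hcomp.exists_isMaxOn ⟨w0, hw0m⟩ hFc.continuousOn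
  have hpos : 0 < F (b0, b) := by
    refine lt_of_lt_of_le ?_ (isMaxOn_iff.1 hmax _ hw0m)
    simp only [hF, hw0, add_sub_cancel_left]
    rw [detv_smul, abs_mul, detv_orth, mul_one, abs_pos]
    exact Finset.prod_ne_zero_iff.2 fun i _ => by positivity
  simp only at hb0 hb
  set e : Fin n → Euc n := fun i => b i - b0 with he
  have hdet : 0 < |detv n e| := hpos
  have hLdet : LinearMap.det (lmv n e) ≠ 0 := by rw [lmv_det]; exact abs_pos.1 hdet
  set L := lmv n e with hL
  -- every point of Q has coordinates at most 1
  have hout : ∀ q ∈ Q, ∃ a : Euc n, (∀ i, |a i| ≤ 1) ∧ q = b0 + L a := by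
    intro q hq
    obtain ⟨a, ha⟩ := ((L.equivOfDetNeZero hLdet).surjective (q - b0))
    have ha' : L a = q - b0 := ha
    refine ⟨a, fun i => ?_, by rw [ha']; abel⟩
    have hm : (b0, Function.update b i q) ∈ Q ×ˢ (Set.univ.pi fun _ : Fin n => Q) := by
      refine ⟨hb0, fun j _ => ?_⟩
      by_cases hj : j = i
      · subst hj; simpa using hq
      · simp only [Function.update_of_ne hj]; exact hb j (mem_univ _)
    have h1 := isMaxOn_iff.1 hmax _ hm
    have h2 : (fun j => (Function.update b i q) j - b0) = Function.update e i (∑ k, a k • e k) := by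
      funext j
      by_cases hj : j = i
      · subst hj; simp only [Function.update_self]; rw [← lmv_apply, ← hL, ha']
      · simp only [Function.update_of_ne hj, he]
    simp only [hF] at h1
    rw [h2, detv_update, abs_mul] at h1
    exact le_of_mul_le_mul_right (by simpa [one_mul] using h1) hdet
  have hin : ∀ a : Euc n, (∀ i, 0 ≤ a i) → ∑ i, a i ≤ 1 → b0 + L a ∈ Q := by
    intro a ha hs
    have h1 : b0 + L a = (1 - ∑ i, a i) • b0 + ∑ i, a i • b i := by
      rw [hL, lmv_apply, he]
      simp only [smul_sub, Finset.sum_sub_distrib, sub_smul, one_smul, Finset.sum_smul]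
      abel
    rw [h1]
    have h2 := hc.sum_mem (t := (Finset.univ : Finset (Option (Fin n))))
      (w := fun o => o.elim (1 - ∑ i, a i) (fun i => a i)) (z := fun o => o.elim b0 b)
      (by rintro (_ | i) _ <;> simp [hs, ha]) (by simp) (by
        rintro (_ | i) _
        · exact hb0
        · exact hb i (mem_univ _))
    simpa using h2
  set δ : ℝ := 1 / ((n : ℝ) + 1) ^ 2 with hδ
  have hδp : 0 < δ := by positivity
  set ones : Euc n := WithLp.toLp 2 (fun _ => 1 / ((n : ℝ) + 1)) with hones
  have hones' : ∀ i, ones i = 1 / ((n : ℝ) + 1) := fun i => rfl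
  refine ⟨b0 + L ones, δ • L, ?_, ?_, ?_⟩
  · rw [LinearMap.det_smul]; positivity
  · intro a ha
    have h1 : b0 + L ones + (δ • L) a = b0 + L (ones + δ • a) := by
      rw [map_add, map_smul, LinearMap.smul_apply, add_assoc]
    rw [h1]
    have hai : ∀ i, |a i| ≤ 1 := fun i => (coord_le a i).trans ha
    have hδn : δ ≤ 1 / ((n : ℝ) + 1) := by
      rw [hδ]
      apply one_div_le_one_div_of_le (by positivity)
      nlinarith [(Nat.cast_nonneg n : (0:ℝ) ≤ n)]
    apply hin
    · intro i
      rw [PiLp.add_apply, PiLp.smul_apply, hones', smul_eq_mul]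
      have := abs_le.1 (hai i)
      nlinarith
    · calc ∑ i, (ones + δ • a) i ≤ ∑ i : Fin n, (1 / ((n : ℝ) + 1) + δ) := by
            refine Finset.sum_le_sum fun i _ => ?_
            rw [PiLp.add_apply, PiLp.smul_apply, hones', smul_eq_mul]
            have := abs_le.1 (hai i)
            nlinarith
        _ = n * (1 / ((n : ℝ) + 1) + δ) := by simp [mul_add]
        _ ≤ 1 := by
            rw [hδ]
            have : (n : ℝ) * (1 / ((n : ℝ) + 1) + 1 / ((n : ℝ) + 1) ^ 2) = ((n : ℝ) * (n + 2)) / (n + 1) ^ 2 := by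
              field_simp; ring
            rw [this, div_le_one (by positivity)]
            nlinarith
  · intro q hq
    obtain ⟨a, ha, rfl⟩ := hout q hq
    refine ⟨δ⁻¹ • (a - ones), ?_, ?_⟩
    · apply norm_le_of_coord
      intro i
      rw [PiLp.smul_apply, PiLp.sub_apply, hones', smul_eq_mul, abs_mul, hδ, one_div, inv_inv,
        abs_of_pos (by positivity : 0 < ((n : ℝ) + 1) ^ 2)]
      have h2 : |a i - 1 / ((n : ℝ) + 1)| ≤ 2 := by
        have h3 : (0:ℝ) ≤ 1 / ((n : ℝ) + 1) := by positivity
        have h4 : 1 / ((n : ℝ) + 1) ≤ 1 := by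
          rw [div_le_one (by positivity)]; linarith [(Nat.cast_nonneg n : (0:ℝ) ≤ n)]
        rw [abs_le]; constructor <;> linarith [abs_le.1 (ha i)]
      nlinarith [sq_nonneg ((n : ℝ) + 1)]
    · rw [LinearMap.smul_apply, map_smul, smul_smul, mul_inv_cancel₀ hδp.ne', one_smul, map_sub]
      abel

theorem adj_det (T : Euc n →ₗ[ℝ] Euc n) : LinearMap.det (LinearMap.adjoint T) = LinearMap.det T := by
  rw [← LinearMap.det_toMatrix (sb n), ← LinearMap.det_toMatrix (sb n), sb, LinearMap.toMatrix_adjoint,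
    Matrix.det_conjTranspose]
  simp

/-- Principal axes of a linear map. -/
theorem axes (T : Euc n →ₗ[ℝ] Euc n) : ∃ (f : OrthonormalBasis (Fin n) ℝ (Euc n)) (r : Fin n → ℝ),
    (∀ i, 0 ≤ r i) ∧ ∏ i, r i = |LinearMap.det T| ∧ ∀ i a, |⟪f i, T a⟫_ℝ| ≤ r i * ‖a‖ := by
  set S := T ∘ₗ LinearMap.adjoint T with hS
  have hsym : S.IsSymmetric := by
    intro x y
    rw [hS, LinearMap.comp_apply, LinearMap.comp_apply, ← LinearMap.adjoint_inner_right,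
      LinearMap.adjoint_inner_left]
  have hn : Module.finrank ℝ (Euc n) = n := by simp
  set f := hsym.eigenvectorBasis hn with hf
  set r : Fin n → ℝ := fun i => ‖LinearMap.adjoint T (f i)‖ with hr
  have hr2 : ∀ i, hsym.eigenvalues hn i = r i ^ 2 := by
    intro i
    have h1 := hsym.apply_eigenvectorBasis hn i
    have h2 : ⟪S (f i), f i⟫_ℝ = hsym.eigenvalues hn i := by
      rw [hf, h1, inner_smul_left]
      simp
    rw [← h2, hS, LinearMap.comp_apply, ← LinearMap.adjoint_inner_right, real_inner_self_eq_norm_sq]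
  refine ⟨f, r, fun i => norm_nonneg _, ?_, ?_⟩
  · have h1 := hsym.det_eq_prod_eigenvalues hn
    simp only [hr2] at h1
    have h3 : LinearMap.det (LinearMap.adjoint T) = LinearMap.det T := adj_det T
    rw [hS, LinearMap.det_comp, h3, ← sq] at h1
    simp only [RCLike.ofReal_real_eq_id, id, Finset.prod_pow] at h1
    rw [← abs_of_nonneg (Finset.prod_nonneg fun i _ => norm_nonneg (LinearMap.adjoint T (f i)) : 0 ≤ ∏ i, r i)]
    exact ((sq_eq_sq_iff_abs_eq_abs _ _).1 h1).symm
  · intro i a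
    rw [← LinearMap.adjoint_inner_left]
    exact abs_real_inner_le_norm _ _

end john
end

end Part14

section Part15
open Set MeasureTheory Metric Bornology
open scoped ENNReal NNReal Pointwise InnerProductSpace

noncomputable section
section sec
variable {n : ℕ} {c : Euc n → Euc n → ℝ} {U V : Set (Euc n)} {u v : Euc n → ℝ}

/-- Sublevel section of the potential. -/
def Sec (n : ℕ) (c : Euc n → Euc n → ℝ) (U : Set (Euc n)) (u : Euc n → ℝ) (y0 : Euc n) (k : ℝ) :
    Set (Euc n) := {x | x ∈ closure U ∧ u x + c x y0 ≤ k}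

theorem Pot.contact (h : Pot n c U V u v) {z y x : Euc n} (hz : (z, y) ∈ Gam n c U V u v)
    (hx : x ∈ closure U) (y0 : Euc n) :
    (-c x y + c x y0) - (-c z y + c z y0) ≤ (u x + c x y0) - (u z + c z y0) := by
  have := h.mono hx hz
  linarith

theorem Pot.cont_w (H : Raw n c U V) (h : Pot n c U V u v) {y0 : Euc n} (hy0 : y0 ∈ closure V) :
    ContinuousOn (fun x => u x + c x y0) (closure U) := h.contu.add (H.cont_x hy0)

theorem Pot.sec_compact (H : Raw n c U V) (h : Pot n c U V u v) {y0 : Euc n} (hy0 : y0 ∈ closure V)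
    (k : ℝ) : IsCompact (Sec n c U u y0 k) :=
  H.compU.of_isClosed_subset
    ((Pot.cont_w H h hy0).preimage_isClosed_of_isClosed isClosed_closure (isClosed_Iic (a := k)))
    inter_subset_left

theorem Pot.sec_seg (H : Raw n c U V) (h3 : MTW n c U V) (h : Pot n c U V u v) {y0 : Euc n} (hy0 : y0 ∈ V)
    {k : ℝ} {x0 x1 x : Euc n} (hx0 : x0 ∈ Sec n c U u y0 k) (hx1 : x1 ∈ Sec n c U u y0 k)
    (hx : x ∈ closure U) {t : ℝ} (ht : t ∈ Icc (0:ℝ) 1)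
    (hq : qc n c y0 x = qc n c y0 x0 + t • (qc n c y0 x1 - qc n c y0 x0)) : x ∈ Sec n c U u y0 k := by
  obtain ⟨y, hy, he⟩ := h.exY x hx
  have hg : (x, y) ∈ Gam n c U V u v := ⟨hx, hy, he⟩
  have h1 := H.I1 h3 hx0.1 hx1.1 hy0 hy ht hx hq
  have e0 := h.contact hg hx0.1 y0
  have e1 := h.contact hg hx1.1 y0
  refine ⟨hx, ?_⟩
  have := hx0.2; have := hx1.2
  rcases le_max_iff.1 h1 with h2 | h2 <;> linarith

theorem Pot.sec_convex (H : Raw n c U V) (h3 : MTW n c U V) (h : Pot n c U V u v) {y0 : Euc n} (hy0 : y0 ∈ V)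
    (k : ℝ) : Convex ℝ (qc n c y0 '' Sec n c U u y0 k) := by
  rw [convex_iff_forall_pos]
  rintro _ ⟨x0, hx0, rfl⟩ _ ⟨x1, hx1, rfl⟩ a b ha hb hab
  have hm : a • qc n c y0 x0 + b • qc n c y0 x1 ∈ clUy n c U y0 :=
    H.clUy_convex hy0 (Raw.qc_mem_cl _ _ hx0.1) (Raw.qc_mem_cl _ _ hx1.1) ha.le hb.le hab
  obtain ⟨hx, he⟩ := xOf_mem hm
  refine ⟨_, Pot.sec_seg H h3 h hy0 hx0 hx1 hx (t := b) ⟨hb.le, by linarith⟩ ?_, he⟩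
  rw [he]
  have : a = 1 - b := by linarith
  rw [this]; module

/-- If a point of the section is strictly inside, one can move in every direction. -/
theorem Pot.push (H : Raw n c U V) (h : Pot n c U V u v) {y0 : Euc n} (hy0 : y0 ∈ V)
    {k : ℝ} {z : Euc n} (hz : z ∈ U) (hlt : u z + c z y0 < k) :
    ∃ r : ℝ, 0 < r ∧ ∀ q, ‖q - qc n c y0 z‖ < r → ∃ x ∈ U, x ∈ Sec n c U u y0 k ∧ qc n c y0 x = q := by
  have hqz : qc n c y0 z ∈ Uyset n c U y0 := Raw.qc_mem _ _ hz
  have hc1 : ContinuousAt (xOf n c U y0) (qc n c y0 z) := (H.cdX hy0 hqz).continuousAt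
  have hc2 : ContinuousAt (fun x => u x + c x y0) z :=
    ((Pot.cont_w H h (subset_closure hy0)).continuousAt (Filter.mem_of_superset (H.openU.mem_nhds hz) subset_closure))
  have hxz : xOf n c U y0 (qc n c y0 z) = z := xOf_left H hy0 (subset_closure hz)
  have hc3 : ContinuousAt (fun q => u (xOf n c U y0 q) + c (xOf n c U y0 q) y0) (qc n c y0 z) := by
    have : ContinuousAt (fun x => u x + c x y0) (xOf n c U y0 (qc n c y0 z)) := by rw [hxz]; exact hc2
    exact ContinuousAt.comp (f := xOf n c U y0) this hc1
  have h1 : ∀ᶠ q in nhds (qc n c y0 z), u (xOf n c U y0 q) + c (xOf n c U y0 q) y0 < k := by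
    refine hc3.eventually_lt_const ?_
    show u (xOf n c U y0 (qc n c y0 z)) + c (xOf n c U y0 (qc n c y0 z)) y0 < k
    rw [hxz]; exact hlt
  have h2 : ∀ᶠ q in nhds (qc n c y0 z), q ∈ Uyset n c U y0 := (H.openUy hy0).mem_nhds hqz
  obtain ⟨r, hr, hb⟩ := Metric.eventually_nhds_iff.1 (h1.and h2)
  refine ⟨r, hr, fun q hq => ?_⟩
  obtain ⟨h5, h6⟩ := hb (by rwa [dist_eq_norm])
  obtain ⟨h7, h8⟩ := xOf_memU H hy0 h6
  exact ⟨_, h7, ⟨subset_closure h7, h5.le⟩, h8⟩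

/-- The contact slopes at a point form a compact convex set. -/
theorem Pot.slopes (H : Raw n c U V) (h3 : MTW n c U V) (h : Pot n c U V u v) {y0 z : Euc n} (hy0 : y0 ∈ V)
    (hz : z ∈ U) : IsCompact (slope' n c z y0 '' {y | (z, y) ∈ Gam n c U V u v}) ∧
    Convex ℝ (slope' n c z y0 '' {y | (z, y) ∈ Gam n c U V u v}) := by
  have e : {y | (z, y) ∈ Gam n c U V u v} = Sec n (swapC n c) V v z (-u z) := by
    ext y; constructor
    · rintro ⟨h1, h2, h4⟩
      simp only at h4
      exact ⟨h2, by simp only [swapC]; linarith⟩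
    · rintro ⟨h1, h2⟩
      simp only [swapC] at h2
      refine ⟨subset_closure hz, h1, ?_⟩
      have := h.ineq z (subset_closure hz) y h1
      simp only
      linarith
  rw [e]
  have hcp := Pot.sec_compact H.swap h.swap (subset_closure hz) (-u z)
  have hcv := Pot.sec_convex H.swap (h3.swap H) h.swap hz (-u z)
  constructor
  · refine hcp.image_of_continuousOn ?_
    refine (H.slope_cont hy0).comp (f := fun y => (z, y)) (by fun_prop) fun y hy => ⟨hz, hy.1⟩
  · rw [convex_iff_forall_pos]
    rintro _ ⟨y1, hy1, rfl⟩ _ ⟨y2, hy2, rfl⟩ a b ha hb hab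
    obtain ⟨y, hy, he⟩ := hcv (mem_image_of_mem _ hy1) (mem_image_of_mem _ hy2) ha.le hb.le hab
    refine ⟨y, hy, ?_⟩
    have ha' : a = 1 - b := by linarith
    rw [slope_affine (t := b) (y1 := y1) (y' := y2) (by rw [he, ha']; module), ha']
    module

end sec
end

end Part15

section Part16
open Set MeasureTheory Metric Bornology
open scoped ENNReal NNReal Pointwise InnerProductSpace

noncomputable section
section nrm
variable {n : ℕ} {c : Euc n → Euc n → ℝ} {U V : Set (Euc n)} {u v : Euc n → ℝ}

theorem Pot.descent (H : Raw n c U V) (h : Pot n c U V u v) {y0 z e : Euc n} (hy0 : y0 ∈ V) (hz : z ∈ U)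
    (he : ∀ y, (z, y) ∈ Gam n c U V u v → ⟪slope' n c z y0 y, e⟫_ℝ < 0) :
    ∃ t : ℝ, 0 < t ∧ ∃ x ∈ U, qc n c y0 x = qc n c y0 z + t • e ∧ u x + c x y0 ≤ u z + c z y0 := by
  obtain ⟨δ0, hδ0, hb⟩ := Metric.nhds_basis_closedBall.mem_iff.1 (H.openU.mem_nhds hz)
  set P : Set (Euc n × (Euc n × Euc n)) := closedBall z δ0 ×ˢ Gam n c U V u v with hP
  have hPc : IsCompact P := (isCompact_closedBall _ _).prod (Pot.gam_compact H h)
  have hF : ContinuousOn (fun p : Euc n × (Euc n × Euc n) => ⟪slope' n c p.1 y0 p.2.2, e⟫_ℝ) P := by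
    have h1 : ContinuousOn (fun p : Euc n × (Euc n × Euc n) => slope' n c p.1 y0 p.2.2) P := by
      refine ContinuousOn.comp (g := fun z : Euc n × Euc n => slope' n c z.1 y0 z.2)
        (f := fun p : Euc n × (Euc n × Euc n) => (p.1, p.2.2)) (H.slope_cont hy0) (by fun_prop) ?_
      rintro ⟨a, b, d⟩ ⟨h1, h2⟩
      exact ⟨hb h1, h2.2.1⟩
    exact h1.inner continuousOn_const
  have hBc : IsCompact (P ∩ (fun p : Euc n × (Euc n × Euc n) => ⟪slope' n c p.1 y0 p.2.2, e⟫_ℝ) ⁻¹' Ici 0) :=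
    hPc.of_isClosed_subset (hF.preimage_isClosed_of_isClosed hPc.isClosed isClosed_Ici) inter_subset_left
  have hIc := hBc.image (f := fun p : Euc n × (Euc n × Euc n) => (p.1, p.2.1)) (by fun_prop)
  have hn : (z, z) ∉ (fun p : Euc n × (Euc n × Euc n) => (p.1, p.2.1)) ''
      (P ∩ (fun p : Euc n × (Euc n × Euc n) => ⟪slope' n c p.1 y0 p.2.2, e⟫_ℝ) ⁻¹' Ici 0) := by
    rintro ⟨⟨a, b, d⟩, ⟨⟨h1, h2⟩, h4⟩, h5⟩
    simp only [Prod.mk.injEq] at h5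
    obtain ⟨rfl, rfl⟩ := h5
    exact absurd (he d h2) (not_lt.2 h4)
  have hev := hIc.isClosed.isOpen_compl.mem_nhds hn
  obtain ⟨δ1, hδ1, hb1⟩ := Metric.mem_nhds_iff.1 hev
  have hq0 : qc n c y0 z + (0:ℝ) • e ∈ Uyset n c U y0 := by
    rw [zero_smul, add_zero]; exact Raw.qc_mem _ _ hz
  have hs0 : segX n c U y0 (qc n c y0 z) e 0 = z := by
    simp only [segX, zero_smul, add_zero]
    exact xOf_left H hy0 (subset_closure hz)
  have hsc : ContinuousAt (segX n c U y0 (qc n c y0 z) e) 0 := (H.seg_cd hy0 hq0).continuousAt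
  have hev2 : ∀ᶠ t in nhds (0:ℝ), segX n c U y0 (qc n c y0 z) e t ∈ ball z (min δ0 δ1) := by
    refine hsc ?_
    rw [hs0]
    exact ball_mem_nhds _ (lt_min hδ0 hδ1)
  obtain ⟨r, hr, hb2⟩ := Metric.eventually_nhds_iff.1 (hev2.and (H.seg_ev hy0 hq0))
  have hall : ∀ t ∈ Icc (0:ℝ) (r/2), segX n c U y0 (qc n c y0 z) e t ∈ ball z (min δ0 δ1) ∧
      qc n c y0 z + t • e ∈ Uyset n c U y0 := by
    intro t ht
    apply hb2
    rw [Real.dist_eq, sub_zero, abs_of_nonneg ht.1]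
    linarith [ht.2]
  have hr2 : (0:ℝ) < r/2 := by linarith
  have hend := hall (r/2) ⟨hr2.le, le_rfl⟩
  obtain ⟨hxU, hxq⟩ := H.seg_mem hy0 hend.2
  obtain ⟨y, hyV, hy⟩ := h.exY _ (subset_closure hxU)
  have hG : (segX n c U y0 (qc n c y0 z) e (r/2), y) ∈ Gam n c U V u v := ⟨subset_closure hxU, hyV, hy⟩
  refine ⟨r/2, hr2, _, hxU, hxq, ?_⟩
  have hcon := h.contact hG (subset_closure hz) y0
  obtain ⟨s, hs, hs'⟩ := exists_hasDerivAt_eq_slope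
    (fun t => -c (segX n c U y0 (qc n c y0 z) e t) y + c (segX n c U y0 (qc n c y0 z) e t) y0)
    (fun t => ⟪slope' n c (segX n c U y0 (qc n c y0 z) e t) y0 y, e⟫_ℝ) hr2
    (fun t ht => (H.slope_deriv hy0 hyV (hall t ht).2).continuousAt.continuousWithinAt)
    (fun t ht => H.slope_deriv hy0 hyV (hall t ⟨ht.1.le, ht.2.le⟩).2)
  have hneg : ⟪slope' n c (segX n c U y0 (qc n c y0 z) e s) y0 y, e⟫_ℝ < 0 := by
    by_contra hcc
    push Not at hcc
    have h1 := (hall s ⟨hs.1.le, hs.2.le⟩).1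
    have hmem : (segX n c U y0 (qc n c y0 z) e s, segX n c U y0 (qc n c y0 z) e (r/2)) ∈ ball (z, z) δ1 := by
      rw [mem_ball, Prod.dist_eq, max_lt_iff]
      exact ⟨lt_of_lt_of_le h1 (min_le_right _ _), lt_of_lt_of_le hend.1 (min_le_right _ _)⟩
    refine hb1 hmem ⟨(segX n c U y0 (qc n c y0 z) e s, segX n c U y0 (qc n c y0 z) e (r/2), y), ⟨⟨?_, hG⟩, hcc⟩, rfl⟩
    exact ball_subset_closedBall (ball_subset_ball (min_le_left _ _) h1)
  simp only [sub_zero] at hs'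
  rw [hs', div_neg_iff] at hneg
  simp only [hs0] at hneg
  rcases hneg with h1 | h1
  · linarith [h1.2]
  · linarith [h1.1]

theorem Pot.normal (H : Raw n c U V) (h3 : MTW n c U V) (h : Pot n c U V u v) {y0 z f : Euc n} {k : ℝ}
    (hy0 : y0 ∈ V) (hz : z ∈ U) (hzk : z ∈ Sec n c U u y0 k)
    (hf : ‖f‖ = 1) (hmax : ∀ x ∈ Sec n c U u y0 k, ⟪f, qc n c y0 x⟫_ℝ ≤ ⟪f, qc n c y0 z⟫_ℝ) :
    ∃ (y1 : Euc n) (s1 : ℝ), (z, y1) ∈ Gam n c U V u v ∧ 0 ≤ s1 ∧ slope' n c z y0 y1 = s1 • f := by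
  by_contra hcon
  push Not at hcon
  obtain ⟨hAc, hAv⟩ := Pot.slopes H h3 h hy0 hz
  set A := slope' n c z y0 '' {y | (z, y) ∈ Gam n c U V u v} with hA
  set R : Set (Euc n) := {x | x = ⟪f, x⟫_ℝ • f ∧ 0 ≤ ⟪f, x⟫_ℝ} with hR
  have hff : ⟪f, f⟫_ℝ = 1 := by rw [real_inner_self_eq_norm_sq, hf]; norm_num
  have hRm : ∀ s : ℝ, 0 ≤ s → s • f ∈ R := by
    intro s hs
    simp only [hR, mem_ofPred_eq, inner_smul_right, hff, mul_one]
    exact ⟨trivial, hs⟩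
  have hRcl : IsClosed R := by
    simp only [hR, ofPred_and]
    exact (isClosed_eq (by fun_prop) (by fun_prop)).inter (isClosed_le (by fun_prop) (by fun_prop))
  have hRcv : Convex ℝ R := by
    rintro a ⟨ha, ha'⟩ b ⟨hb, hb'⟩ s t hs ht hst
    rw [ha, hb, smul_smul, smul_smul, ← add_smul]
    exact hRm _ (by positivity)
  have hdis : Disjoint A R := by
    rw [Set.disjoint_left]
    rintro a ⟨y, hy, rfl⟩ ⟨h1, h2⟩
    exact hcon y ⟪f, slope' n c z y0 y⟫_ℝ hy h2 h1
  obtain ⟨φ, p, p', h1, h2, h3'⟩ := geometric_hahn_banach_compact_closed hAv hAc hRcv hRcl hdis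
  have hp' : p' < 0 := by
    have := h3' _ (hRm 0 le_rfl)
    simpa using this
  have hφf : 0 ≤ φ f := by
    by_contra hc
    push Not at hc
    have := h3' _ (hRm (p' / φ f) (div_nonneg_of_nonpos hp'.le hc.le))
    rw [map_smul, smul_eq_mul, div_mul_cancel₀ _ hc.ne] at this
    exact lt_irrefl _ this
  have hp : p < 0 := h2.trans hp'
  obtain ⟨M, hM⟩ := hAc.isBounded.exists_norm_le
  set M' := max M 0
  have hM' : 0 ≤ M' := le_max_right _ _
  set τ := -p / (M' + 1) with hτ
  have hτ0 : 0 < τ := div_pos (by linarith) (by linarith)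
  have hτM : τ * (M' + 1) = -p := div_mul_cancel₀ _ (by linarith)
  set e := (InnerProductSpace.toDual ℝ (Euc n)).symm φ with he
  have hei : ∀ a, ⟪a, e⟫_ℝ = φ a := by
    intro a
    rw [real_inner_comm, he, InnerProductSpace.toDual_symm_apply]
  obtain ⟨t, ht, x, hxU, hxq, hxw⟩ := Pot.descent H h (e := e + τ • f) hy0 hz (by
    intro y hy
    have hya : slope' n c z y0 y ∈ A := ⟨y, hy, rfl⟩
    have h4 := h1 _ hya
    have h5 : ⟪slope' n c z y0 y, f⟫_ℝ ≤ M' := by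
      refine (real_inner_le_norm _ _).trans ?_
      rw [hf, mul_one]
      exact (hM _ hya).trans (le_max_left _ _)
    rw [inner_add_right, inner_smul_right, hei]
    nlinarith)
  have hxS : x ∈ Sec n c U u y0 k := ⟨subset_closure hxU, hxw.trans hzk.2⟩
  have := hmax x hxS
  rw [hxq, inner_add_right, inner_smul_right, inner_add_right, inner_smul_right, hff, hei] at this
  nlinarith

end nrm
end

end Part16

section Part17
open Set MeasureTheory Metric Bornology
open scoped ENNReal NNReal Pointwise InnerProductSpace

noncomputable section
section lemB
variable {n : ℕ} {c : Euc n → Euc n → ℝ} {U V : Set (Euc n)} {u v : Euc n → ℝ}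

theorem Raw.slope_bd (H : Raw n c U V) {K W : Set (Euc n)} (hK : IsCompact K) (hKU : K ⊆ U)
    (hW : IsCompact W) (hWV : W ⊆ V) : ∃ L : ℝ, 0 < L ∧ ∀ x ∈ K, ∀ y0 ∈ W, ∀ y ∈ closure V,
    ‖slope' n c x y0 y‖ ≤ L := by
  obtain ⟨M, hM, hb⟩ := H.slope_le_p hK hKU hW hWV
  have hc : ContinuousOn (fun z : Euc n × Euc n => qc n (swapC n c) z.2 z.1) (closure V ×ˢ K) :=
    H.swap.contq2.mono (prod_mono subset_rfl hKU)
  obtain ⟨B, hB⟩ := (H.compV.prod hK).exists_bound_of_continuousOn hc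
  refine ⟨M * (2 * (max B 0) + 1), by positivity, fun x hx y0 hy0 y hy => ?_⟩
  have h1 := hb x hx y0 hy0 y y0
  rw [slope_self, sub_zero] at h1
  refine h1.trans (mul_le_mul_of_nonneg_left ?_ hM.le)
  have h2 := hB (y, x) ⟨hy, hx⟩
  have h3 := hB (y0, x) ⟨subset_closure (hWV hy0), hx⟩
  have h4 := norm_sub_le (qc n (swapC n c) x y) (qc n (swapC n c) x y0)
  have h5 := le_max_left B 0
  simp only at h2 h3
  linarith

theorem Raw.mvt_m (H : Raw n c U V) {Q : Set (Euc n)} {y0 y : Euc n} {L : ℝ} (hQU : Q ⊆ U) (hy0 : y0 ∈ V)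
    (hy : y ∈ closure V) (hQ : Convex ℝ (qc n c y0 '' Q)) (hL : ∀ x ∈ Q, ‖slope' n c x y0 y‖ ≤ L)
    {x0 x1 : Euc n} (hx0 : x0 ∈ Q) (hx1 : x1 ∈ Q) :
    (-c x1 y + c x1 y0) - (-c x0 y + c x0 y0) ≤ L * ‖qc n c y0 x1 - qc n c y0 x0‖ := by
  set q := qc n c y0 x0
  set w := qc n c y0 x1 - qc n c y0 x0 with hw
  have hall : ∀ t ∈ Icc (0:ℝ) 1, q + t • w ∈ Uyset n c U y0 ∧ segX n c U y0 q w t ∈ Q := by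
    intro t ht
    have : q + t • w ∈ qc n c y0 '' Q := by
      have := hQ.add_smul_sub_mem (mem_image_of_mem _ hx0) (mem_image_of_mem _ hx1) ht
      exact this
    obtain ⟨x, hx, hxq⟩ := this
    refine ⟨hxq ▸ Raw.qc_mem _ _ (hQU hx), ?_⟩
    show xOf n c U y0 (q + t • w) ∈ Q
    rw [← hxq, xOf_left H hy0 (subset_closure (hQU hx))]
    exact hx
  have hs0 : segX n c U y0 q w 0 = x0 := by
    simp only [segX, zero_smul, add_zero]
    exact xOf_left H hy0 (subset_closure (hQU hx0))
  have hs1 : segX n c U y0 q w 1 = x1 := by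
    have : q + (1:ℝ) • w = qc n c y0 x1 := by simp [q, w]
    simp only [segX, this]
    exact xOf_left H hy0 (subset_closure (hQU hx1))
  obtain ⟨s, hs, hs'⟩ := exists_hasDerivAt_eq_slope
    (fun t => -c (segX n c U y0 q w t) y + c (segX n c U y0 q w t) y0)
    (fun t => ⟪slope' n c (segX n c U y0 q w t) y0 y, w⟫_ℝ) (zero_lt_one' ℝ)
    (fun t ht => (H.slope_deriv hy0 hy (hall t ht).1).continuousAt.continuousWithinAt)
    (fun t ht => H.slope_deriv hy0 hy (hall t ⟨ht.1.le, ht.2.le⟩).1)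
  simp only [hs0, hs1, sub_zero, div_one] at hs'
  rw [← hs']
  refine (real_inner_le_norm _ _).trans ?_
  exact mul_le_mul_of_nonneg_right (hL _ (hall s ⟨hs.1.le, hs.2.le⟩).2) (norm_nonneg _)

theorem Pot.width (H : Raw n c U V) (h3 : MTW n c U V) (h : Pot n c U V u v) {y0 : Euc n} (hy0 : y0 ∈ V)
    {k L : ℝ} (hSU : Sec n c U u y0 k ⊆ U)
    (hL : ∀ x ∈ Sec n c U u y0 k, ∀ y ∈ closure V, ‖slope' n c x y0 y‖ ≤ L)
    {x0 f : Euc n} {h0 ω : ℝ} (hx0 : x0 ∈ Sec n c U u y0 k) (hh : h0 = k - (u x0 + c x0 y0)) (hL0 : 0 ≤ L)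
    (hf : ‖f‖ = 1) (hω : ∀ x ∈ Sec n c U u y0 k, ⟪f, qc n c y0 x - qc n c y0 x0⟫_ℝ ≤ ω) :
    h0 ≤ L * ω := by
  have hff : ⟪f, f⟫_ℝ = 1 := by rw [real_inner_self_eq_norm_sq, hf]; norm_num
  have hSc := Pot.sec_compact H h (subset_closure hy0) k
  have hqS : IsCompact (qc n c y0 '' Sec n c U u y0 k) :=
    hSc.image_of_continuousOn ((H.contq hy0).mono (fun x hx => hx.1))
  set I : Set ℝ := Icc 0 ω ∩ (fun t : ℝ => qc n c y0 x0 + t • f) ⁻¹' (qc n c y0 '' Sec n c U u y0 k) with hI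
  have hIc : IsCompact I := isCompact_Icc.inter_right (hqS.isClosed.preimage (by fun_prop))
  have hω0 : 0 ≤ ω := by simpa using hω x0 hx0
  have hI0 : (0:ℝ) ∈ I := ⟨⟨le_rfl, hω0⟩, by simpa using mem_image_of_mem _ hx0⟩
  obtain ⟨t, htI, htm⟩ := hIc.exists_isMaxOn ⟨0, hI0⟩ (continuousOn_id)
  obtain ⟨ht, z, hzS, hzq⟩ := htI
  simp only at hzq
  have hzk : u z + c z y0 = k := by
    by_contra hne
    have hlt : u z + c z y0 < k := lt_of_le_of_ne hzS.2 hne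
    obtain ⟨r, hr, hb⟩ := Pot.push H h hy0 (hSU hzS) hlt
    obtain ⟨x, hxU, hxS, hxq⟩ := hb (qc n c y0 z + (r/2) • f) (by
      rw [add_sub_cancel_left, norm_smul, hf, mul_one, Real.norm_eq_abs, abs_of_pos (by linarith)]; linarith)
    rw [hzq, add_assoc, ← add_smul] at hxq
    have hb1 := hω x hxS
    rw [hxq, add_sub_cancel_left, inner_smul_right, hff, mul_one] at hb1
    have hmem : t + r/2 ∈ I := ⟨⟨by linarith [ht.1], hb1⟩, x, hxS, hxq⟩
    have := isMaxOn_iff.1 htm _ hmem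
    simp only [id] at this
    linarith
  obtain ⟨y, hyV, hy⟩ := h.exY z hzS.1
  have hcon := h.contact (y := y) ⟨hzS.1, hyV, hy⟩ hx0.1 y0
  have hm := H.mvt_m hSU hy0 hyV (Pot.sec_convex H h3 h hy0 k) (fun x hx => hL x hx y hyV) hx0 hzS
  rw [hzq, add_sub_cancel_left, norm_smul, hf, mul_one, Real.norm_eq_abs, abs_of_nonneg ht.1] at hm
  have : L * t ≤ L * ω := mul_le_mul_of_nonneg_left ht.2 hL0
  linarith

theorem Pot.G_sub (H : Raw n c U V) (h3 : MTW n c U V) (h : Pot n c U V u v) {y0 y : Euc n}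
    (hy : y ∈ V) {k : ℝ} {x0 : Euc n} {h0 : ℝ} (hx0 : x0 ∈ Sec n c U u y0 k)
    (hy0 : y0 ∈ closure V)
    (hh : h0 = k - (u x0 + c x0 y0)) (hpos : 0 < h0)
    (hG : ∀ x ∈ Sec n c U u y0 k, (-c x y + c x y0) - (-c x0 y + c x0 y0) ≤ h0 / 2) :
    y ∈ GI n c U V u v (Sec n c U u y0 k) := by
  obtain ⟨xs, hxs, hxe⟩ := h.exX y (subset_closure hy)
  have hxG : (xs, y) ∈ Gam n c U V u v := ⟨hxs, subset_closure hy, hxe⟩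
  by_cases hin : u xs + c xs y0 ≤ k
  · exact ⟨xs, ⟨hxs, hin⟩, hxG⟩
  push Not at hin
  set q := qc n c y x0
  set w := qc n c y xs - qc n c y x0 with hw
  have hmem : ∀ t ∈ Icc (0:ℝ) 1, q + t • w ∈ clUy n c U y := by
    intro t ht
    exact (H.clUy_convex hy).add_smul_sub_mem (Raw.qc_mem_cl _ _ hx0.1) (Raw.qc_mem_cl _ _ hxs) ht
  obtain ⟨A, hA⟩ := H.lipX hy
  have hcX : ContinuousOn (fun t : ℝ => xOf n c U y (q + t • w)) (Icc 0 1) :=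
    hA.continuousOn.comp (by fun_prop) hmem
  have hcw : ContinuousOn (fun t : ℝ => u (xOf n c U y (q + t • w)) + c (xOf n c U y (q + t • w)) y0) (Icc 0 1) :=
    ContinuousOn.comp (f := fun t : ℝ => xOf n c U y (q + t • w)) (Pot.cont_w H h hy0) hcX
      (fun t ht => (xOf_mem (hmem t ht)).1)
  have hs0 : xOf n c U y (q + (0:ℝ) • w) = x0 := by
    rw [zero_smul, add_zero]; exact xOf_left H hy hx0.1
  have hs1 : xOf n c U y (q + (1:ℝ) • w) = xs := by
    have : q + (1:ℝ) • w = qc n c y xs := by simp [q, w]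
    rw [this]; exact xOf_left H hy hxs
  obtain ⟨t, ht, hte⟩ := intermediate_value_Icc (zero_le_one' ℝ) hcw (show k ∈ Icc _ _ by
    simp only [hs0, hs1]; exact ⟨hx0.2, hin.le⟩)
  simp only at hte
  obtain ⟨hzU, hzq⟩ := xOf_mem (hmem t ht)
  set z := xOf n c U y (q + t • w)
  obtain ⟨y', hyV', hy'⟩ := h.exY z hzU
  have hzG : (z, y') ∈ Gam n c U V u v := ⟨hzU, hyV', hy'⟩
  have h1 := h.contact hzG hx0.1 y0
  have h2 := hG z ⟨hzU, hte.le⟩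
  have h4 := h.contact hzG hxs y0
  have h5 := h.contact hxG hzU y0
  have h6 := H.I1 h3 hx0.1 hxs hy hyV' ht hzU hzq
  refine ⟨z, ⟨hzU, hte.le⟩, hzU, subset_closure hy, ?_⟩
  have h7 := h.ineq z hzU y (subset_closure hy)
  rcases le_max_iff.1 h6 with h8 | h8
  · linarith
  · show u z + v y + c z y = 0
    linarith

set_option maxHeartbeats 1000000 in
theorem Pot.lemB (H : Raw n c U V) (h3 : MTW n c U V) (h : Pot n c U V u v) {K : Set (Euc n)}
    (hK : IsCompact K) (hKU : K ⊆ U) {yb : Euc n} {r1 : ℝ} (hr1 : 0 < r1) (hWV : closedBall yb (2 * r1) ⊆ V)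
    {η κ0 : ℝ} (hη : 0 < η) (hκ0 : 0 < κ0) : ∃ κ : ℝ, 0 < κ ∧ κ ≤ κ0 ∧
    ∀ y0 ∈ closedBall yb r1, ∀ k : ℝ, Sec n c U u y0 k ⊆ K → ∀ x0 ∈ Sec n c U u y0 k, ∀ h0 : ℝ,
    h0 = k - (u x0 + c x0 y0) → 0 < h0 → ∀ f : Euc n, ‖f‖ = 1 → ∀ ω : ℝ,
    (∀ x ∈ Sec n c U u y0 k, ⟪f, qc n c y0 x - qc n c y0 x0⟫_ℝ ≤ ω) →
    0 < ω ∧ ∃ y ∈ closedBall yb (2 * r1),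
      (∀ x ∈ Sec n c U u y0 k, (-c x y + c x y0) - (-c x0 y + c x0 y0) ≤ h0 / 2) ∧
      ∃ g : Euc n, ‖g‖ ≤ η ∧ slope' n c x0 y0 y = (κ * h0 / ω) • (f + g) := by
  set W := closedBall yb (2 * r1) with hWd
  have hW : IsCompact W := isCompact_closedBall _ _
  have hWc : Convex ℝ W := convex_closedBall _ _
  obtain ⟨L, hL, hLb⟩ := H.slope_bd hK hKU hW hWV
  obtain ⟨δ, hδ, hδb⟩ := H.slope_small hK hKU hW hWV hr1
  obtain ⟨C, hC, hCb⟩ := H.I2 h3 hK hKU hW hWV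
  obtain ⟨M1, hM1, hM1b⟩ := H.slope_antilip hK hKU hW hWV
  obtain ⟨M2, hM2, hM2b⟩ := H.slope_quad hK hKU hW hWV hWc
  obtain ⟨κ, hκ, hk0, hk1, hk2, hk3⟩ : ∃ κ : ℝ, 0 < κ ∧ κ ≤ κ0 ∧ κ * (2 * C) ≤ 1 ∧ κ * L ≤ δ ∧
      κ * (2 * M2 * M1 ^ 2 * L) ≤ η := by
    refine ⟨min (min κ0 (1 / (2 * C))) (min (δ / L) (η / (2 * M2 * M1 ^ 2 * L))), by positivity, ?_, ?_, ?_, ?_⟩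
    · exact (min_le_left _ _).trans (min_le_left _ _)
    · rw [← le_div_iff₀ (by positivity)]
      exact (min_le_left _ _).trans (min_le_right _ _)
    · rw [← le_div_iff₀ (by positivity)]
      exact (min_le_right _ _).trans (min_le_left _ _)
    · rw [← le_div_iff₀ (by positivity)]
      exact (min_le_right _ _).trans (min_le_right _ _)
  refine ⟨κ, hκ, hk0, ?_⟩
  intro y0 hy0 k hSK x0 hx0 h0 hh hh0 f hf ω hω
  have hff : ⟪f, f⟫_ℝ = 1 := by rw [real_inner_self_eq_norm_sq, hf]; norm_num
  have hy0W : y0 ∈ W := closedBall_subset_closedBall (by linarith) hy0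
  have hy0V := hWV hy0W
  have hSU := hSK.trans hKU
  have hwid := Pot.width H h3 h hy0V hSU (fun x hx y hy => hLb x (hSK hx) y0 hy0W y hy) hx0 hh hL.le hf hω
  have hωpos : 0 < ω := by
    by_contra hc
    push Not at hc
    nlinarith
  refine ⟨hωpos, ?_⟩
  set σ := κ * h0 / ω with hσ
  have hσpos : 0 < σ := by positivity
  have hσω : σ * ω = κ * h0 := div_mul_cancel₀ _ hωpos.ne'
  have hσL : σ ≤ κ * L := by
    rw [hσ, div_le_iff₀ hωpos, mul_assoc]
    exact mul_le_mul_of_nonneg_left hwid hκ.le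
  have hinW : ∀ y ∈ closure V, ∀ x ∈ K, ‖slope' n c x y0 y‖ ≤ δ → y ∈ W := by
    intro y hy x hx hs
    have h1 := hδb x hx y0 hy0W y hy hs
    rw [hWd, mem_closedBall]
    rw [mem_closedBall] at hy0
    have h2 := dist_triangle y y0 yb
    rw [dist_eq_norm y y0] at h2
    linarith
  obtain ⟨z, hzS, hzm⟩ := (Pot.sec_compact H h (subset_closure hy0V) k).exists_isMaxOn ⟨x0, hx0⟩
    (f := fun x => ⟪f, qc n c y0 x⟫_ℝ)
    (continuousOn_const.inner ((H.contq hy0V).mono (fun x hx => hx.1)))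
  have hzm' : ∀ x ∈ Sec n c U u y0 k, ⟪f, qc n c y0 x⟫_ℝ ≤ ⟪f, qc n c y0 z⟫_ℝ :=
    fun x hx => isMaxOn_iff.1 hzm x hx
  have hzU := hSU hzS
  have hzK := hSK hzS
  have hx0K := hSK hx0
  have hzk : u z + c z y0 = k := by
    by_contra hne
    have hlt : u z + c z y0 < k := lt_of_le_of_ne hzS.2 hne
    obtain ⟨r, hr, hb⟩ := Pot.push H h hy0V hzU hlt
    obtain ⟨x, hxU, hxS, hxq⟩ := hb (qc n c y0 z + (r/2) • f) (by
      rw [add_sub_cancel_left, norm_smul, hf, mul_one, Real.norm_eq_abs, abs_of_pos (by linarith)]; linarith)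
    have := hzm' x hxS
    rw [hxq, inner_add_right, inner_smul_right, hff] at this
    linarith
  obtain ⟨y1, s1, hy1G, hs1, hsl⟩ := Pot.normal H h3 h hy0V hzU hzS hf hzm'
  have hy1V : y1 ∈ closure V := hy1G.2.1
  have hcon := h.contact hy1G hx0.1 y0
  set ωz := ⟪f, qc n c y0 z⟫_ℝ - ⟪f, qc n c y0 x0⟫_ℝ with hωz
  have hωz0 : 0 ≤ ωz := sub_nonneg.2 (hzm' x0 hx0)
  have hωz1 : ωz ≤ ω := by have := hω z hzS; rw [inner_sub_right] at this; exact this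
  have hdin : ∀ s : ℝ, ⟪s • f, qc n c y0 x0 - qc n c y0 z⟫_ℝ = -(s * ωz) := by
    intro s; rw [real_inner_smul_left, inner_sub_right, hωz]; ring
  have hσs : σ ≤ s1 := by
    by_cases hs : s1 ≤ δ
    · have hy1W : y1 ∈ W := hinW y1 hy1V z hzK (by
        rw [hsl, norm_smul, hf, mul_one, Real.norm_eq_abs, abs_of_nonneg hs1]; exact hs)
      have := (hCb y0 hy0W y1 hy1W z hzK x0 hx0K _ _ rfl rfl).2 (by
        rw [hsl, hdin]; nlinarith)
      rw [hsl, hdin] at this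
      have h4 : h0 ≤ C * (s1 * ωz) := by linarith
      have h5 : s1 * ωz ≤ s1 * ω := mul_le_mul_of_nonneg_left hωz1 hs1
      rw [hσ, div_le_iff₀ hωpos]
      have h6 : h0 ≤ C * (s1 * ω) := h4.trans (mul_le_mul_of_nonneg_left h5 hC.le)
      have h7 : κ * h0 ≤ κ * (C * (s1 * ω)) := mul_le_mul_of_nonneg_left h6 hκ.le
      have h8 : (κ * C) * (s1 * ω) ≤ 1 * (s1 * ω) :=
        mul_le_mul_of_nonneg_right (by linarith [mul_pos hκ hC]) (by positivity)
      linarith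
    · push Not at hs; linarith
  have hs1pos : 0 < s1 := lt_of_lt_of_le hσpos hσs
  have ht : σ / s1 ∈ Icc (0:ℝ) 1 := ⟨by positivity, (div_le_one hs1pos).2 hσs⟩
  have hmem := (H.swap.clUy_convex hzU).add_smul_sub_mem
    (Raw.qc_mem_cl y0 z (subset_closure hy0V)) (Raw.qc_mem_cl y1 z hy1V) ht
  obtain ⟨hyfV, hyfq⟩ := xOf_mem hmem
  set yf := xOf n (swapC n c) V z (qc n (swapC n c) z y0 +
    (σ / s1) • (qc n (swapC n c) z y1 - qc n (swapC n c) z y0)) with hyf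
  have hslf : slope' n c z y0 yf = σ • f := by
    rw [slope_affine hyfq, slope_self, sub_zero, zero_add, hsl, smul_smul, div_mul_cancel₀ _ hs1pos.ne']
  have hnσ : ‖σ • f‖ = σ := by rw [norm_smul, hf, mul_one, Real.norm_eq_abs, abs_of_pos hσpos]
  have hyfW : yf ∈ W := hinW yf hyfV z hzK (by rw [hslf, hnσ]; linarith)
  refine ⟨yf, hyfW, ?_, σ⁻¹ • slope' n c x0 y0 yf - f, ?_, ?_⟩
  · intro x hx
    have h4 := H.swap.I1 (MTW.swap H h3) (subset_closure hy0V) hy1V hzU hx.1 ht hyfV hyfq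
    simp only [swapC] at h4
    have h5 := h.contact hy1G hx.1 y0
    have h6 := hx.2
    have h8 := (hCb y0 hy0W yf hyfW z hzK x0 hx0K _ _ rfl rfl).2 (by
        rw [hslf, hdin]; nlinarith)
    rw [hslf, hdin] at h8
    have h9 : C * (σ * ωz) ≤ h0 / 2 := by
      have : σ * ωz ≤ κ * h0 := by
        rw [← hσω]; exact mul_le_mul_of_nonneg_left hωz1 hσpos.le
      have h10 := mul_le_mul_of_nonneg_left this hC.le
      have h11 := mul_le_mul_of_nonneg_right hk1 hh0.le
      linarith
    rcases le_max_iff.1 h4 with h7 | h7 <;> linarith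
  · have h4 := hM1b z hzK y0 hy0V yf hyfW y0 hy0W
    rw [slope_self, sub_zero, hslf, hnσ] at h4
    have h5 := hM2b z hzK y0 hy0W yf hyfW
    have h6 := hM2b x0 hx0K y0 hy0W yf hyfW
    rw [hslf] at h5
    have h7 : ‖yf - y0‖ ^ 2 ≤ (M1 * σ) ^ 2 := pow_le_pow_left₀ (norm_nonneg _) h4 2
    have h8 : ‖slope' n c x0 y0 yf - σ • f‖ ≤ 2 * M2 * (M1 * σ) ^ 2 := by
      have := norm_sub_le (slope' n c x0 y0 yf - (yf - y0)) (σ • f - (yf - y0))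
      rw [sub_sub_sub_cancel_right] at this
      nlinarith
    have h9 : σ⁻¹ • slope' n c x0 y0 yf - f = σ⁻¹ • (slope' n c x0 y0 yf - σ • f) := by
      rw [smul_sub, smul_smul, inv_mul_cancel₀ hσpos.ne', one_smul]
    rw [h9, norm_smul, norm_inv, Real.norm_eq_abs, abs_of_pos hσpos]
    have h10 : σ⁻¹ * (2 * M2 * (M1 * σ) ^ 2) = 2 * M2 * M1 ^ 2 * σ := by field_simp
    calc σ⁻¹ * ‖slope' n c x0 y0 yf - σ • f‖ ≤ σ⁻¹ * (2 * M2 * (M1 * σ) ^ 2) :=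
          mul_le_mul_of_nonneg_left h8 (by positivity)
      _ = 2 * M2 * M1 ^ 2 * σ := h10
      _ ≤ 2 * M2 * M1 ^ 2 * (κ * L) := mul_le_mul_of_nonneg_left hσL (by positivity)
      _ ≤ η := by linarith
  · rw [add_sub_cancel, smul_smul, mul_inv_cancel₀ hσpos.ne', one_smul]

end lemB
end

end Part17

section Part18
open Set MeasureTheory Metric Bornology
open scoped ENNReal NNReal Pointwise InnerProductSpace

noncomputable section
section simplexgeo
variable {n : ℕ}

/-- The standard corner simplex. -/
def Dl (n : ℕ) : Set (Euc n) := {a | (∀ i, 0 ≤ a i) ∧ ∑ i, a i ≤ 1}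

theorem Dl_pos : 0 < volume (Dl n) := by
  set b : ℝ := 1 / (2 * ((n:ℝ) + 1)) with hb
  have hbp : 0 < b := by positivity
  set a0 : Euc n := WithLp.toLp 2 (fun _ => b) with ha0
  refine lt_of_lt_of_le (measure_ball_pos volume a0 hbp) (measure_mono ?_)
  intro a ha
  have hc : ∀ i, |a i - b| < b := by
    intro i
    have h1 := coord_le (a - a0) i
    rw [mem_ball, dist_eq_norm] at ha
    have h2 : (a - a0) i = a i - b := by simp [ha0]
    rw [h2] at h1
    linarith
  refine ⟨fun i => ?_, ?_⟩
  · have := abs_lt.1 (hc i); linarith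
  · have h1 : ∑ i, a i ≤ ∑ _i : Fin n, 2 * b := Finset.sum_le_sum (fun i _ => by
      have := abs_lt.1 (hc i); linarith)
    rw [Finset.sum_const, Finset.card_univ, Fintype.card_fin, nsmul_eq_mul] at h1
    refine h1.trans ?_
    rw [hb]
    have : (n:ℝ) * (2 * (1 / (2 * ((n:ℝ) + 1)))) = n / (n + 1) := by field_simp
    rw [this, div_le_one (by positivity)]
    linarith

theorem Dl_lt_top : volume (Dl n) < ⊤ := by
  refine lt_of_le_of_lt (measure_mono (t := closedBall 0 ((n:ℝ) * 1)) ?_) measure_closedBall_lt_top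
  intro a ha
  rw [mem_closedBall, dist_zero_right]
  refine norm_le_of_coord (fun i => ?_)
  rw [abs_of_nonneg (ha.1 i)]
  exact (Finset.single_le_sum (f := fun i => a i) (fun j _ => ha.1 j) (Finset.mem_univ i)).trans ha.2

theorem simplex_sub {A : Set (Euc n)} (hA : Convex ℝ A) (h0 : (0 : Euc n) ∈ A) {p : Fin n → Euc n}
    (hp : ∀ i, p i ∈ A) : lmv n p '' Dl n ⊆ A := by
  rintro _ ⟨a, ha, rfl⟩
  rw [lmv_apply]
  have := hA.sum_mem (t := Finset.univ) (w := fun o : Option (Fin n) => o.elim (1 - ∑ i, a i) (fun i => a i))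
    (z := fun o : Option (Fin n) => o.elim 0 p) (by
      rintro (_ | i) _
      · simpa using ha.2
      · exact ha.1 i) (by simp [Fintype.sum_option]) (by
      rintro (_ | i) _
      · exact h0
      · exact hp i)
  simpa [Fintype.sum_option] using this

theorem vol_lin (T : Euc n →ₗ[ℝ] Euc n) (s : Set (Euc n)) :
    volume (T '' s) = ENNReal.ofReal |LinearMap.det T| * volume s :=
  Measure.addHaar_image_linearMap _ _ _

theorem det_pert {c0 : ℝ} (hc0 : 0 < c0) : ∃ η : ℝ, 0 < η ∧ η ≤ 1 ∧ ∀ F G : Fin n → Euc n,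
    (∀ i, ‖F i‖ ≤ 1) → (∀ i, ‖G i‖ ≤ η) → c0 ≤ |detv n F| → c0 / 2 ≤ |detv n (fun i => F i + G i)| := by
  have hK : IsCompact (closedBall (0 : Fin n → Euc n) 2) := isCompact_closedBall _ _
  have hu := hK.uniformContinuousOn_of_continuous (detv_cont (n := n)).continuousOn
  obtain ⟨δ, hδ, hb⟩ := Metric.uniformContinuousOn_iff.1 hu (c0/2) (by linarith)
  refine ⟨min 1 (δ/2), by positivity, min_le_left _ _, fun F G hF hG hc => ?_⟩
  have hG1 : ∀ i, ‖G i‖ ≤ 1 := fun i => (hG i).trans (min_le_left _ _)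
  have hG2 : ∀ i, ‖G i‖ ≤ δ/2 := fun i => (hG i).trans (min_le_right _ _)
  have h1 : F ∈ closedBall (0 : Fin n → Euc n) 2 := by
    rw [mem_closedBall, dist_zero_right, pi_norm_le_iff_of_nonneg (by norm_num)]
    intro i; linarith [hF i]
  have h2 : (fun i => F i + G i) ∈ closedBall (0 : Fin n → Euc n) 2 := by
    rw [mem_closedBall, dist_zero_right, pi_norm_le_iff_of_nonneg (by norm_num)]
    intro i; linarith [hF i, hG1 i, norm_add_le (F i) (G i)]
  have h3 := hb F h1 _ h2 (by
    rw [dist_eq_norm]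
    refine lt_of_le_of_lt (b := δ/2) ?_ (by linarith)
    rw [pi_norm_le_iff_of_nonneg (by linarith)]
    intro i
    simp only [Pi.sub_apply, sub_add_cancel_left, norm_neg]
    exact hG2 i)
  rw [Real.dist_eq] at h3
  have h4 := abs_sub_abs_le_abs_sub (detv n F) (detv n (fun i => F i + G i))
  linarith

end simplexgeo
end

end Part18

section Part19
open Set MeasureTheory Metric Bornology
open scoped ENNReal NNReal Pointwise InnerProductSpace

noncomputable section
section lemBf
variable {n : ℕ} {c : Euc n → Euc n → ℝ} {U V O : Set (Euc n)} {u v : Euc n → ℝ} {lam Lam : ℝ}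

theorem Raw.vol_sec (H : Raw n c U V) {X : Set (Euc n)} {y0 zc : Euc n} {A Cn : ℝ}
    {T : Euc n →ₗ[ℝ] Euc n} (hX : X ⊆ closure U) (hy0 : y0 ∈ V) (hA : 0 ≤ A)
    (hal : ∀ x ∈ X, ∀ x' ∈ X, ‖x - x'‖ ≤ A * ‖qc n c y0 x - qc n c y0 x'‖)
    (hT : ∀ x ∈ X, ∃ a, ‖a‖ ≤ Cn ∧ qc n c y0 x = zc + T a) :
    volume X ≤ ENNReal.ofReal (A ^ n) * (ENNReal.ofReal |LinearMap.det T| * volume (closedBall (0 : Euc n) Cn)) := by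
  have h1 : X = xOf n c U y0 '' (qc n c y0 '' X) := by
    rw [image_image]
    ext x
    constructor
    · exact fun hx => ⟨x, hx, xOf_left H hy0 (hX hx)⟩
    · rintro ⟨x', hx', rfl⟩
      show xOf n c U y0 (qc n c y0 x') ∈ X
      rw [xOf_left H hy0 (hX hx')]; exact hx'
  have h2 : volume X ≤ ENNReal.ofReal (A ^ n) * volume (qc n c y0 '' X) := by
    conv_lhs => rw [h1]
    refine vol_lip' hA ?_
    rintro _ ⟨x, hx, rfl⟩ _ ⟨x', hx', rfl⟩
    rw [xOf_left H hy0 (hX hx), xOf_left H hy0 (hX hx')]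
    exact hal x hx x' hx'
  refine h2.trans (mul_le_mul_right ?_ _)
  rw [← vol_lin]
  have h3 : qc n c y0 '' X ⊆ zc +ᵥ (T '' closedBall (0 : Euc n) Cn) := by
    rintro _ ⟨x, hx, rfl⟩
    obtain ⟨a, ha, hq⟩ := hT x hx
    rw [hq]
    exact ⟨T a, ⟨a, by simpa using ha, rfl⟩, rfl⟩
  refine (measure_mono h3).trans ?_
  rw [measure_vadd]

theorem Raw.G_convex (H : Raw n c U V) (h3 : MTW n c U V) {X : Set (Euc n)} {x0 y0 : Euc n} {b : ℝ}
    (hX : X ⊆ closure U) (hx0 : x0 ∈ U) :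
    Convex ℝ (slope' n c x0 y0 '' {y | y ∈ closure V ∧
      ∀ x ∈ X, (-c x y + c x y0) - (-c x0 y + c x0 y0) ≤ b}) := by
  rintro _ ⟨y1, ⟨hy1, hy1'⟩, rfl⟩ _ ⟨y2, ⟨hy2, hy2'⟩, rfl⟩ s t hs ht hst
  have htI : t ∈ Icc (0:ℝ) 1 := ⟨ht, by linarith⟩
  have hmem := (H.swap.clUy_convex hx0).add_smul_sub_mem
    (Raw.qc_mem_cl y1 x0 hy1) (Raw.qc_mem_cl y2 x0 hy2) htI
  obtain ⟨hyV, hyq⟩ := xOf_mem hmem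
  refine ⟨_, ⟨hyV, ?_⟩, ?_⟩
  · intro x hx
    have h4 := H.swap.I1 (MTW.swap H h3) hy1 hy2 hx0 (hX hx) htI hyV hyq
    simp only [swapC] at h4
    have h5 := hy1' x hx
    have h6 := hy2' x hx
    rcases le_max_iff.1 h4 with h7 | h7 <;> linarith
  · rw [slope_affine hyq]
    have : s = 1 - t := by linarith
    rw [this]; module

theorem pick_axis (f : OrthonormalBasis (Fin n) ℝ (Euc n)) {ν d : Euc n} {τ : ℝ} (hτ : 0 < τ)
    (h : ⟪ν, d⟫_ℝ ≤ -τ) : ∃ i, τ ≤ n * (|⟪f i, ν⟫_ℝ| * |⟪f i, d⟫_ℝ|) := by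
  by_contra hc
  push Not at hc
  have h1 := f.sum_inner_mul_inner ν d
  have h2 : τ ≤ ∑ i, |⟪f i, ν⟫_ℝ| * |⟪f i, d⟫_ℝ| := by
    calc τ ≤ |⟪ν, d⟫_ℝ| := by rw [abs_of_nonpos (by linarith)]; linarith
      _ = |∑ i, ⟪ν, f i⟫_ℝ * ⟪f i, d⟫_ℝ| := by rw [h1]
      _ ≤ ∑ i, |⟪ν, f i⟫_ℝ * ⟪f i, d⟫_ℝ| := Finset.abs_sum_le_sum_abs _ _
      _ = _ := by
        refine Finset.sum_congr rfl (fun i _ => ?_)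
        rw [abs_mul, real_inner_comm]
  have hn : n ≠ 0 := by
    rintro rfl
    simp at h2; linarith
  have hn' : (0:ℝ) < n := by positivity
  have h4 : ∀ i ∈ Finset.univ, |⟪f i, ν⟫_ℝ| * |⟪f i, d⟫_ℝ| < τ / n := by
    intro i _
    rw [lt_div_iff₀ hn']
    linarith [hc i]
  have h5 := Finset.sum_lt_sum_of_nonempty (s := (Finset.univ : Finset (Fin n)))
    ⟨⟨0, Nat.pos_of_ne_zero hn⟩, Finset.mem_univ _⟩ h4
  rw [Finset.sum_const, Finset.card_univ, Fintype.card_fin, nsmul_eq_mul, mul_div_cancel₀ _ hn'.ne'] at h5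
  linarith

theorem Raw.q_diam (H : Raw n c U V) {K W : Set (Euc n)} (hK : IsCompact K) (hKU : K ⊆ U)
    (hW : IsCompact W) (hWV : W ⊆ V) : ∃ D : ℝ, 0 < D ∧ ∀ y ∈ W, ∀ x ∈ K, ∀ x' ∈ K,
    ‖qc n c y x - qc n c y x'‖ ≤ D := by
  have hc : ContinuousOn (fun z : Euc n × Euc n => qc n c z.2 z.1) (K ×ˢ W) :=
    H.contq2.mono (prod_mono (hKU.trans subset_closure) hWV)
  obtain ⟨B, hB⟩ := (hK.prod hW).exists_bound_of_continuousOn hc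
  refine ⟨2 * (max B 0) + 1, by positivity, fun y hy x hx x' hx' => ?_⟩
  have h2 := hB (x, y) ⟨hx, hy⟩
  have h3 := hB (x', y) ⟨hx', hy⟩
  have h4 := norm_sub_le (qc n c y x) (qc n c y x')
  have h5 := le_max_left B 0
  simp only at h2 h3
  linarith

set_option maxHeartbeats 2000000 in
theorem Sol.lemBf (S : Sol n c U V O u v lam Lam) {K : Set (Euc n)}
    (hK : IsCompact K) (hKU : K ⊆ U) {yb : Euc n} {r1 : ℝ} (hr1 : 0 < r1) (hWV : closedBall yb (2 * r1) ⊆ V)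
    {τ Cn : ℝ} (hτ : 0 < τ) (hCn : 0 < Cn) : ∃ CB : ℝ, 0 < CB ∧
    ∀ y0 ∈ closedBall yb r1, ∀ k : ℝ, Sec n c U u y0 k ⊆ K → ∀ x0 ∈ Sec n c U u y0 k, ∀ h0 : ℝ,
    h0 = k - (u x0 + c x0 y0) → 0 < h0 → ∀ x ∈ Sec n c U u y0 k, ∀ ν : Euc n, ‖ν‖ = 1 →
    ⟪ν, qc n c y0 x - qc n c y0 x0⟫_ℝ ≤ -τ → ∀ ρ : ℝ,
    (∀ x' ∈ Sec n c U u y0 k, ⟪ν, qc n c y0 x' - qc n c y0 x0⟫_ℝ ≤ ρ) →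
    ∀ (zc : Euc n) (T : Euc n →ₗ[ℝ] Euc n),
    (∀ x' ∈ Sec n c U u y0 k, ∃ a, ‖a‖ ≤ Cn ∧ qc n c y0 x' = zc + T a) →
    h0 ^ n ≤ CB * ρ * |LinearMap.det T| ^ 2 := by
  obtain ⟨H, h3, h⟩ : Raw n c U V ∧ MTW n c U V ∧ Pot n c U V u v := ⟨S.raw, S.mtw, S.pot⟩
  set W := closedBall yb (2 * r1) with hWd
  have hW : IsCompact W := isCompact_closedBall _ _
  have hWc : Convex ℝ W := convex_closedBall _ _
  obtain ⟨L, hL, hLb⟩ := H.slope_bd hK hKU hW hWV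
  obtain ⟨δ, hδ, hδb⟩ := H.slope_small hK hKU hW hWV hr1
  obtain ⟨D, hD, hDb⟩ := H.q_diam hK hKU hW hWV
  obtain ⟨A, hA, hAb⟩ := H.antilipU hK hKU hW hWV
  obtain ⟨M, hM, hMb⟩ := H.slope_lip hK hKU hW hWV hWc
  have hc0 : 0 < τ / ((n + 1) * D) := by positivity
  set c0 := τ / ((n + 1) * D) with hc0d
  obtain ⟨η, hη, hη1, hηb⟩ := det_pert (n := n) hc0
  obtain ⟨κ, hκ, hκ1, hκb⟩ := Pot.lemB H h3 h hK hKU hr1 hWV hη (κ0 := δ / (2 * L)) (by positivity)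
  have hκL : 2 * (κ * L) ≤ δ := by
    rw [le_div_iff₀ (by positivity)] at hκ1
    linarith
  set V0 := (volume (Dl n)).toReal with hV0
  set VB := (volume (closedBall (0 : Euc n) Cn)).toReal with hVB
  have hV0p : 0 < V0 := ENNReal.toReal_pos Dl_pos.ne' Dl_lt_top.ne
  have hVBp : 0 < VB := ENNReal.toReal_pos (measure_closedBall_pos volume _ hCn).ne'
    measure_closedBall_lt_top.ne
  have hLam := S.Lampos
  set E1 := M ^ n * (Lam * (A ^ n * VB)) with hE1
  set E2 := (2 * Cn) ^ n * ((n + 1) / τ) with hE2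
  set E3 := κ ^ n * (c0 / 2) * V0 with hE3
  have hE1p : 0 < E1 := by positivity
  have hE2p : 0 < E2 := by positivity
  have hE3p : 0 < E3 := by positivity
  refine ⟨E1 * E2 / E3, by positivity, ?_⟩
  intro y0 hy0 k hSK x0 hx0 h0 hh hh0 x hx ν hν hνx ρ hρ zc T hT
  have hy0W : y0 ∈ W := closedBall_subset_closedBall (by linarith) hy0
  have hy0V := hWV hy0W
  have hSU := hSK.trans hKU
  have hx0K := hSK hx0
  obtain ⟨f, r, hr, hrp, hfr⟩ := axes T
  set d := qc n c y0 x - qc n c y0 x0 with hd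
  obtain ⟨i, hi⟩ := pick_axis f hτ hνx
  have hω : ∀ j, ∀ x' ∈ Sec n c U u y0 k, |⟪f j, qc n c y0 x' - qc n c y0 x0⟫_ℝ| ≤ 2 * Cn * r j := by
    intro j x' hx'
    obtain ⟨a, ha, hqa⟩ := hT x' hx'
    obtain ⟨b, hb, hqb⟩ := hT x0 hx0
    have h1 : qc n c y0 x' - qc n c y0 x0 = T (a - b) := by
      rw [hqa, hqb, map_sub]; abel
    rw [h1]
    refine (hfr j (a - b)).trans ?_
    have h2 : ‖a - b‖ ≤ 2 * Cn := by linarith [norm_sub_le a b]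
    linarith [mul_le_mul_of_nonneg_left h2 (hr j)]
  have hfn : ∀ j, ‖f j‖ = 1 := fun j => f.orthonormal.1 j
  have hnn : (0:ℝ) ≤ n := Nat.cast_nonneg n
  have hfd : |⟪f i, d⟫_ℝ| ≤ D := by
    refine (abs_real_inner_le_norm _ _).trans ?_
    rw [hfn, one_mul]
    exact hDb y0 hy0W x (hSK hx) x0 hx0K
  have hfν : |⟪f i, ν⟫_ℝ| ≤ 1 := by
    refine (abs_real_inner_le_norm _ _).trans ?_
    rw [hfn, hν, one_mul]
  have hdet : c0 ≤ |⟪f i, ν⟫_ℝ| := by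
    rw [hc0d, div_le_iff₀ (by positivity)]
    have h1 : |⟪f i, ν⟫_ℝ| * |⟪f i, d⟫_ℝ| ≤ |⟪f i, ν⟫_ℝ| * D :=
      mul_le_mul_of_nonneg_left hfd (abs_nonneg _)
    have h2 := mul_le_mul_of_nonneg_left h1 hnn
    have h4 : 0 ≤ |⟪f i, ν⟫_ℝ| * D := by positivity
    linarith
  have hri : τ ≤ (n + 1) * (2 * Cn * r i) := by
    have h1 := hω i x hx
    have h2 : |⟪f i, ν⟫_ℝ| * |⟪f i, d⟫_ℝ| ≤ 1 * (2 * Cn * r i) :=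
      mul_le_mul hfν h1 (abs_nonneg _) zero_le_one
    have h4 := mul_le_mul_of_nonneg_left h2 hnn
    have h5 : 0 ≤ 2 * Cn * r i := (abs_nonneg _).trans h1
    linarith
  -- the directions and widths
  set F : Fin n → Euc n := Function.update f i ν with hF
  set w : Fin n → ℝ := Function.update (fun j => 2 * Cn * r j) i ρ with hw
  have hFn : ∀ j, ‖F j‖ = 1 := by
    intro j
    by_cases hj : j = i
    · subst hj; simp [hF, hν]
    · simp [hF, Function.update_of_ne hj, hfn]
  have hFw : ∀ j, ∀ x' ∈ Sec n c U u y0 k, ⟪F j, qc n c y0 x' - qc n c y0 x0⟫_ℝ ≤ w j := by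
    intro j x' hx'
    by_cases hj : j = i
    · subst hj; simpa [hF, hw] using hρ x' hx'
    · simp only [hF, hw, Function.update_of_ne hj]
      exact (le_abs_self _).trans (hω j x' hx')
  have hdF : |detv n F| = |⟪f i, ν⟫_ℝ| := by
    have h1 : ν = ∑ j, ⟪f j, ν⟫_ℝ • f j := (f.sum_repr' ν).symm
    have h2 : F = Function.update (⇑f) i (∑ j, ⟪f j, ν⟫_ℝ • f j) := by rw [← h1]
    rw [h2, detv_update, abs_mul, detv_orth, mul_one]
  have hch := fun j => hκb y0 hy0 k hSK x0 hx0 h0 hh hh0 (F j) (hFn j) (w j) (hFw j)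
  have hwp : ∀ j, 0 < w j := fun j => (hch j).1
  choose yy hyyW hyyG g hg hsl using fun j => (hch j).2
  have hρp : 0 < ρ := by simpa [hw] using hwp i
  set σ : Fin n → ℝ := fun j => κ * h0 / w j with hσ
  have hσp : ∀ j, 0 < σ j := fun j => by have := hwp j; simp only [hσ]; positivity
  have hσL : ∀ j, σ j ≤ κ * L := by
    intro j
    have hwid := Pot.width H h3 h hy0V hSU (fun x hx y hy => hLb x (hSK hx) y0 hy0W y hy) hx0 hh hL.le
      (hFn j) (hFw j)
    simp only [hσ]
    rw [div_le_iff₀ (hwp j), mul_assoc]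
    exact mul_le_mul_of_nonneg_left hwid hκ.le
  set P : Fin n → Euc n := fun j => slope' n c x0 y0 (yy j) with hP
  have hPn : ∀ j, ‖P j‖ ≤ δ := by
    intro j
    have h1 : P j = σ j • (F j + g j) := hsl j
    rw [h1, norm_smul, Real.norm_eq_abs, abs_of_pos (hσp j)]
    have h2 : ‖F j + g j‖ ≤ 2 := by linarith [norm_add_le (F j) (g j), hFn j, hg j]
    have h4 := mul_le_mul (hσL j) h2 (norm_nonneg _) (by positivity)
    linarith
  set G : Set (Euc n) := {y | y ∈ closure V ∧
      ∀ x ∈ Sec n c U u y0 k, (-c x y + c x y0) - (-c x0 y + c x0 y0) ≤ h0 / 2} with hG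
  have hGc : Convex ℝ (slope' n c x0 y0 '' G) := H.G_convex h3 (fun x hx => hx.1) (hSU hx0)
  have hsub : lmv n P '' Dl n ⊆ slope' n c x0 y0 '' G ∩ closedBall 0 δ := by
    refine simplex_sub (hGc.inter (convex_closedBall _ _)) ⟨⟨y0, ⟨subset_closure hy0V, ?_⟩, slope_self _ _⟩, ?_⟩ ?_
    · intro x hx; linarith
    · simpa using hδ.le
    · intro j
      exact ⟨⟨yy j, ⟨subset_closure (hWV (hyyW j)), hyyG j⟩, rfl⟩, by simpa using hPn j⟩
  have hsub2 : lmv n P '' Dl n ⊆ slope' n c x0 y0 '' (G ∩ W) := by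
    intro p hp
    obtain ⟨⟨y, hyG, rfl⟩, hpb⟩ := hsub hp
    refine ⟨y, ⟨hyG, ?_⟩, rfl⟩
    have h1 := hδb x0 hx0K y0 hy0W y hyG.1 (by simpa using hpb)
    rw [hWd, mem_closedBall]
    rw [mem_closedBall] at hy0
    have h2 := dist_triangle y y0 yb
    rw [dist_eq_norm y y0] at h2
    linarith
  have hGI : G ∩ W ⊆ GI n c U V u v (Sec n c U u y0 k) := by
    rintro y ⟨hyG, hyW⟩
    exact Pot.G_sub H h3 h (hWV hyW) hx0 (subset_closure hy0V) hh hh0 hyG.2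
  have hSm : MeasurableSet (Sec n c U u y0 k) :=
    (Pot.sec_compact H h (subset_closure hy0V) k).isClosed.measurableSet
  have hvol : ENNReal.ofReal |detv n P| * volume (Dl n) ≤ ENNReal.ofReal (M ^ n) * (ENNReal.ofReal Lam *
      (ENNReal.ofReal (A ^ n) * (ENNReal.ofReal |LinearMap.det T| * volume (closedBall (0 : Euc n) Cn)))) := by
    rw [← lmv_det, ← vol_lin]
    refine (measure_mono hsub2).trans ?_
    refine (vol_lip' hM.le (fun y hy y' hy' => hMb x0 hx0K y0 hy0W y hy.2 y' hy'.2)).trans ?_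
    refine mul_le_mul_right ((measure_mono hGI).trans ?_) _
    refine (S.le _ (fun x hx => hx.1) hSm).trans (mul_le_mul_right ?_ _)
    exact H.vol_sec (fun x hx => hx.1) hy0V hA.le
      (fun x hx x' hx' => hAb y0 hy0W x (hSK hx) x' (hSK hx')) hT
  have hreal : |detv n P| * V0 ≤ E1 * |LinearMap.det T| := by
    have h1 := ENNReal.toReal_mono (by
      refine ENNReal.mul_ne_top ENNReal.ofReal_ne_top (ENNReal.mul_ne_top ENNReal.ofReal_ne_top
        (ENNReal.mul_ne_top ENNReal.ofReal_ne_top (ENNReal.mul_ne_top ENNReal.ofReal_ne_top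
        measure_closedBall_lt_top.ne)))) hvol
    simp only [ENNReal.toReal_mul] at h1
    rw [ENNReal.toReal_ofReal (abs_nonneg _), ENNReal.toReal_ofReal (abs_nonneg _),
      ENNReal.toReal_ofReal (by positivity), ENNReal.toReal_ofReal (by positivity),
      ENNReal.toReal_ofReal (by positivity)] at h1
    rw [← hV0, ← hVB] at h1
    rw [hE1]
    linarith
  have hdP : (∏ j, σ j) * (c0 / 2) ≤ |detv n P| := by
    have h1 : P = fun j => σ j • (F j + g j) := funext hsl
    rw [h1, detv_smul, abs_mul, abs_of_pos (Finset.prod_pos (fun j _ => hσp j))]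
    refine mul_le_mul_of_nonneg_left ?_ (Finset.prod_pos (fun j _ => hσp j)).le
    exact hηb F g (fun j => (hFn j).le) hg (by rw [hdF]; exact hdet)
  have hprodσ : (∏ j, σ j) * ∏ j, w j = (κ * h0) ^ n := by
    rw [← Finset.prod_mul_distrib]
    have : ∀ j ∈ Finset.univ, σ j * w j = κ * h0 := fun j _ => div_mul_cancel₀ _ (hwp j).ne'
    rw [Finset.prod_congr rfl this, Finset.prod_const, Finset.card_univ, Fintype.card_fin]
  have hprodw : ∏ j, w j ≤ ρ * (E2 * |LinearMap.det T|) := by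
    have h1 : ∏ j, w j = ρ * ∏ j ∈ Finset.univ \ {i}, (2 * Cn * r j) := by
      rw [hw, Finset.prod_update_of_mem (Finset.mem_univ i)]
    have h2 : (2 * Cn * r i) * ∏ j ∈ Finset.univ \ {i}, (2 * Cn * r j) = (2 * Cn) ^ n * |LinearMap.det T| := by
      rw [← hrp]
      have h4 : ∏ j, (2 * Cn * r j) = (2 * Cn) ^ n * ∏ j, r j := by
        rw [Finset.prod_mul_distrib, Finset.prod_const, Finset.card_univ, Fintype.card_fin]
      rw [← h4, ← Finset.prod_erase_mul _ _ (Finset.mem_univ i), mul_comm, Finset.sdiff_singleton_eq_erase]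
    rw [h1]
    refine mul_le_mul_of_nonneg_left ?_ hρp.le
    set Pr := ∏ j ∈ Finset.univ \ {i}, (2 * Cn * r j) with hPr
    have hPr0 : 0 ≤ Pr := Finset.prod_nonneg (fun j _ => by have := hr j; positivity)
    have h5 : τ * Pr ≤ (n + 1) * ((2 * Cn) ^ n * |LinearMap.det T|) := by
      rw [← h2]
      have := mul_le_mul_of_nonneg_right hri hPr0
      linarith
    have h6 : E2 * |LinearMap.det T| = ((n + 1) * ((2 * Cn) ^ n * |LinearMap.det T|)) / τ := by
      rw [hE2]; ring
    rw [h6, le_div_iff₀ hτ]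
    linarith
  have hfin : E3 * h0 ^ n ≤ E1 * |LinearMap.det T| * (ρ * (E2 * |LinearMap.det T|)) := by
    have h1 : E3 * h0 ^ n = ((∏ j, σ j) * (c0 / 2)) * V0 * ∏ j, w j := by
      rw [hE3]
      have : κ ^ n * h0 ^ n = (∏ j, σ j) * ∏ j, w j := by rw [hprodσ, mul_pow]
      linear_combination (c0 / 2) * V0 * this
    rw [h1]
    have hw0 : 0 ≤ ∏ j, w j := (Finset.prod_pos (fun j _ => hwp j)).le
    refine mul_le_mul ?_ hprodw hw0 (by positivity)
    exact (mul_le_mul_of_nonneg_right hdP hV0p.le).trans hreal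
  have h7 : E1 * E2 / E3 * ρ * |LinearMap.det T| ^ 2 =
      (E1 * |LinearMap.det T| * (ρ * (E2 * |LinearMap.det T|))) / E3 := by ring
  rw [h7, le_div_iff₀ hE3p]
  linarith

end lemBf
end

end Part19

section Part20
open Set MeasureTheory Metric Bornology
open scoped ENNReal NNReal Pointwise InnerProductSpace

noncomputable section
section lemA
variable {n : ℕ} {c : Euc n → Euc n → ℝ} {U V O : Set (Euc n)} {u v : Euc n → ℝ} {lam Lam : ℝ}

theorem vol_antilip {M : ℝ} (hM : 0 ≤ M) {f : Euc n → Euc n} {s : Set (Euc n)}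
    (hf : ∀ x ∈ s, ∀ y ∈ s, ‖x - y‖ ≤ M * ‖f x - f y‖) :
    volume s ≤ ENNReal.ofReal (M ^ n) * volume (f '' s) := by
  have hinj : InjOn f s := by
    intro x hx y hy hxy
    have := hf x hx y hy
    rw [hxy, sub_self, norm_zero, mul_zero] at this
    exact sub_eq_zero.1 (norm_le_zero_iff.1 this)
  have hl := hinj.leftInvOn_invFunOn
  have h1 : s = Function.invFunOn f s '' (f '' s) := hl.image_image.symm
  conv_lhs => rw [h1]
  refine vol_lip' hM ?_
  rintro _ ⟨x, hx, rfl⟩ _ ⟨y, hy, rfl⟩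
  rw [hl hx, hl hy]
  exact hf x hx y hy

theorem norm_le_of_inner {p : Euc n} {B : ℝ} (hB : 0 ≤ B) (h : ∀ b : Euc n, ‖b‖ ≤ 1 → ⟪p, b⟫_ℝ ≤ B) :
    ‖p‖ ≤ B := by
  by_cases hp : p = 0
  · rw [hp, norm_zero]; exact hB
  have hn : 0 < ‖p‖ := norm_pos_iff.2 hp
  have := h (‖p‖⁻¹ • p) (by rw [norm_smul, norm_inv, norm_norm, inv_mul_cancel₀ hn.ne'])
  rw [inner_smul_right, real_inner_self_eq_norm_sq, sq, ← mul_assoc, inv_mul_cancel₀ hn.ne', one_mul] at this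
  exact this

set_option maxHeartbeats 2000000 in
theorem Sol.lemA (S : Sol n c U V O u v lam Lam) {K : Set (Euc n)}
    (hK : IsCompact K) (hKU : K ⊆ U) {yb : Euc n} {r1 : ℝ} (hr1 : 0 < r1) (hWV : closedBall yb (2 * r1) ⊆ V)
    {x : Euc n} {rO : ℝ} (hrO : 0 < rO) (hxO : closedBall x rO ⊆ O) : ∃ CA : ℝ, 0 < CA ∧
    ∀ y0 ∈ closedBall yb r1, ∀ k h : ℝ, 0 < h → Sec n c U u y0 k ⊆ K → x ∈ Sec n c U u y0 k →
    (∀ x' ∈ Sec n c U u y0 k, k - h ≤ u x' + c x' y0) →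
    ∀ (zc : Euc n) (T : Euc n →ₗ[ℝ] Euc n), LinearMap.det T ≠ 0 →
    (∀ a, ‖a‖ ≤ 1 → zc + T a ∈ qc n c y0 '' Sec n c U u y0 k) →
    |LinearMap.det T| ^ 2 ≤ CA * h ^ n := by
  obtain ⟨H, h3, hp⟩ : Raw n c U V ∧ MTW n c U V ∧ Pot n c U V u v := ⟨S.raw, S.mtw, S.pot⟩
  set W := closedBall yb (2 * r1) with hWd
  have hW : IsCompact W := isCompact_closedBall _ _
  set W1 := GI n c U V u v (closedBall x rO) with hW1d
  have hW1 : IsCompact W1 := S.image_compact (isCompact_closedBall _ _)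
  have hW1V : W1 ⊆ V := by
    rintro y ⟨x', hx', hG⟩
    exact S.memV hG (hxO hx')
  have hW2 : IsCompact (W ∪ W1) := hW.union hW1
  have hW2V : W ∪ W1 ⊆ V := union_subset hWV hW1V
  obtain ⟨C, hC, hCb⟩ := H.I2 h3 hK hKU hW2 hW2V
  obtain ⟨M1, hM1, hM1b⟩ := H.slope_antilip hK hKU hW2 hW2V
  obtain ⟨A, hA, hAb⟩ := H.antilipU hK hKU hW hWV
  obtain ⟨D, hD, hDb⟩ := H.q_diam hK hKU hW hWV
  obtain ⟨Lq, hLq, hLqb⟩ := H.lipq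
  have hlam := S.lampos
  obtain ⟨κ, hκ, hκ1, hκD⟩ : ∃ κ : ℝ, 0 < κ ∧ κ ≤ 1 ∧ κ * (A * D) ≤ rO := by
    refine ⟨min 1 (rO / (A * D)), by positivity, min_le_left _ _, ?_⟩
    rw [← le_div_iff₀ (by positivity)]
    exact min_le_right _ _
  set R := C * (1 + C ^ 2) / κ with hR
  have hRp : 0 < R := by positivity
  set E := (Lq ^ n * M1 ^ n * R ^ n) / (lam * (κ / 2) ^ n) with hE
  refine ⟨E, by positivity, ?_⟩
  intro y0 hy0 k h hh hSK hxS hwl zc T hdet hT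
  have hy0W : y0 ∈ W := closedBall_subset_closedBall (by linarith) hy0
  have hy0V := hWV hy0W
  have hSU := hSK.trans hKU
  have hy02 : y0 ∈ W ∪ W1 := Or.inl hy0W
  have hxK := hSK hxS
  have hcv := Pot.sec_convex H h3 hp hy0V k
  set qx := qc n c y0 x with hqx
  -- points of the shrunk copy
  have hpt : ∀ a, ‖a‖ ≤ 1 → ∃ z ∈ Sec n c U u y0 k, qc n c y0 z = qx + κ • (zc + T a - qx) := by
    intro a ha
    exact hcv.add_smul_sub_mem (mem_image_of_mem _ hxS) (hT a ha) ⟨hκ.le, hκ1⟩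
  set X : Set (Euc n) := {x' | x' ∈ Sec n c U u y0 k ∧ ∃ a : Euc n, ‖a‖ ≤ 1 ∧
    qc n c y0 x' = qx + κ • (zc + T ((1/2 : ℝ) • a) - qx)} with hX
  have hhalf : ∀ a : Euc n, ‖a‖ ≤ 1 → ‖(1/2 : ℝ) • a‖ ≤ 1 := by
    intro a ha
    rw [norm_smul]; norm_num; linarith
  have hXb : X ⊆ closedBall x rO := by
    rintro x' ⟨hx'S, a, ha, hq⟩
    rw [mem_closedBall, dist_eq_norm]
    refine (hAb y0 hy0W x' (hSK hx'S) x hxK).trans ?_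
    obtain ⟨z, hz, hzq⟩ := hT _ (hhalf a ha)
    rw [hq, ← hzq, ← hqx, add_sub_cancel_left, norm_smul, Real.norm_eq_abs, abs_of_pos hκ]
    have h1 := hDb y0 hy0W z (hSK hz) x hxK
    rw [← hqx] at h1
    have h2 : A * (κ * ‖qc n c y0 z - qx‖) ≤ A * (κ * D) := by gcongr
    linarith
  have hTc : Continuous T := T.continuous_of_finiteDimensional
  set Φ : Euc n → Euc n := fun a => qx + κ • (zc + T ((1/2 : ℝ) • a) - qx) with hΦ
  have hΦc : Continuous Φ := by
    have h1 : Continuous (fun a : Euc n => T ((1/2 : ℝ) • a)) := hTc.comp (by fun_prop)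
    simp only [hΦ]
    fun_prop
  have hEc : IsCompact (Φ '' closedBall 0 1) := (isCompact_closedBall _ _).image hΦc
  have hSc := Pot.sec_compact H hp (subset_closure hy0V) k
  have hXm : MeasurableSet X := by
    have h1 : X = Sec n c U u y0 k ∩ qc n c y0 ⁻¹' (Φ '' closedBall 0 1) := by
      ext x'
      constructor
      · rintro ⟨h1, a, ha, hq⟩
        exact ⟨h1, a, by simpa using ha, hq.symm⟩
      · rintro ⟨h1, a, ha, hq⟩
        exact ⟨h1, a, by simpa using ha, hq.symm⟩
    rw [h1]
    exact (((H.contq hy0V).mono (fun x hx => hx.1)).preimage_isClosed_of_isClosed hSc.isClosed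
      hEc.isClosed).measurableSet
  have hqX : qc n c y0 '' X = Φ '' closedBall 0 1 := by
    ext q
    constructor
    · rintro ⟨x', ⟨h1, a, ha, hq⟩, rfl⟩
      exact ⟨a, by simpa using ha, hq.symm⟩
    · rintro ⟨a, ha, rfl⟩
      have ha' : ‖a‖ ≤ 1 := by simpa using ha
      obtain ⟨z, hz, hzq⟩ := hpt _ (hhalf a ha')
      exact ⟨z, ⟨hz, a, ha', hzq⟩, hzq⟩
  -- the centre
  obtain ⟨z0, hz0S, hz0q⟩ := hpt 0 (by simp)
  have hz0K := hSK hz0S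
  have hGIW : GI n c U V u v X ⊆ W1 := by
    rintro y ⟨x', hx', hG⟩
    exact ⟨x', hXb hx', hG⟩
  have hkey : ∀ y ∈ GI n c U V u v X, ‖LinearMap.adjoint T (slope' n c z0 y0 y)‖ ≤ R * h := by
    intro y hy
    have hy2 : y ∈ W ∪ W1 := Or.inr (hGIW hy)
    obtain ⟨x', ⟨hx'S, a, ha, hq⟩, hG⟩ := hy
    have hx'K := hSK hx'S
    have hm : ∀ z ∈ Sec n c U u y0 k, (-c z y + c z y0) - (-c x' y + c x' y0) ≤ h := by
      intro z hz
      have h1 := hp.contact hG hz.1 y0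
      have h2 := hwl x' hx'S
      have h4 := hz.2
      linarith
    have hin : ∀ z ∈ Sec n c U u y0 k, ⟪slope' n c x' y0 y, qc n c y0 z - qc n c y0 x'⟫_ℝ ≤ C * h := by
      intro z hz
      by_cases hs : 0 ≤ ⟪slope' n c x' y0 y, qc n c y0 z - qc n c y0 x'⟫_ℝ
      · have h1 := (hCb y0 hy02 y hy2 x' hx'K z (hSK hz) _ _ rfl rfl).1 hs
        exact h1.trans (mul_le_mul_of_nonneg_left (hm z hz) hC.le)
      · push Not at hs
        exact hs.le.trans (by positivity)
    have hz0x : -(C ^ 2 * h) ≤ (-c z0 y + c z0 y0) - (-c x' y + c x' y0) := by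
      obtain ⟨zs, hzs, hzsq⟩ := hpt a ha
      have h1 := hin zs hzs
      have h2 : qc n c y0 z0 - qc n c y0 x' = -(qc n c y0 zs - qc n c y0 x') := by
        rw [hz0q, hq, hzsq, map_smul, map_zero]; module
      have h4 : ⟪slope' n c x' y0 y, qc n c y0 z0 - qc n c y0 x'⟫_ℝ ≥ -(C * h) := by
        rw [h2, inner_neg_right]; linarith
      have h5 := hCb y0 hy02 y hy2 x' hx'K z0 hz0K _ _ rfl rfl
      by_cases hs : ⟪slope' n c x' y0 y, qc n c y0 z0 - qc n c y0 x'⟫_ℝ ≤ 0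
      · have h6 := h5.2 hs
        have h7 := mul_le_mul_of_nonneg_left h4 hC.le
        linarith
      · push Not at hs
        have h6 := h5.1 hs.le
        have h7 : 0 ≤ (-c z0 y + c z0 y0) - (-c x' y + c x' y0) := by
          by_contra hc
          push Not at hc
          nlinarith
        have h8 : 0 ≤ C ^ 2 * h := by positivity
        linarith
    refine norm_le_of_inner (by positivity) (fun b hb => ?_)
    rw [LinearMap.adjoint_inner_left]
    obtain ⟨z, hz, hzq⟩ := hpt b hb
    have h1 : qc n c y0 z - qc n c y0 z0 = κ • T b := by
      rw [hz0q, hzq, map_zero]; module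
    have h2 : ⟪slope' n c z0 y0 y, qc n c y0 z - qc n c y0 z0⟫_ℝ ≤ C * (1 + C ^ 2) * h := by
      by_cases hs : 0 ≤ ⟪slope' n c z0 y0 y, qc n c y0 z - qc n c y0 z0⟫_ℝ
      · have h4 := (hCb y0 hy02 y hy2 z0 hz0K z (hSK hz) _ _ rfl rfl).1 hs
        have h5 : (-c z y + c z y0) - (-c z0 y + c z0 y0) ≤ (1 + C ^ 2) * h := by
          have := hm z hz
          linarith
        have h6 := mul_le_mul_of_nonneg_left h5 hC.le
        linarith
      · push Not at hs
        exact hs.le.trans (by positivity)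
    rw [h1, inner_smul_right] at h2
    rw [hR, div_mul_eq_mul_div, le_div_iff₀ hκ]
    linarith
  set VB := (volume (closedBall (0 : Euc n) 1)).toReal with hVB
  have hVBt : volume (closedBall (0 : Euc n) 1) ≠ ⊤ := measure_closedBall_lt_top.ne
  have hVBp : 0 < VB := ENNReal.toReal_pos (measure_closedBall_pos volume _ one_pos).ne' hVBt
  have hVBe : volume (closedBall (0 : Euc n) 1) = ENNReal.ofReal VB := (ENNReal.ofReal_toReal hVBt).symm
  set dT := |LinearMap.det T| with hdT
  have hdTp : 0 < dT := abs_pos.2 hdet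
  have hup : volume (GI n c U V u v X) ≤ ENNReal.ofReal (M1 ^ n * (dT⁻¹ * ((R * h) ^ n * VB))) := by
    have h1 : volume (GI n c U V u v X) ≤ ENNReal.ofReal (M1 ^ n) *
        volume (slope' n c z0 y0 '' GI n c U V u v X) :=
      vol_antilip hM1.le (fun y hy y' hy' => hM1b z0 hz0K y0 hy0V y (Or.inr (hGIW hy)) y' (Or.inr (hGIW hy')))
    have h2 : slope' n c z0 y0 '' GI n c U V u v X ⊆ LinearMap.adjoint T ⁻¹' closedBall 0 (R * h) := by
      rintro _ ⟨y, hy, rfl⟩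
      rw [mem_preimage, mem_closedBall, dist_zero_right]
      exact hkey y hy
    have h4 : volume (LinearMap.adjoint T ⁻¹' closedBall (0 : Euc n) (R * h)) =
        ENNReal.ofReal (dT⁻¹ * ((R * h) ^ n * VB)) := by
      rw [Measure.addHaar_preimage_linearMap volume (by rw [adj_det]; exact hdet), adj_det,
        Measure.addHaar_closedBall' volume _ (by positivity), hVBe, finrank_euclideanSpace,
        Fintype.card_fin, abs_inv, ← ENNReal.ofReal_mul (by positivity), ← ENNReal.ofReal_mul (by positivity)]
    refine h1.trans ?_
    rw [ENNReal.ofReal_mul (by positivity), ← h4]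
    exact mul_le_mul_right (measure_mono h2) _
  have hlow : ENNReal.ofReal ((κ / 2) ^ n * dT * VB) ≤ ENNReal.ofReal (Lq ^ n) * volume X := by
    have h1 : volume (qc n c y0 '' X) ≤ ENNReal.ofReal (Lq ^ n) * volume X :=
      vol_lip' hLq.le (fun x1 hx1 x2 hx2 => hLqb _ (convex_closedBall x rO) (hxO.trans S.subO) y0 hy0V
        x1 (hXb hx1) x2 (hXb hx2))
    refine le_trans ?_ h1
    rw [hqX]
    have h2 : Φ '' closedBall 0 1 = (qx + κ • (zc - qx)) +ᵥ (((κ / 2) • T : Euc n →ₗ[ℝ] Euc n) '' closedBall 0 1) := by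
      rw [← image_vadd, image_image]
      refine image_congr (fun a _ => ?_)
      simp only [hΦ, map_smul, LinearMap.smul_apply, vadd_eq_add]
      module
    rw [h2, measure_vadd, vol_lin, LinearMap.det_smul, finrank_euclideanSpace, Fintype.card_fin, abs_mul,
      abs_of_pos (by positivity), hVBe, ← ENNReal.ofReal_mul (by positivity)]
  have hge := S.ge X (hXb.trans hxO) hXm
  have hfin : ENNReal.ofReal (lam * ((κ / 2) ^ n * dT * VB)) ≤
      ENNReal.ofReal (Lq ^ n * (M1 ^ n * (dT⁻¹ * ((R * h) ^ n * VB)))) := by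
    rw [ENNReal.ofReal_mul hlam.le, ENNReal.ofReal_mul (p := Lq ^ n) (by positivity)]
    calc ENNReal.ofReal lam * ENNReal.ofReal ((κ / 2) ^ n * dT * VB)
        ≤ ENNReal.ofReal lam * (ENNReal.ofReal (Lq ^ n) * volume X) := mul_le_mul_right hlow _
      _ = ENNReal.ofReal (Lq ^ n) * (ENNReal.ofReal lam * volume X) := by ring
      _ ≤ ENNReal.ofReal (Lq ^ n) * _ := mul_le_mul_right (hge.trans hup) _
  rw [ENNReal.ofReal_le_ofReal_iff (by positivity)] at hfin
  rw [hE, div_mul_eq_mul_div, le_div_iff₀ (by positivity)]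
  have h5 : Lq ^ n * (M1 ^ n * (dT⁻¹ * ((R * h) ^ n * VB))) = (Lq ^ n * M1 ^ n * R ^ n * h ^ n * VB) / dT := by
    rw [mul_pow]; field_simp
  rw [h5, le_div_iff₀ hdTp] at hfin
  have h6 : (dT ^ 2 * (lam * (κ / 2) ^ n)) * VB ≤ (Lq ^ n * M1 ^ n * R ^ n * h ^ n) * VB := by linarith
  exact le_of_mul_le_mul_right h6 hVBp

end lemA
end

end Part20

section Part21
open Set MeasureTheory Metric Bornology
open scoped ENNReal NNReal Pointwise InnerProductSpace

noncomputable section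
section fin
variable {n : ℕ} {c : Euc n → Euc n → ℝ} {U V O : Set (Euc n)} {u v : Euc n → ℝ} {lam Lam : ℝ}

theorem Raw.q_unif (H : Raw n c U V) {yb : Euc n} {r θ : ℝ} (hr : 0 < r) (hWV : closedBall yb r ⊆ V)
    (hθ : 0 < θ) : ∃ r' : ℝ, 0 < r' ∧ r' ≤ r ∧ ∀ y ∈ closedBall yb r', ∀ x ∈ closure U,
    ‖qc n c y x - qc n c yb x‖ ≤ θ := by
  have hc : ContinuousOn (fun z : Euc n × Euc n => qc n c z.2 z.1) (closure U ×ˢ closedBall yb r) :=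
    H.contq2.mono (prod_mono subset_rfl hWV)
  have hu := (H.compU.prod (isCompact_closedBall yb r)).uniformContinuousOn_of_continuous hc
  obtain ⟨δ, hδ, hb⟩ := Metric.uniformContinuousOn_iff.1 hu θ hθ
  refine ⟨min r (δ / 2), by positivity, min_le_left _ _, fun y hy x hx => ?_⟩
  have hy1 : dist y yb ≤ r := (mem_closedBall.1 hy).trans (min_le_left _ _)
  have hy2 : dist y yb ≤ δ / 2 := (mem_closedBall.1 hy).trans (min_le_right _ _)
  have := hb (x, y) ⟨hx, hy1⟩ (x, yb) ⟨hx, mem_closedBall_self hr.le⟩ (by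
    rw [Prod.dist_eq, dist_self, max_lt_iff]; exact ⟨hδ, by simp only; linarith⟩)
  rw [dist_eq_norm] at this
  exact this.le

theorem Raw.m_lin (H : Raw n c U V) {yb e : Euc n} {r θ ε : ℝ} (hV : closedBall yb r ⊆ V)
    (hq : ∀ y ∈ closedBall yb r, ∀ x ∈ closure U, ‖qc n c y x - qc n c yb x‖ ≤ θ)
    (hε : 0 < ε) (he : ε * ‖e‖ ≤ r) {x : Euc n} (hx : x ∈ closure U) :
    |(-c x (yb + ε • e) + c x yb) - ε * ⟪qc n c yb x, e⟫_ℝ| ≤ ε * (θ * ‖e‖) := by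
  have hmem : ∀ s ∈ Icc (0:ℝ) ε, yb + s • e ∈ closedBall yb r := by
    intro s hs
    rw [mem_closedBall, dist_eq_norm, add_sub_cancel_left, norm_smul, Real.norm_eq_abs, abs_of_nonneg hs.1]
    exact (mul_le_mul_of_nonneg_right hs.2 (norm_nonneg _)).trans he
  have hd : ∀ s ∈ Icc (0:ℝ) ε, HasDerivAt (fun s : ℝ => -c x (yb + s • e)) ⟪qc n c (yb + s • e) x, e⟫_ℝ s := by
    intro s hs
    have h1 := (H.hasGradY hx (hV (hmem s hs))).hasFDerivAt
    have h2 : HasDerivAt (fun s : ℝ => yb + s • e) e s := by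
      simpa using ((hasDerivAt_id s).smul_const e).const_add yb
    have h4 := (h1.comp_hasDerivAt s h2).neg
    have h5 : -((InnerProductSpace.toDual ℝ (Euc n)) (gradY n c x (yb + s • e)) e) =
        ⟪qc n c (yb + s • e) x, e⟫_ℝ := by
      rw [InnerProductSpace.toDual_apply_apply, qc, inner_neg_left]
    rw [h5] at h4
    exact h4
  obtain ⟨s, hs, hs'⟩ := exists_hasDerivAt_eq_slope (fun s : ℝ => -c x (yb + s • e))
    (fun s => ⟪qc n c (yb + s • e) x, e⟫_ℝ) hε (fun s hs => (hd s hs).continuousAt.continuousWithinAt)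
    (fun s hs => hd s ⟨hs.1.le, hs.2.le⟩)
  simp only [zero_smul, add_zero, sub_zero] at hs'
  rw [eq_div_iff hε.ne'] at hs'
  have h1 : (-c x (yb + ε • e) + c x yb) - ε * ⟪qc n c yb x, e⟫_ℝ =
      ε * ⟪qc n c (yb + s • e) x - qc n c yb x, e⟫_ℝ := by
    rw [inner_sub_left]; linarith
  rw [h1, abs_mul, abs_of_pos hε]
  refine mul_le_mul_of_nonneg_left ?_ hε.le
  refine (abs_real_inner_le_norm _ _).trans ?_
  exact mul_le_mul_of_nonneg_right (hq _ (hmem s ⟨hs.1.le, hs.2.le⟩) x hx) (norm_nonneg _)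

set_option maxHeartbeats 2000000 in
theorem Sol.no_two (S : Sol n c U V O u v lam Lam) {x x' yb : Euc n} (hxO : x ∈ O)
    (hx : (x, yb) ∈ Gam n c U V u v) (hx' : (x', yb) ∈ Gam n c U V u v) : x = x' := by
  by_contra hne
  obtain ⟨H, h3, hp⟩ : Raw n c U V ∧ MTW n c U V ∧ Pot n c U V u v := ⟨S.raw, S.mtw, S.pot⟩
  have hyV : yb ∈ V := S.memV hx hxO
  set S0 : Set (Euc n) := {z | (z, yb) ∈ Gam n c U V u v} with hS0
  have hS0c : IsCompact S0 := S.contact_compact yb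
  have hS0U : S0 ⊆ U := fun z hz => S.memU hz hyV
  have hxcl : x ∈ closure U := hx.1
  obtain ⟨x0, hx0S, hx0m⟩ := hS0c.exists_isMaxOn ⟨x, hx⟩
    (f := fun z => ‖qc n c yb z - qc n c yb x‖)
    (((H.contq hyV).mono (hS0U.trans subset_closure)).sub continuousOn_const).norm
  have hx0cl : x0 ∈ closure U := hx0S.1
  set e := qc n c yb x0 - qc n c yb x with he
  have hmax : ∀ z ∈ S0, ‖qc n c yb z - qc n c yb x‖ ≤ ‖e‖ := fun z hz => isMaxOn_iff.1 hx0m z hz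
  have hen : 0 < ‖e‖ := by
    have h1 := hmax x' hx'
    refine lt_of_lt_of_le (norm_pos_iff.2 (sub_ne_zero.2 ?_)) h1
    intro hqq
    exact hne (H.injq hyV hx'.1 hx.1 hqq).symm
  obtain ⟨r2, hr2, hr2V⟩ := Metric.nhds_basis_closedBall.mem_iff.1 (H.openV.mem_nhds hyV)
  set r1 := r2 / 2 with hr1d
  have hr1 : 0 < r1 := by positivity
  have hWV : closedBall yb (2 * r1) ⊆ V := by
    rw [show 2 * r1 = r2 by rw [hr1d]; ring]; exact hr2V
  have hW1V : closedBall yb r1 ⊆ V := (closedBall_subset_closedBall (by linarith)).trans hWV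
  obtain ⟨rO, hrO, hrOO⟩ := Metric.nhds_basis_closedBall.mem_iff.1 (S.openO.mem_nhds hxO)
  obtain ⟨δK, hδK, hKU⟩ := hS0c.exists_cthickening_subset_open H.openU hS0U
  set K := cthickening δK S0 with hKd
  have hK : IsCompact K := hS0c.cthickening
  have hCn : (0:ℝ) < n * (2 * (n + 1) ^ 2) + 1 := by positivity
  obtain ⟨CB, hCB, hCBb⟩ := S.lemBf hK hKU hr1 hWV (τ := ‖e‖ / 2) (by positivity) hCn
  obtain ⟨CA, hCA, hCAb⟩ := S.lemA hK hKU hr1 hWV hrO hrOO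
  obtain ⟨ρ0, hρ0, hρ1, hρ2⟩ : ∃ ρ0 : ℝ, 0 < ρ0 ∧ ρ0 ≤ ‖e‖ / 2 ∧ ρ0 * (CB * CA * 2 ^ n * 2) ≤ 1 := by
    refine ⟨min (‖e‖ / 2) (1 / (CB * CA * 2 ^ n * 2)), by positivity, min_le_left _ _, ?_⟩
    rw [← le_div_iff₀ (by positivity)]
    exact min_le_right _ _
  set θ := ρ0 / 4 with hθd
  have hθ : 0 < θ := by positivity
  obtain ⟨r', hr', hr'1, hqu⟩ := H.q_unif hr1 hW1V hθ
  -- the bad set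
  set B : Set (Euc n) := (closure U \ thickening δK S0) ∪
    (closure U ∩ (fun z => ⟪e, qc n c yb z - qc n c yb x0⟫_ℝ) ⁻¹' Ici (ρ0 * ‖e‖ / 2)) with hB
  have hqc : ContinuousOn (fun z => ⟪e, qc n c yb z - qc n c yb x0⟫_ℝ) (closure U) :=
    continuousOn_const.inner ((H.contq hyV).sub continuousOn_const)
  have hBc : IsCompact B := by
    refine IsCompact.union (H.compU.diff isOpen_thickening) ?_
    exact H.compU.of_isClosed_subset (hqc.preimage_isClosed_of_isClosed isClosed_closure isClosed_Ici)
      inter_subset_left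
  have hBU : B ⊆ closure U := union_subset diff_subset inter_subset_left
  have hee : ⟪e, e⟫_ℝ = ‖e‖ ^ 2 := real_inner_self_eq_norm_sq e
  have hsplit : ∀ z, ⟪e, qc n c yb z - qc n c yb x0⟫_ℝ = ⟪e, qc n c yb z - qc n c yb x⟫_ℝ - ‖e‖ ^ 2 := by
    intro z
    rw [← hee, ← inner_sub_right, he]; congr 1; abel
  have hBpos : ∀ z ∈ B, 0 < u z + v yb + c z yb := by
    intro z hz
    have h1 := hp.ineq z (hBU hz) yb (subset_closure hyV)
    refine lt_of_le_of_ne h1 (fun h2 => ?_)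
    have hzS : z ∈ S0 := ⟨hBU hz, subset_closure hyV, h2.symm⟩
    rcases hz with hz | hz
    · exact hz.2 (self_subset_thickening hδK _ hzS)
    · have h4 : ρ0 * ‖e‖ / 2 ≤ ⟪e, qc n c yb z - qc n c yb x0⟫_ℝ := hz.2
      rw [hsplit] at h4
      have h5 := real_inner_le_norm e (qc n c yb z - qc n c yb x)
      have h6 := mul_le_mul_of_nonneg_left (hmax z hzS) (norm_nonneg e)
      have h7 : 0 < ρ0 * ‖e‖ / 2 := by positivity
      nlinarith
  obtain ⟨μ, hμ, hμb⟩ : ∃ μ : ℝ, 0 < μ ∧ ∀ z ∈ B, μ ≤ u z + v yb + c z yb := by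
    by_cases hBe : B.Nonempty
    · obtain ⟨z, hz, hzm⟩ := hBc.exists_isMinOn hBe (f := fun z => u z + v yb + c z yb)
        (((hp.contu.mono hBU).add continuousOn_const).add ((H.cont_x (subset_closure hyV)).mono hBU))
      exact ⟨_, hBpos z hz, fun z' hz' => isMinOn_iff.1 hzm z' hz'⟩
    · exact ⟨1, one_pos, fun z hz => absurd ⟨z, hz⟩ hBe⟩
  obtain ⟨δ2, hδ2, hmod⟩ := H.swap.modulus (ε := μ / 2) (by positivity)
  obtain ⟨ε, hε, hε1, hε2⟩ : ∃ ε : ℝ, 0 < ε ∧ ε * ‖e‖ ≤ r' ∧ ε * ‖e‖ < δ2 := by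
    refine ⟨min r' (δ2 / 2) / ‖e‖, by positivity, ?_, ?_⟩
    · rw [div_mul_cancel₀ _ hen.ne']; exact min_le_left _ _
    · rw [div_mul_cancel₀ _ hen.ne']; exact lt_of_le_of_lt (min_le_right _ _) (by linarith)
  set y0 := yb + ε • e with hy0
  have hy0d : dist y0 yb = ε * ‖e‖ := by
    rw [dist_eq_norm, hy0, add_sub_cancel_left, norm_smul, Real.norm_eq_abs, abs_of_pos hε]
  have hy0r' : y0 ∈ closedBall yb r' := by rw [mem_closedBall, hy0d]; exact hε1
  have hy0r1 : y0 ∈ closedBall yb r1 := closedBall_subset_closedBall hr'1 hy0r'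
  have hy0V : y0 ∈ V := hW1V hy0r1
  have hml : ∀ z ∈ closure U, |(-c z y0 + c z yb) - ε * ⟪qc n c yb z, e⟫_ℝ| ≤ ε * (θ * ‖e‖) :=
    fun z hz => H.m_lin ((closedBall_subset_closedBall hr'1).trans hW1V) hqu hε hε1 hz
  set k := u x + c x y0 with hk
  have hxG : u x + v yb + c x yb = 0 := hx.2.2
  have hx0G : u x0 + v yb + c x0 yb = 0 := hx0S.2.2
  have hnear : ∀ z ∈ closure U, |c z y0 - c z yb| < μ / 2 := by
    intro z hz
    exact hmod y0 (subset_closure hy0V) yb (subset_closure hyV) (by rw [hy0d]; exact hε2) z hz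
  have hSB : ∀ z ∈ Sec n c U u y0 k, z ∉ B := by
    intro z hz hzB
    have h1 := hμb z hzB
    have h2 := abs_lt.1 (hnear z hz.1)
    have h4 := abs_lt.1 (hnear x hxcl)
    have h5 := hz.2
    linarith [h2.1, h2.2, h4.1, h4.2]
  have hSK : Sec n c U u y0 k ⊆ K := by
    intro z hz
    by_contra hc
    exact hSB z hz (Or.inl ⟨hz.1, fun h1 => hc (thickening_subset_cthickening _ _ h1)⟩)
  have hSin : ∀ z ∈ Sec n c U u y0 k, ⟪e, qc n c yb z - qc n c yb x0⟫_ℝ ≤ ρ0 * ‖e‖ / 2 := by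
    intro z hz
    by_contra hc
    push Not at hc
    exact hSB z hz (Or.inr ⟨hz.1, hc.le⟩)
  have hxS : x ∈ Sec n c U u y0 k := ⟨hxcl, le_rfl⟩
  -- numerology
  have hθe : θ * ‖e‖ ≤ ‖e‖ ^ 2 / 8 := by
    rw [hθd]; nlinarith
  have hinx : ⟪qc n c yb x0, e⟫_ℝ - ⟪qc n c yb x, e⟫_ℝ = ‖e‖ ^ 2 := by
    rw [← inner_sub_left, ← he, hee]
  have hεe : 0 < ε * ‖e‖ ^ 2 := by positivity
  have hεθ := mul_le_mul_of_nonneg_left hθe hε.le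
  have hmx := abs_le.1 (hml x hxcl)
  have hmx0 := abs_le.1 (hml x0 hx0cl)
  have hεin : ε * ⟪qc n c yb x0, e⟫_ℝ - ε * ⟪qc n c yb x, e⟫_ℝ = ε * ‖e‖ ^ 2 := by
    rw [← mul_sub, hinx]
  obtain ⟨h0, hh0⟩ : ∃ h0, h0 = k - (u x0 + c x0 y0) := ⟨_, rfl⟩
  have hh0l : 3 / 4 * (ε * ‖e‖ ^ 2) ≤ h0 := by
    rw [hh0, hk]
    linarith [hmx.1, hmx.2, hmx0.1, hmx0.2]
  have hh0p : 0 < h0 := by linarith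
  have hx0Sec : x0 ∈ Sec n c U u y0 k := ⟨hx0cl, by linarith⟩
  have hwl : ∀ z ∈ Sec n c U u y0 k, k - 2 * h0 ≤ u z + c z y0 := by
    intro z hz
    have h1 := hp.ineq z hz.1 yb (subset_closure hyV)
    have hmz := abs_le.1 (hml z hz.1)
    have h2 := hSin z hz
    rw [inner_sub_right, real_inner_comm, real_inner_comm _ e] at h2
    have h4 : ρ0 * ‖e‖ / 2 ≤ ‖e‖ ^ 2 / 4 := by nlinarith
    have h5 := mul_le_mul_of_nonneg_left (h2.trans h4) hε.le
    rw [hk]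
    rw [mul_sub] at h5
    linarith [hmx.1, hmx.2, hmz.1, hmz.2]
  set ν := ‖e‖⁻¹ • e with hν
  have hνn : ‖ν‖ = 1 := by rw [hν, norm_smul, norm_inv, norm_norm, inv_mul_cancel₀ hen.ne']
  have hqν : ∀ z ∈ closure U, ⟪ν, qc n c y0 z - qc n c y0 x0⟫_ℝ ≤
      ⟪ν, qc n c yb z - qc n c yb x0⟫_ℝ + 2 * θ := by
    intro z hz
    have h1 : ⟪ν, qc n c y0 z - qc n c y0 x0⟫_ℝ - ⟪ν, qc n c yb z - qc n c yb x0⟫_ℝ =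
        ⟪ν, qc n c y0 z - qc n c yb z⟫_ℝ - ⟪ν, qc n c y0 x0 - qc n c yb x0⟫_ℝ := by
      simp only [inner_sub_right]; ring
    have h2a : |⟪ν, qc n c y0 z - qc n c yb z⟫_ℝ| ≤ θ := by
      refine (abs_real_inner_le_norm _ _).trans ?_
      rw [hνn, one_mul]
      exact hqu y0 hy0r' z hz
    have h2 := abs_le.1 h2a
    have h4a : |⟪ν, qc n c y0 x0 - qc n c yb x0⟫_ℝ| ≤ θ := by
      refine (abs_real_inner_le_norm _ _).trans ?_
      rw [hνn, one_mul]
      exact hqu y0 hy0r' x0 hx0cl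
    have h4 := abs_le.1 h4a
    linarith [h2.1, h2.2, h4.1, h4.2]
  have hνx : ⟪ν, qc n c y0 x - qc n c y0 x0⟫_ℝ ≤ -(‖e‖ / 2) := by
    have h1 := hqν x hxcl
    rw [hν, real_inner_smul_left _ (qc n c yb x - qc n c yb x0), hsplit, sub_self, inner_zero_right, zero_sub] at h1
    have h2 : ‖e‖⁻¹ * -‖e‖ ^ 2 = -‖e‖ := by field_simp
    rw [h2, ← hν] at h1
    have h4 : 2 * θ ≤ ‖e‖ / 2 := by rw [hθd]; linarith
    linarith
  have hνρ : ∀ z ∈ Sec n c U u y0 k, ⟪ν, qc n c y0 z - qc n c y0 x0⟫_ℝ ≤ ρ0 := by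
    intro z hz
    have h1 := hqν z hz.1
    have h2 := mul_le_mul_of_nonneg_left (hSin z hz) (inv_nonneg.2 hen.le)
    rw [← real_inner_smul_left, ← hν] at h2
    have h4 : ‖e‖⁻¹ * (ρ0 * ‖e‖ / 2) = ρ0 / 2 := by field_simp
    rw [h4] at h2
    rw [hθd] at h1
    linarith
  have hQc : IsCompact (qc n c y0 '' Sec n c U u y0 k) :=
    (Pot.sec_compact H hp (subset_closure hy0V) k).image_of_continuousOn
      ((H.contq hy0V).mono (fun x hx => hx.1))
  have hQi : (interior (qc n c y0 '' Sec n c U u y0 k)).Nonempty := by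
    obtain ⟨r, hr, hb⟩ := Pot.push H hp hy0V (k := k) (hS0U hx0S) (by linarith)
    refine ⟨qc n c y0 x0, mem_interior.2 ⟨ball (qc n c y0 x0) r, ?_, isOpen_ball, mem_ball_self hr⟩⟩
    intro q hq
    rw [mem_ball, dist_eq_norm] at hq
    obtain ⟨z, _, hz, hzq⟩ := hb q hq
    exact ⟨z, hz, hzq⟩
  obtain ⟨zc, T, hdet, hin, hout⟩ := john hQc (Pot.sec_convex H h3 hp hy0V k) hQi
  have hB1 := hCBb y0 hy0r1 k hSK x0 hx0Sec h0 hh0 hh0p x hxS ν hνn hνx ρ0 hνρ zc T (by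
    intro z hz
    obtain ⟨a, ha, hq⟩ := hout _ (mem_image_of_mem _ hz)
    exact ⟨a, by linarith, hq⟩)
  have hA1 := hCAb y0 hy0r1 k (2 * h0) (by positivity) hSK hxS hwl zc T hdet hin
  have hfin : h0 ^ n ≤ CB * ρ0 * (CA * (2 * h0) ^ n) :=
    hB1.trans (mul_le_mul_of_nonneg_left hA1 (by positivity))
  rw [mul_pow] at hfin
  have hpw : 0 < h0 ^ n := by positivity
  have h8 := mul_le_mul_of_nonneg_right hρ2 hpw.le
  linarith

end fin
end

end Part21

/-- Theorem 8.1: injectivity of optimal maps to a strongly `c`-convex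
target; i.e. strict `c`-convexity of the potential. -/
theorem strict_c_convexity (n : ℕ) (c : Euc n → Euc n → ℝ)
    (U V Ulam : Set (Euc n)) (u : Euc n → ℝ) (lam Lam : ℝ)
    (hB0 : B0cond n c U V) (hB1 : B1cond n c U V) (hB2 : B2cond n c U V)
    (hB3 : B3cond n c U V) (hB2s : B2scond n c U V)
    (hUlamOpen : IsOpen Ulam) (hUlam : Ulam ⊆ U)
    (hu : CConvexOn n c (closure U) (closure V) u)
    (hlam : 0 < lam) (hLam : 0 < Lam)
    (hge : MAge n c (closure U) (closure V) u lam Ulam)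
    (hle : MAle n c (closure U) (closure V) u (1 / lam) Ulam)
    (hleU : MAle n c (closure U) (closure V) u Lam (closure U)) :
    ∀ x ∈ Ulam, ∀ x' ∈ Ulam, x ≠ x' →
      Disjoint (cSubdiffAt n c (closure U) (closure V) u x)
        (cSubdiffAt n c (closure U) (closure V) u x') := by
  intro x hx x' hx' hne
  rw [Set.disjoint_left]
  intro y h1 h2
  have H : Raw n c U V := ⟨hB0, hB1, hB2, hB2s⟩
  have hUn : U.Nonempty := ⟨x, hUlam hx⟩
  have g1 : (x, y) ∈ Gam n c U V u (cStarT n c (closure U) u) := h1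
  have g2 : (x', y) ∈ Gam n c U V u (cStarT n c (closure U) u) := h2
  have hVn : V.Nonempty := closure_nonempty_iff.1 ⟨y, g1.2.1⟩
  have hGI : ∀ X : Set (Euc n), GI n c U V u (cStarT n c (closure U) u) X =
      cSubdiffImg n c (closure U) (closure V) u X := by
    intro X
    ext z
    simp only [GI, cSubdiffImg, Set.mem_setOf_eq, Set.mem_iUnion, exists_prop]
    rfl
  have S : Sol n c U V Ulam u (cStarT n c (closure U) u) lam Lam :=
    ⟨H, H.mtw hB3, H.pot hUn hVn hu, hUlamOpen, hUlam, hlam, hLam,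
      fun X hX hm => by rw [hGI]; exact hge X hX hm,
      fun X hX hm => by rw [hGI]; exact hleU X hX hm⟩
  exact hne (S.no_two hx g1 g2)
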